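/- Let F = ∪_{i=1}^k P_{t_i} be a linear forest with k ≥ 2, t_i ≥ 2, and at least one t_i even. Set s = Σ ⌊t_i/2⌋ and ε = 1 if exactly one t_i is even, ε = 0 if at least two are even. Then for all sufficiently large n, AR(n, F) = binom(s−2, 2) + (s−2)(n−s+2) + 1 + ε. -/

import Mathlib

open Finset

/-- Number of colors used by the edge-coloring `c` of `K_n`. -/
def colorCount (n : ℕ) (c : Sym2 (Fin n) → ℕ) : ℕ :=
  ((Finset.univ.filter fun e : Sym2 (Fin n) => ¬ e.IsDiag).image c).card

/-- `K_n` colored by `c` contains a rainbow copy of the linear forest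
with path orders `t i`, `i : ι`. -/
def RainbowLF (n : ℕ) (c : Sym2 (Fin n) → ℕ) {ι : Type*} (t : ι → ℕ) : Prop :=
  ∃ p : (i : ι) → Fin (t i) → Fin n,
    Function.Injective (fun q : Σ i, Fin (t i) => p q.1 q.2) ∧
    Function.Injective (fun q : Σ i : ι, {j : ℕ // j + 1 < t i} =>
      c s(p q.1 ⟨q.2.1, Nat.lt_of_succ_lt q.2.2⟩, p q.1 ⟨q.2.1 + 1, q.2.2⟩))

/-- The consecutive pairs of a list. -/
def edgesL {V : Type*} : List V → List (Sym2 V)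
  | [] => []
  | [_] => []
  | x :: y :: l => s(x, y) :: edgesL (y :: l)

section lists
variable {V : Type*}

@[simp] lemma edgesL_nil : edgesL ([] : List V) = [] := rfl
@[simp] lemma edgesL_singleton (x : V) : edgesL [x] = [] := rfl
@[simp] lemma edgesL_cons_cons (x y : V) (l : List V) :
    edgesL (x :: y :: l) = s(x, y) :: edgesL (y :: l) := rfl

lemma length_edgesL_le (l : List V) : (edgesL l).length ≤ l.length := by
  fun_induction edgesL l <;> simp_all

lemma isChain_mem_edgesL (l : List V) : l.IsChain (fun x y => s(x, y) ∈ edgesL l) := by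
  fun_induction edgesL l with
  | case1 => simp
  | case2 => simp
  | case3 x y l ih =>
    refine List.isChain_cons_cons.2 ⟨by simp, ih.imp ?_⟩
    intro a b h
    simp [h]

/-- The alternating list `f 0, g 0, f 1, …, g (m - 1), f m`. -/
def alternating (f g : ℕ → V) (m : ℕ) : List V :=
  (List.range (2 * m + 1)).map fun j => if j % 2 = 0 then f (j / 2) else g (j / 2)

lemma length_alternating (f g : ℕ → V) (m : ℕ) : (alternating f g m).length = 2 * m + 1 := by
  simp [alternating]

lemma head?_alternating (f g : ℕ → V) (m : ℕ) : (alternating f g m).head? = some (f 0) := by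
  rw [alternating, List.range_succ_eq_map]; simp

lemma mem_alternating {f g : ℕ → V} {m : ℕ} {x : V} (hx : x ∈ alternating f g m) :
    (∃ j ≤ m, x = f j) ∨ ∃ j < m, x = g j := by
  simp only [alternating, List.mem_map, List.mem_range] at hx
  obtain ⟨j, hj, rfl⟩ := hx
  split_ifs with h
  · exact Or.inl ⟨j / 2, by omega, rfl⟩
  · exact Or.inr ⟨j / 2, by omega, rfl⟩

lemma nodup_alternating {f g : ℕ → V} {m : ℕ}
    (hf : ∀ i ≤ m, ∀ j ≤ m, f i = f j → i = j) (hg : ∀ i < m, ∀ j < m, g i = g j → i = j)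
    (hfg : ∀ i ≤ m, ∀ j < m, f i ≠ g j) : (alternating f g m).Nodup := by
  refine List.Nodup.map_on ?_ List.nodup_range
  intro i hi j hj h
  rw [List.mem_range] at hi hj
  split_ifs at h with h1 h2 h2
  · have := hf _ (by omega) _ (by omega) h; omega
  · exact absurd h (hfg _ (by omega) _ (by omega))
  · exact absurd h.symm (hfg _ (by omega) _ (by omega))
  · have := hg _ (by omega) _ (by omega) h; omega

lemma isChain_alternating {f g : ℕ → V} {m : ℕ} {R : V → V → Prop}
    (h1 : ∀ i < m, R (f i) (g i)) (h2 : ∀ i < m, R (g i) (f (i + 1))) :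
    (alternating f g m).IsChain R := by
  rw [List.isChain_iff_getElem]
  intro i hi
  rw [length_alternating] at hi
  simp only [alternating, List.getElem_map, List.getElem_range]
  rcases Nat.even_or_odd' i with ⟨k, rfl | rfl⟩
  · rw [if_pos (by omega), if_neg (by omega)]
    have e1 : 2 * k / 2 = k := by omega
    have e2 : (2 * k + 1) / 2 = k := by omega
    rw [e1, e2]; exact h1 _ (by omega)
  · rw [if_neg (by omega), if_pos (by omega)]
    have e1 : (2 * k + 1) / 2 = k := by omega
    have e2 : (2 * k + 1 + 1) / 2 = k + 1 := by omega
    rw [e1, e2]; exact h2 _ (by omega)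

end lists

lemma rainbowLF_of_lists {n k : ℕ} {c : Sym2 (Fin n) → ℕ} {t : Fin k → ℕ}
    (L : Fin k → List (Fin n)) (hlen : ∀ i, t i ≤ (L i).length) (hnd : ∀ i, (L i).Nodup)
    (hdj : ∀ i j, i ≠ j → List.Disjoint (L i) (L j))
    (hcol : ∀ i j (a : ℕ) (ha : a + 1 < (L i).length) (b : ℕ) (hb : b + 1 < (L j).length),
      c s((L i)[a], (L i)[a + 1]) = c s((L j)[b], (L j)[b + 1]) → i = j ∧ a = b) :
    RainbowLF n c t := by
  refine ⟨fun i j => (L i)[j.1]'(j.2.trans_le (hlen i)), ?_, ?_⟩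
  · rintro ⟨i, a⟩ ⟨j, b⟩ h
    dsimp only at h
    obtain rfl : i = j := by
      by_contra hij
      exact hdj i j hij (List.getElem_mem _) (by rw [h]; exact List.getElem_mem _)
    have := (hnd i).getElem_inj_iff.1 h
    rw [Fin.ext this]
  · rintro ⟨i, a, ha⟩ ⟨j, b, hb⟩ h
    obtain ⟨rfl, rfl⟩ := hcol i j a (ha.trans_le (hlen i)) b (hb.trans_le (hlen j)) h
    rfl

lemma rainbowLF_of_injOn {n k : ℕ} {c : Sym2 (Fin n) → ℕ} {t : Fin k → ℕ}
    (L : Fin k → List (Fin n)) (hlen : ∀ i, t i ≤ (L i).length) (hnd : ∀ i, (L i).Nodup)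
    (hdj : ∀ i j, i ≠ j → List.Disjoint (L i) (L j)) (E : Set (Sym2 (Fin n)))
    (hE : Set.InjOn c E) (hL : ∀ i, (L i).IsChain fun x y => s(x, y) ∈ E) :
    RainbowLF n c t := by
  refine rainbowLF_of_lists L hlen hnd hdj ?_
  intro i j a ha b hb h
  have h' := hE (List.isChain_iff_getElem.1 (hL i) a ha) (List.isChain_iff_getElem.1 (hL j) b hb) h
  obtain rfl : i = j := by
    by_contra hij
    rcases Sym2.eq_iff.1 h' with ⟨h1, _⟩ | ⟨h1, _⟩ <;>
    exact hdj i j hij (List.getElem_mem _) (by rw [h1]; exact List.getElem_mem _)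
  refine ⟨rfl, ?_⟩
  rcases Sym2.eq_iff.1 h' with ⟨h1, _⟩ | ⟨h1, h2⟩
  · exact (hnd i).getElem_inj_iff.1 h1
  · have e1 := (hnd i).getElem_inj_iff.1 h1
    have e2 := (hnd i).getElem_inj_iff.1 h2
    omega

/-- `c` is injective on the pairs between `A` and `W`, which are disjoint. -/
def RainbowBip {V : Type*} (c : Sym2 V → ℕ) (A W : Finset V) : Prop :=
  Disjoint A W ∧ ∀ a ∈ A, ∀ a' ∈ A, ∀ w ∈ W, ∀ w' ∈ W, c s(a, w) = c s(a', w') → a = a' ∧ w = w'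

lemma RainbowBip.mono {V : Type*} {c : Sym2 V → ℕ} {A W W' : Finset V} (h : RainbowBip c A W)
    (hW : W' ⊆ W) : RainbowBip c A W' :=
  ⟨h.1.mono_right hW, fun a ha a' ha' w hw w' hw' => h.2 a ha a' ha' w (hW hw) w' (hW hw')⟩

lemma exists_sigma_family {V : Type*} [Nonempty V] {k : ℕ} (h : Fin k → ℕ) (S : Finset V)
    (hS : ∑ i, h i ≤ S.card) :
    ∃ f : Fin k → ℕ → V, (∀ i, ∀ j < h i, f i j ∈ S) ∧
      ∀ i, ∀ j < h i, ∀ i', ∀ j' < h i', f i j = f i' j' → i = i' ∧ j = j' := by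
  classical
  obtain ⟨v0⟩ := ‹Nonempty V›
  have hc : Fintype.card (Σ i, Fin (h i)) ≤ Fintype.card S := by simpa using hS
  obtain ⟨e⟩ := Function.Embedding.nonempty_of_card_le hc
  refine ⟨fun i j => if hj : j < h i then (e ⟨i, ⟨j, hj⟩⟩ : V) else v0, ?_, ?_⟩
  · intro i j hj
    simp [hj]
  · intro i j hj i' j' hj' heq
    simp only [hj, hj', dif_pos] at heq
    have := e.injective (Subtype.ext heq)
    obtain ⟨rfl, h2⟩ := Sigma.mk.inj_iff.1 this
    refine ⟨rfl, ?_⟩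
    simpa using h2

/-- Extending prefixes `P i` of the paths of the forest by alternating paths between a set `A` of
hubs and a large set `W`. -/
lemma rainbowLF_of_prefixes {n k : ℕ} {c : Sym2 (Fin n) → ℕ} {t : Fin k → ℕ}
    {A W : Finset (Fin n)} (hAW : RainbowBip c A W) (P : Fin k → List (Fin n)) (h : Fin k → ℕ)
    (hnd : ∀ i, (P i).Nodup) (hdj : ∀ i j, i ≠ j → List.Disjoint (P i) (P j))
    (hcnd : ∀ i, ((edgesL (P i)).map c).Nodup)
    (hcdj : ∀ i j, i ≠ j → List.Disjoint ((edgesL (P i)).map c) ((edgesL (P j)).map c))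
    (hcov : ∀ i, t i ≤ (P i).length ∨
      ((∀ x ∈ (P i).getLast?, x ∈ A) ∧ t i ≤ (P i).length + 1 + 2 * h i))
    (hA : ∑ i, (h i + (P i).countP (· ∈ A)) ≤ A.card)
    (hW : ∑ i, (2 * (P i).length + h i + 1) ≤ W.card) :
    RainbowLF n c t := by
  classical
  rcases isEmpty_or_nonempty (Fin n) with hV | hV
  · refine rainbowLF_of_lists P (fun i => ?_) hnd hdj ?_
    · have h1 : ∑ i, (2 * (P i).length + h i + 1) = 0 := by
        have : W.card = 0 := by simp [Finset.eq_empty_of_isEmpty W]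
        omega
      have h2 := (Finset.sum_eq_zero_iff.1 h1) i (mem_univ _)
      omega
    · intro i j a ha
      exact (IsEmpty.false (P i)[a]).elim
  set VP : Finset (Fin n) := univ.biUnion fun i => (P i).toFinset with hVP
  set CP : Finset ℕ := univ.biUnion fun i => ((edgesL (P i)).map c).toFinset with hCP
  have hVPc : VP.card ≤ ∑ i, (P i).length :=
    card_biUnion_le.trans (sum_le_sum fun i _ => List.toFinset_card_le _)
  have hCPc : CP.card ≤ ∑ i, (P i).length :=
    card_biUnion_le.trans (sum_le_sum fun i _ => (List.toFinset_card_le _).trans (by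
      simpa using length_edgesL_le (P i)))
  have hVPA : (A ∩ VP).card ≤ ∑ i, (P i).countP (· ∈ A) := by
    rw [hVP, inter_biUnion]
    refine card_biUnion_le.trans (sum_le_sum fun i _ => ?_)
    rw [List.countP_eq_length_filter]
    refine le_trans (card_le_card ?_) (List.toFinset_card_le _)
    intro x hx
    simp only [mem_inter, List.mem_toFinset] at hx
    simp [hx]
  set B := W.filter fun w => ∃ a ∈ A, c s(a, w) ∈ CP with hB
  have hBc : B.card ≤ CP.card := by
    have hex : ∀ w ∈ B, ∃ a ∈ A, c s(a, w) ∈ CP := fun w hw => (mem_filter.1 hw).2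
    choose! f hf1 hf2 using hex
    refine card_le_card_of_injOn (fun w => c s(f w, w)) hf2 ?_
    intro w hw w' hw' he
    exact (hAW.2 _ (hf1 w hw) _ (hf1 w' hw') _ (mem_filter.1 hw).1 _ (mem_filter.1 hw').1 he).2
  set Pool := (W \ VP) \ B with hPool
  have hPoolc : W.card ≤ Pool.card + VP.card + B.card := by
    have h1 := le_card_sdiff VP W
    have h2 : _ ≤ Pool.card := le_card_sdiff B (W \ VP)
    omega
  have hsum : ∑ i, (2 * (P i).length + h i + 1) = 2 * ∑ i, (P i).length + ∑ i, (h i + 1) := by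
    rw [mul_sum, ← sum_add_distrib]; rfl
  obtain ⟨f, hf, hfi⟩ := exists_sigma_family (fun i => h i + 1) Pool (by omega)
  obtain ⟨g, hg, hgi⟩ := exists_sigma_family h (A \ VP) (by
    have := card_sdiff_add_card_inter A VP
    rw [sum_add_distrib] at hA
    omega)
  have hPW : ∀ w ∈ Pool, w ∈ W := fun w hw => (mem_sdiff.1 (mem_sdiff.1 hw).1).1
  have hPV : ∀ w ∈ Pool, w ∉ VP := fun w hw => (mem_sdiff.1 (mem_sdiff.1 hw).1).2
  have hPB : ∀ w ∈ Pool, ∀ a ∈ A, c s(a, w) ∉ CP := fun w hw a ha hc =>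
    (mem_sdiff.1 hw).2 (mem_filter.2 ⟨hPW w hw, a, ha, hc⟩)
  have hfg : ∀ i, ∀ j < h i + 1, ∀ i', ∀ j' < h i', f i j ≠ g i' j' := by
    intro i j hj i' j' hj' he
    exact disjoint_left.1 hAW.1 (mem_sdiff.1 (hg i' j' hj')).1 (he ▸ hPW _ (hf i j hj))
  set T : Fin k → List (Fin n) := fun i =>
    if t i ≤ (P i).length then [] else alternating (f i) (g i) (h i) with hT
  have hTm : ∀ i x, x ∈ T i → (∃ j < h i + 1, x = f i j) ∨ ∃ j < h i, x = g i j := by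
    intro i x hx
    simp only [hT] at hx
    split_ifs at hx
    · simp at hx
    · rcases mem_alternating hx with ⟨j, hj, he⟩ | h'
      · exact Or.inl ⟨j, by omega, he⟩
      · exact Or.inr h'
  have hTV : ∀ i x, x ∈ T i → x ∉ VP := by
    intro i x hx
    rcases hTm i x hx with ⟨j, hj, rfl⟩ | ⟨j, hj, rfl⟩
    · exact hPV _ (hf i j hj)
    · exact (mem_sdiff.1 (hg i j hj)).2
  have hPm : ∀ i x, x ∈ P i → x ∈ VP := by
    intro i x hx
    simp only [hVP, mem_biUnion, mem_univ, true_and, List.mem_toFinset]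
    exact ⟨i, hx⟩
  have hCm : ∀ i e, e ∈ edgesL (P i) → c e ∈ CP := by
    intro i x hx
    simp only [hCP, mem_biUnion, mem_univ, true_and, List.mem_toFinset]
    exact ⟨i, List.mem_map_of_mem hx⟩
  set E : Set (Sym2 (Fin n)) := {e | (∃ i, e ∈ edgesL (P i)) ∨ ∃ a ∈ A, ∃ w ∈ Pool, e = s(a, w)}
    with hE
  refine rainbowLF_of_injOn (fun i => P i ++ T i) (fun i => ?_) (fun i => ?_) (fun i j hij => ?_) E
    ?_ (fun i => ?_)
  · simp only [hT]
    split_ifs with h1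
    · simpa using h1
    · rw [List.length_append, length_alternating]
      have := (hcov i).resolve_left h1
      omega
  · refine List.Nodup.append (hnd i) ?_ fun x hx hx' => hTV i x hx' (hPm i x hx)
    simp only [hT]
    split_ifs with h1
    · simp
    · refine nodup_alternating ?_ ?_ ?_
      · intro a ha b hb hab
        exact (hfi i a (by omega) i b (by omega) hab).2
      · intro a ha b hb hab
        exact (hgi i a ha i b hb hab).2
      · intro a ha b hb
        exact hfg _ _ (by omega) _ _ hb
  · intro x hx hx'
    rw [List.mem_append] at hx hx'
    rcases hx with hx | hx <;> rcases hx' with hx' | hx'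
    · exact hdj i j hij hx hx'
    · exact hTV j x hx' (hPm i x hx)
    · exact hTV i x hx (hPm j x hx')
    · rcases hTm i x hx with ⟨a, ha, rfl⟩ | ⟨a, ha, rfl⟩ <;>
        rcases hTm j _ hx' with ⟨b, hb, hab⟩ | ⟨b, hb, hab⟩
      · exact hij (hfi _ _ ha _ _ hb hab).1
      · exact hfg _ _ ha _ _ hb hab
      · exact hfg _ _ hb _ _ ha hab.symm
      · exact hij (hgi _ _ ha _ _ hb hab).1
  · rintro e (⟨i, he⟩ | ⟨a, ha, w, hw, rfl⟩) e' (⟨i', he'⟩ | ⟨a', ha', w', hw', rfl⟩) hc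
    · obtain rfl : i = i' := by
        by_contra hii
        exact hcdj i i' hii (List.mem_map_of_mem he) (hc ▸ List.mem_map_of_mem he')
      exact List.inj_on_of_nodup_map (hcnd i) he he' hc
    · exact (hPB w' hw' a' ha' (hc ▸ hCm i e he)).elim
    · exact (hPB w hw a ha (hc ▸ hCm i' e' he')).elim
    · obtain ⟨rfl, rfl⟩ := hAW.2 a ha a' ha' w (hPW w hw) w' (hPW w' hw') hc
      rfl
  · refine List.isChain_append.2 ⟨?_, ?_, ?_⟩
    · exact (isChain_mem_edgesL (P i)).imp fun x y hxy => Or.inl ⟨i, hxy⟩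
    · simp only [hT]
      split_ifs
      · simp
      · refine isChain_alternating ?_ ?_
        · intro j hj
          exact Or.inr ⟨_, (mem_sdiff.1 (hg i j hj)).1, _, hf i j (by omega), Sym2.eq_swap⟩
        · intro j hj
          exact Or.inr ⟨_, (mem_sdiff.1 (hg i j hj)).1, _, hf i (j + 1) (by omega), rfl⟩
    · intro x hx y hy
      simp only [hT] at hy
      split_ifs at hy with h1
      · simp at hy
      · rw [head?_alternating] at hy
        obtain rfl : f i 0 = y := by simpa using hy
        exact Or.inr ⟨x, ((hcov i).resolve_left h1).1 x hx, _, hf i 0 (by omega), rfl⟩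

lemma sum_if_two {k : ℕ} {i₁ i₂ : Fin k} (hi : i₁ ≠ i₂) (x y : ℕ) (f : Fin k → ℕ) :
    ∑ i, (if i = i₁ then x else if i = i₂ then y else f i) + f i₁ + f i₂ = x + y + ∑ i, f i := by
  have key : ∀ g : Fin k → ℕ, ∑ i, g i = g i₁ + (g i₂ + ∑ i ∈ (univ.erase i₁).erase i₂, g i) := by
    intro g
    rw [← add_sum_erase univ g (mem_univ i₁), ← add_sum_erase (univ.erase i₁) g (a := i₂)]
    simp [hi.symm]
  rw [key, key f]
  have : ∑ i ∈ (univ.erase i₁).erase i₂, (if i = i₁ then x else if i = i₂ then y else f i)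
      = ∑ i ∈ (univ.erase i₁).erase i₂, f i := by
    refine sum_congr rfl fun i hi' => ?_
    simp only [mem_erase] at hi'
    simp [hi'.1, hi'.2.1]
  rw [this]
  simp [hi.symm]
  omega

/-- A version of `rainbowLF_of_prefixes` with prefixes for two of the paths only. -/
lemma rainbowLF_of_two {n k : ℕ} {c : Sym2 (Fin n) → ℕ} {t : Fin k → ℕ} (ht : ∀ i, 2 ≤ t i)
    {A W : Finset (Fin n)} (hAW : RainbowBip c A W) {s : ℕ} (hs : s = ∑ i, t i / 2)
    (hAs : s ≤ A.card + 2) {i₁ i₂ : Fin k} (hi : i₁ ≠ i₂) (P₁ P₂ : List (Fin n)) (h₁ h₂ : ℕ)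
    (hnd : (P₁ ++ P₂).Nodup) (hcnd : ((edgesL P₁ ++ edgesL P₂).map c).Nodup)
    (hcov₁ : t i₁ ≤ P₁.length ∨
      ((∀ x ∈ P₁.getLast?, x ∈ A) ∧ t i₁ ≤ P₁.length + 1 + 2 * h₁))
    (hcov₂ : t i₂ ≤ P₂.length ∨
      ((∀ x ∈ P₂.getLast?, x ∈ A) ∧ t i₂ ≤ P₂.length + 1 + 2 * h₂))
    (hcost : h₁ + P₁.countP (· ∈ A) + (h₂ + P₂.countP (· ∈ A)) + 2 ≤ t i₁ / 2 + t i₂ / 2)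
    (hW : 2 * (P₁.length + P₂.length) + h₁ + h₂ + 2 * s ≤ W.card) :
    RainbowLF n c t := by
  have hi' := hi.symm
  rw [List.nodup_append'] at hnd
  rw [List.map_append, List.nodup_append'] at hcnd
  obtain ⟨hn₁, hn₂, hn⟩ := hnd
  obtain ⟨hc₁, hc₂, hc⟩ := hcnd
  have hb : ∀ i, 1 ≤ t i / 2 := fun i => by have := ht i; omega
  have e1 := sum_if_two hi (h₁ + P₁.countP (· ∈ A)) (h₂ + P₂.countP (· ∈ A)) fun i => t i / 2
  have e2 := sum_if_two hi (2 * P₁.length + h₁ + 1) (2 * P₂.length + h₂ + 1)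
    fun i => t i / 2 + 1
  refine rainbowLF_of_prefixes hAW (fun i => if i = i₁ then P₁ else if i = i₂ then P₂ else [])
    (fun i => if i = i₁ then h₁ else if i = i₂ then h₂ else t i / 2) ?_ ?_ ?_ ?_ ?_ ?_ ?_
  · intro i; split_ifs <;> simp [*]
  · intro i j hij
    split_ifs <;> simp_all [List.Disjoint.symm]
  · intro i; split_ifs <;> simp [*]
  · intro i j hij
    split_ifs <;> simp_all [List.Disjoint.symm]
  · intro i; split_ifs with h1 h2
    · subst h1; exact hcov₁
    · subst h2; exact hcov₂
    · right; simp; omega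
  · refine le_trans (le_of_eq (b := ∑ i, (if i = i₁ then h₁ + P₁.countP (· ∈ A)
      else if i = i₂ then h₂ + P₂.countP (· ∈ A) else t i / 2)) (sum_congr rfl fun i _ => ?_))
      (by omega)
    split_ifs <;> simp
  · have hk : ∑ i, (t i / 2 + 1) ≤ 2 * s := by
      rw [hs, mul_sum]; exact sum_le_sum fun i _ => by have := hb i; omega
    have := hb i₁
    have := hb i₂
    refine le_trans (le_of_eq (b := ∑ i, (if i = i₁ then 2 * P₁.length + h₁ + 1
      else if i = i₂ then 2 * P₂.length + h₂ + 1 else t i / 2 + 1)) (sum_congr rfl fun i _ => ?_))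
      (by omega)
    split_ifs <;> simp

lemma choose_two_add (q r : ℕ) : (q + r).choose 2 = q.choose 2 + q * r + r.choose 2 := by
  induction r with
  | zero => simp
  | succ r ih =>
    rw [← add_assoc, Nat.choose_succ_succ' (q + r), ih, Nat.choose_succ_succ' r]
    simp
    ring

lemma nondiag_eq_image_offDiag {V : Type*} [Fintype V] [DecidableEq V] :
    (univ.filter fun e : Sym2 V => ¬ e.IsDiag) = (univ : Finset V).offDiag.image (Function.uncurry Sym2.mk) := by
  ext e
  induction e with
  | _ x y =>
    simp only [mem_filter, mem_univ, true_and, Sym2.mk_isDiag_iff, mem_image, mem_offDiag]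
    constructor
    · intro h; exact ⟨(x, y), h, rfl⟩
    · rintro ⟨⟨a, b⟩, hab, h⟩
      rcases Sym2.eq_iff.1 h with ⟨rfl, rfl⟩ | ⟨rfl, rfl⟩
      · exact hab
      · exact fun h => hab h.symm

lemma card_edges_touching {V : Type*} [Fintype V] [DecidableEq V] (A : Finset V) :
    (univ.filter fun e : Sym2 V => ¬ e.IsDiag ∧ ∃ a ∈ A, a ∈ e).card
      = A.card.choose 2 + A.card * (Fintype.card V - A.card) := by
  have h1 : (univ.filter fun e : Sym2 V => ¬ e.IsDiag).card = (Fintype.card V).choose 2 := by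
    rw [nondiag_eq_image_offDiag, Sym2.card_image_offDiag, card_univ]
  have h2 : (univ.filter fun e : Sym2 V => ¬ e.IsDiag ∧ ¬ ∃ a ∈ A, a ∈ e)
      = Aᶜ.offDiag.image (Function.uncurry Sym2.mk) := by
    ext e
    induction e with
    | _ x y =>
      simp only [mem_filter, mem_univ, true_and, Sym2.mk_isDiag_iff, mem_image, mem_offDiag,
        Sym2.mem_iff, mem_compl]
      constructor
      · intro h
        exact ⟨(x, y), ⟨fun hx => h.2 ⟨x, hx, Or.inl rfl⟩, fun hx => h.2 ⟨y, hx, Or.inr rfl⟩, h.1⟩,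
          rfl⟩
      · rintro ⟨⟨a, b⟩, ⟨ha, hb, hab⟩, h⟩
        rcases Sym2.eq_iff.1 h with ⟨rfl, rfl⟩ | ⟨rfl, rfl⟩
        · exact ⟨hab, by rintro ⟨v, hv, rfl | rfl⟩ <;> contradiction⟩
        · exact ⟨fun h => hab h.symm, by rintro ⟨v, hv, rfl | rfl⟩ <;> contradiction⟩
  have h3 := card_filter_add_card_filter_not
    (s := univ.filter fun e : Sym2 V => ¬ e.IsDiag) (fun e : Sym2 V => ∃ a ∈ A, a ∈ e)
  rw [filter_filter, filter_filter, h1, h2, Sym2.card_image_offDiag, card_compl] at h3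
  have h4 := choose_two_add A.card (Fintype.card V - A.card)
  rw [Nat.add_sub_cancel' (card_le_univ A)] at h4
  omega

/-- The edges touching the first `q` vertices get distinct colors, `e₀` gets the color `1` when
`ε = 1`, and all the other edges get the color `0`. -/
noncomputable def extremalColoring (n q ε : ℕ) (e₀ : Sym2 (Fin n)) (e : Sym2 (Fin n)) : ℕ :=
  open Classical in
  if ∃ v ∈ e, v.1 < q then Fintype.equivFin (Sym2 (Fin n)) e + 2
  else if ε = 1 ∧ e = e₀ then 1 else 0

lemma extremalColoring_inj {n q ε : ℕ} {e₀ e e' : Sym2 (Fin n)} (he : ∃ v ∈ e, v.1 < q)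
    (h : extremalColoring n q ε e₀ e = extremalColoring n q ε e₀ e') : e = e' := by
  unfold extremalColoring at h
  rw [if_pos he] at h
  split_ifs at h
  · exact (Fintype.equivFin _).injective (Fin.ext (by omega))
  all_goals omega

lemma extremalColoring_le {n q ε : ℕ} {e₀ e : Sym2 (Fin n)} (he : ¬ ∃ v ∈ e, v.1 < q) :
    extremalColoring n q ε e₀ e ≤ 1 ∧ (ε = 0 → extremalColoring n q ε e₀ e = 0) := by
  unfold extremalColoring
  rw [if_neg he]
  split_ifs with h <;> simp
  omega

lemma colorCount_extremalColoring {n q ε : ℕ} {x y z : Fin n} (hε : ε ≤ 1) (hx : q ≤ x) (hy : q ≤ y)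
    (hz : q ≤ z) (hxy : x ≠ y) (hyz : y ≠ z) (hxz : x ≠ z) :
    colorCount n (extremalColoring n q ε s(x, y)) = q.choose 2 + q * (n - q) + 1 + ε := by
  classical
  set c := extremalColoring n q ε s(x, y) with hc
  set A : Finset (Fin n) := univ.filter fun v => v.1 < q with hA
  have hAc : A.card = q := by
    have : q ≤ n := hx.trans x.2.le
    rw [hA, Fin.card_filter_val_lt, min_eq_right this]
  set T := univ.filter fun e : Sym2 (Fin n) => ¬ e.IsDiag ∧ ∃ a ∈ A, a ∈ e with hTdef
  have hT : T.card = q.choose 2 + q * (n - q) := by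
    rw [hTdef, ← hAc]
    convert card_edges_touching A
    rw [Fintype.card_fin]
  have hmem : ∀ e : Sym2 (Fin n), (∃ a ∈ A, a ∈ e) ↔ ∃ v ∈ e, v.1 < q := by
    intro e
    simp [hA, and_comm]
  have hcx : c s(x, y) = ε := by
    rw [hc, extremalColoring, if_neg (by simp; omega)]
    split_ifs with h
    · exact h.1.symm
    · have : ε ≠ 1 := fun h' => h ⟨h', rfl⟩
      omega
  have hcz : c s(x, z) = 0 := by
    rw [hc, extremalColoring, if_neg (by simp; omega), if_neg]
    rintro ⟨-, h⟩
    rcases Sym2.eq_iff.1 h with ⟨-, h⟩ | ⟨h, -⟩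
    · exact hyz h.symm
    · exact hxy h
  have himg : (univ.filter fun e : Sym2 (Fin n) => ¬ e.IsDiag).image c
      = T.image c ∪ (range (ε + 1)) := by
    ext m
    simp only [mem_image, mem_filter, mem_univ, true_and, mem_union, mem_range, hTdef, hmem]
    constructor
    · rintro ⟨e, he, rfl⟩
      by_cases h : ∃ v ∈ e, v.1 < q
      · exact Or.inl ⟨e, ⟨he, h⟩, rfl⟩
      · have := extremalColoring_le (ε := ε) (e₀ := s(x, y)) h
        rw [← hc] at this
        right; omega
    · rintro (⟨e, ⟨he, -⟩, rfl⟩ | h)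
      · exact ⟨e, he, rfl⟩
      · rcases Nat.eq_zero_or_pos m with rfl | hm
        · exact ⟨s(x, z), by simpa using hxz, hcz⟩
        · exact ⟨s(x, y), by simpa using hxy, by omega⟩
  have hinj : Set.InjOn c T := by
    intro e he e' he' h
    simp only [hTdef, coe_filter, mem_univ, true_and, Set.mem_ofPred_eq, hmem] at he
    exact extremalColoring_inj he.2 h
  have hdj : Disjoint (T.image c) (range (ε + 1)) := by
    rw [disjoint_left]
    intro m hm hm'
    obtain ⟨e, he, rfl⟩ := mem_image.1 hm
    simp only [hTdef, mem_filter, mem_univ, true_and, hmem] at he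
    rw [mem_range, hc, extremalColoring, if_pos he.2] at hm'
    omega
  rw [colorCount]
  convert_to ((univ.filter fun e : Sym2 (Fin n) => ¬ e.IsDiag).image c).card = _
  rw [himg, card_union_of_disjoint hdj, card_image_of_injOn hinj, hT, card_range]
  omega

lemma not_rainbowLF_extremalColoring {n q k : ℕ} {t : Fin k → ℕ} (e₀ : Sym2 (Fin n))
    (hq : q + 2 ≤ ∑ i, t i / 2) : ¬ RainbowLF n (extremalColoring n q 0 e₀) t := by
  classical
  rintro ⟨p, hp, hc⟩
  have hlt : ∀ x : Σ i, Fin (t i / 2), 2 * x.2.1 + 1 < t x.1 := fun x => by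
    have := x.2.2; omega
  set f : (Σ i, Fin (t i / 2)) → Σ i, {j : ℕ // j + 1 < t i} :=
    fun x => ⟨x.1, ⟨2 * x.2.1, hlt x⟩⟩ with hf
  set u : (Σ i, Fin (t i / 2)) → Fin n := fun x => p x.1 ⟨2 * x.2.1, by have := hlt x; omega⟩
  set v : (Σ i, Fin (t i / 2)) → Fin n := fun x => p x.1 ⟨2 * x.2.1 + 1, hlt x⟩
  have hinj : ∀ (x y : Σ i, Fin (t i / 2)) (a b : ℕ) (ha : a < t x.1) (hb : b < t y.1),
      p x.1 ⟨a, ha⟩ = p y.1 ⟨b, hb⟩ → x.1 = y.1 ∧ a = b := by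
    intro x y a b ha hb h
    have := @hp ⟨x.1, ⟨a, ha⟩⟩ ⟨y.1, ⟨b, hb⟩⟩ h
    obtain ⟨x1, x2⟩ := x
    obtain ⟨y1, y2⟩ := y
    obtain ⟨rfl, h2⟩ := Sigma.mk.inj_iff.1 this
    exact ⟨rfl, by simpa using h2⟩
  have hext : ∀ x y : Σ i, Fin (t i / 2), x.1 = y.1 → x.2.1 = y.2.1 → x = y := by
    rintro ⟨i, a⟩ ⟨j, b⟩ h1 h2
    obtain rfl : i = j := h1
    obtain rfl : a = b := Fin.ext h2
    rfl
  set φ : (Σ i, Fin (t i / 2)) → Fin q ⊕ Unit := fun x =>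
    if hu : (u x).1 < q then Sum.inl ⟨_, hu⟩ else if hv : (v x).1 < q then Sum.inl ⟨_, hv⟩
    else Sum.inr () with hφ
  have hφi : Function.Injective φ := by
    intro x y h
    simp only [hφ] at h
    split_ifs at h with h1 h2 h3 h4 h5 h6 h7
    · have := hinj _ _ _ _ _ _ (Fin.ext (by simpa using h) : u x = u y)
      exact hext _ _ this.1 (by omega)
    · have := hinj _ _ _ _ _ _ (Fin.ext (by simpa using h) : u x = v y)
      omega
    · have := hinj _ _ _ _ _ _ (Fin.ext (by simpa using h) : v x = u y)
      omega
    · have := hinj _ _ _ _ _ _ (Fin.ext (by simpa using h) : v x = v y)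
      exact hext _ _ this.1 (by omega)
    · have e1 : extremalColoring n q 0 e₀ s(u x, v x) = 0 :=
        (extremalColoring_le (by simp; omega)).2 rfl
      have e2 : extremalColoring n q 0 e₀ s(u y, v y) = 0 :=
        (extremalColoring_le (by simp; omega)).2 rfl
      have := @hc (f x) (f y) (e1.trans e2.symm)
      obtain ⟨x1, x2⟩ := x
      obtain ⟨y1, y2⟩ := y
      obtain ⟨rfl, h2⟩ := Sigma.mk.inj_iff.1 this
      refine hext _ _ rfl ?_
      have : 2 * x2.1 = 2 * y2.1 := by simpa using h2
      simpa using this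
  have := Fintype.card_le_of_injective φ hφi
  simp at this
  omega

lemma not_rainbowLF_extremalColoring_one {n q k : ℕ} {t : Fin k → ℕ} (e₀ : Sym2 (Fin n))
    (hq : 2 * q + 3 ≤ ∑ i, (t i - 1)) : ¬ RainbowLF n (extremalColoring n q 1 e₀) t := by
  classical
  rintro ⟨p, hp, hc⟩
  have hlt : ∀ x : Σ i, Fin (t i - 1), x.2.1 + 1 < t x.1 := fun x => by
    have := x.2.2; omega
  set f : (Σ i, Fin (t i - 1)) → Σ i, {j : ℕ // j + 1 < t i} :=
    fun x => ⟨x.1, ⟨x.2.1, hlt x⟩⟩ with hf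
  set u : (Σ i, Fin (t i - 1)) → Fin n := fun x => p x.1 ⟨x.2.1, by have := hlt x; omega⟩
  set v : (Σ i, Fin (t i - 1)) → Fin n := fun x => p x.1 ⟨x.2.1 + 1, hlt x⟩
  have hinj : ∀ (x y : Σ i, Fin (t i - 1)) (a b : ℕ) (ha : a < t x.1) (hb : b < t y.1),
      p x.1 ⟨a, ha⟩ = p y.1 ⟨b, hb⟩ → x.1 = y.1 ∧ a = b := by
    intro x y a b ha hb h
    have := @hp ⟨x.1, ⟨a, ha⟩⟩ ⟨y.1, ⟨b, hb⟩⟩ h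
    obtain ⟨x1, x2⟩ := x
    obtain ⟨y1, y2⟩ := y
    obtain ⟨rfl, h2⟩ := Sigma.mk.inj_iff.1 this
    exact ⟨rfl, by simpa using h2⟩
  have hext : ∀ x y : Σ i, Fin (t i - 1), x.1 = y.1 → x.2.1 = y.2.1 → x = y := by
    rintro ⟨i, a⟩ ⟨j, b⟩ h1 h2
    obtain rfl : i = j := h1
    obtain rfl : a = b := Fin.ext h2
    rfl
  have hle : ∀ x, ¬ (u x).1 < q → ¬ (v x).1 < q →
      extremalColoring n q 1 e₀ s(u x, v x) ≤ 1 := by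
    intro x h1 h2
    exact (extremalColoring_le (by simp; omega)).1
  set φ : (Σ i, Fin (t i - 1)) → (Fin q × Bool) ⊕ Fin 2 := fun x =>
    if hu : (u x).1 < q then Sum.inl (⟨_, hu⟩, true)
    else if hv : (v x).1 < q then Sum.inl (⟨_, hv⟩, false)
    else Sum.inr ⟨extremalColoring n q 1 e₀ s(u x, v x), by
      have := hle x hu hv; omega⟩ with hφ
  have hφi : Function.Injective φ := by
    intro x y h
    simp only [hφ] at h
    split_ifs at h with h1 h2 h3 h4 h5 h6 h7
    · have := hinj _ _ _ _ _ _ (Fin.ext (by simpa using h) : u x = u y)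
      exact hext _ _ this.1 (by omega)
    · simp at h
    · simp at h
    · have := hinj _ _ _ _ _ _ (Fin.ext (by simpa using h) : v x = v y)
      exact hext _ _ this.1 (by omega)
    · have h' : extremalColoring n q 1 e₀ s(u x, v x) = extremalColoring n q 1 e₀ s(u y, v y) := by
        simpa using h
      have := @hc (f x) (f y) h'
      obtain ⟨x1, x2⟩ := x
      obtain ⟨y1, y2⟩ := y
      obtain ⟨rfl, h2⟩ := Sigma.mk.inj_iff.1 this
      exact hext _ _ rfl (by simpa using h2)
  have := Fintype.card_le_of_injective φ hφi
  simp at this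
  omega

lemma two_mul_sum_half {k : ℕ} (t : Fin k → ℕ) (ht : ∀ i, 2 ≤ t i) :
    2 * ∑ i, t i / 2 = ∑ i, (t i - 1) + (univ.filter fun i => Even (t i)).card := by
  rw [card_filter, mul_sum, ← sum_add_distrib]
  refine sum_congr rfl fun i _ => ?_
  have := ht i
  split_ifs with h
  · obtain ⟨r, hr⟩ := h; omega
  · obtain ⟨r, hr⟩ := Nat.not_even_iff_odd.1 h; omega

lemma exists_extremal_coloring {n k s ε : ℕ} {t : Fin k → ℕ} (ht : ∀ i, 2 ≤ t i) (h2 : 2 ≤ s)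
    (hs : s = ∑ i, t i / 2)
    (hε : ε = if (Finset.univ.filter fun i => Even (t i)).card = 1 then 1 else 0)
    (hn : s + 1 ≤ n) :
    ∃ c : Sym2 (Fin n) → ℕ,
      colorCount n c = (s - 2).choose 2 + (s - 2) * (n - s + 2) + 1 + ε ∧ ¬ RainbowLF n c t := by
  refine ⟨extremalColoring n (s - 2) ε
    s((⟨s - 2, by omega⟩ : Fin n), (⟨s - 1, by omega⟩ : Fin n)), ?_, ?_⟩
  · rw [colorCount_extremalColoring (z := ⟨s, by omega⟩)]
    · congr 4; omega
    · rw [hε]; split_ifs <;> omega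
    all_goals simp
    all_goals omega
  · split_ifs at hε with h
    · subst hε
      refine not_rainbowLF_extremalColoring_one _ ?_
      have := two_mul_sum_half t ht
      omega
    · subst hε
      exact not_rainbowLF_extremalColoring _ (by omega)

/-- The number of neighbors of `x` in `S`. -/
noncomputable def nbrCount {V : Type*} (G : SimpleGraph V) (x : V) (S : Finset V) : ℕ :=
  open Classical in (S.filter (G.Adj x)).card

/-- A path of `G` in `S`, with at most `q + 2` vertices, whose length together with the weight of
its last vertex is at least `q + 2`. -/
def IsPiece {V : Type*} (G : SimpleGraph V) (I : V → ℕ) (q : ℕ) (S : Finset V) (l : List V) :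
    Prop :=
  l.Nodup ∧ l.IsChain G.Adj ∧ (∀ x ∈ l, x ∈ S) ∧ l.length ≤ q + 2 ∧
    ∃ z, l.getLast? = some z ∧ q + 2 ≤ I z + l.length

section
variable {V : Type*} {G : SimpleGraph V}

lemma IsPiece.mono {I : V → ℕ} {q : ℕ} {S S' : Finset V} {l : List V} (h : IsPiece G I q S l)
    (hS : S ⊆ S') : IsPiece G I q S' l :=
  ⟨h.1, h.2.1, fun x hx => hS (h.2.2.1 x hx), h.2.2.2⟩

lemma nbrCount_eq_sum (x : V) (S : Finset V) :
    nbrCount G x S = open Classical in ∑ y ∈ S, if G.Adj x y then 1 else 0 := by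
  rw [nbrCount, card_filter]

lemma sum_nbrCount_comm (S T : Finset V) :
    ∑ x ∈ S, nbrCount G x T = ∑ y ∈ T, nbrCount G y S := by
  classical
  simp_rw [nbrCount_eq_sum]
  rw [sum_comm]
  exact sum_congr rfl fun y _ => sum_congr rfl fun x _ => if_congr (G.adj_comm _ _) rfl rfl

lemma nbrCount_le_card (x : V) (S : Finset V) : nbrCount G x S ≤ S.card := by
  classical
  rw [nbrCount]; exact card_filter_le _ _

variable [DecidableEq V]

lemma nbrCount_union (x : V) {S T : Finset V} (h : Disjoint S T) :
    nbrCount G x (S ∪ T) = nbrCount G x S + nbrCount G x T := by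
  simp_rw [nbrCount_eq_sum]
  exact sum_union h

lemma nbrCount_erase (x : V) {S : Finset V} {v : V} (hv : v ∈ S) :
    nbrCount G x S = nbrCount G x (S.erase v) + open Classical in if G.Adj x v then 1 else 0 := by
  simp_rw [nbrCount_eq_sum]
  rw [sum_erase_add _ _ hv]

lemma sum_nbrCount_erase {S : Finset V} {v : V} (hv : v ∈ S) :
    ∑ x ∈ S, nbrCount G x S = ∑ x ∈ S.erase v, nbrCount G x (S.erase v) + 2 * nbrCount G v S := by
  classical
  rw [← sum_erase_add _ _ hv, sum_congr rfl fun x _ => nbrCount_erase x hv, sum_add_distrib]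
  have : (open Classical in ∑ x ∈ S.erase v, if G.Adj x v then 1 else 0)
      = nbrCount G v (S.erase v) := by
    rw [nbrCount_eq_sum]; exact sum_congr rfl fun x _ => if_congr (G.adj_comm _ _) rfl rfl
  rw [this]
  have h2 := nbrCount_erase (G := G) v hv
  simp only [SimpleGraph.irrefl, if_false, add_zero] at h2
  omega

/-- A long path can be grown greedily when all degrees are large. -/
lemma exists_path_of_nbrCount {S : Finset V} {d : ℕ} (hd : ∀ x ∈ S, d ≤ nbrCount G x S) {z : V}
    (hz : z ∈ S) (m : ℕ) (hm : m ≤ d) :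
    ∃ l : List V, l.length = m + 1 ∧ l.Nodup ∧ l.IsChain G.Adj ∧ (∀ x ∈ l, x ∈ S) ∧
      l.getLast? = some z := by
  classical
  induction m with
  | zero => exact ⟨[z], by simp, by simp, by simp, by simpa, by simp⟩
  | succ m ih =>
    obtain ⟨l, hl, hn, hch, hS, hz⟩ := ih (by omega)
    match l, hl with
    | y :: l, hl =>
    have h1 := hd y (hS y (by simp))
    rw [nbrCount] at h1
    have h2 : l.toFinset.card < (S.filter (G.Adj y)).card := by
      have := List.toFinset_card_le l
      simp at hl; omega
    obtain ⟨w, hw, hw'⟩ := exists_mem_notMem_of_card_lt_card h2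
    rw [mem_filter] at hw
    refine ⟨w :: y :: l, by simpa using hl, ?_, ?_, ?_, ?_⟩
    · refine List.nodup_cons.2 ⟨?_, hn⟩
      simp only [List.mem_cons, not_or]
      exact ⟨hw.2.ne', by simpa using hw'⟩
    · exact List.isChain_cons_cons.2 ⟨hw.2.symm, hch⟩
    · intro x hx
      rcases List.mem_cons.1 hx with rfl | hx
      · exact hw.1
      · exact hS x hx
    · simpa using hz

lemma nbrCount_le_of_not_isPiece {I : V → ℕ} {q : ℕ} {S : Finset V}
    (hno : ∀ l, ¬ IsPiece G I q S l) {y z : V} {l : List V} (hn : (y :: l).Nodup)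
    (hch : (y :: l).IsChain G.Adj) (hS : ∀ x ∈ y :: l, x ∈ S) (hz : (y :: l).getLast? = some z)
    (hlen : (y :: l).length ≤ q + 1) (hI : q + 1 ≤ I z + (y :: l).length) :
    ∀ w ∈ S, G.Adj y w → w ∈ l := by
  intro w hw hyw
  by_contra hwl
  refine hno (w :: y :: l) ⟨?_, ?_, ?_, ?_, z, ?_, ?_⟩
  · refine List.nodup_cons.2 ⟨?_, hn⟩
    simp only [List.mem_cons, not_or]
    exact ⟨hyw.ne', hwl⟩
  · exact List.isChain_cons_cons.2 ⟨hyw.symm, hch⟩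
  · intro x hx
    rcases List.mem_cons.1 hx with rfl | hx
    · exact hw
    · exact hS x hx
  · simp at hlen ⊢; omega
  · simpa using hz
  · simp at hI ⊢; omega

lemma sum_le_of_not_isPiece (I : V → ℕ) (q : ℕ) (S : Finset V)
    (hno : ∀ l, ¬ IsPiece G I q S l) :
    ∑ x ∈ S, (2 * I x + nbrCount G x S) + (S.filter fun x => I x < q).card ≤ 2 * q * S.card := by
  classical
  induction hc : S.card using Nat.strong_induction_on generalizing S with
  | _ m ih =>
  subst hc
  have hno' : ∀ v, ∀ l, ¬ IsPiece G I q (S.erase v) l := fun v l hl =>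
    hno l (hl.mono (erase_subset _ _))
  have hstep : ∀ (S : Finset V), ∀ v ∈ S,
      ∑ x ∈ S, (2 * I x + nbrCount G x S) + (S.filter fun x => I x < q).card =
      ∑ x ∈ S.erase v, (2 * I x + nbrCount G x (S.erase v)) +
        ((S.erase v).filter fun x => I x < q).card + 2 * (I v + nbrCount G v S) +
        (if I v < q then 1 else 0) := by
    intro S v hv
    rw [sum_add_distrib, sum_add_distrib, sum_nbrCount_erase hv,
      ← sum_erase_add _ (fun x => 2 * I x) hv, card_filter, card_filter,
      ← sum_erase_add _ (fun x => if I x < q then 1 else 0) hv]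
    ring
  have hIq : ∀ x ∈ S, I x ≤ q := by
    intro x hx
    by_contra hI
    exact hno [x] ⟨by simp, by simp, by simpa, by simp, x, by simp, by simp; omega⟩
  by_cases h1 : ∃ x ∈ S, I x + nbrCount G x S < q
  · obtain ⟨x, hx, hlt⟩ := h1
    have h2 := ih _ (card_erase_lt_of_mem hx) _ (hno' x) rfl
    have h3 := hstep S x hx
    have h4 := card_erase_add_one hx
    rw [← h4, mul_add]
    split_ifs at h3 <;> omega
  push Not at h1
  by_cases h2 : ∃ x ∈ S, q ≤ I x
  · obtain ⟨x, hx, hle⟩ := h2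
    have hd : nbrCount G x S = 0 := by
      rw [nbrCount, card_eq_zero, filter_eq_empty_iff]
      intro y hy hxy
      exact hno [y, x] ⟨by simpa using hxy.ne', by simpa using hxy.symm, by simp [hx, hy],
        by simp, x, by simp, by simp; omega⟩
    have h2 := ih _ (card_erase_lt_of_mem hx) _ (hno' x) rfl
    have h3 := hstep S x hx
    have h4 := card_erase_add_one hx
    have h5 := hIq x hx
    rw [← h4, mul_add]
    split_ifs at h3 <;> omega
  push Not at h2
  rcases S.eq_empty_or_nonempty with rfl | hne
  · simp
  obtain ⟨z, hz, hmax⟩ := exists_max_image S I hne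
  have hzq := h2 z hz
  obtain ⟨l, hl, hn, hch, hS, hlz⟩ := exists_path_of_nbrCount (G := G) (S := S) (d := q - I z)
    (fun x hx => by have := hmax x hx; have := h1 x hx; omega) hz (q - I z) le_rfl
  match l, hl with
  | y :: l, hl =>
  have hy : y ∈ S := hS y (by simp)
  have hyl := nbrCount_le_of_not_isPiece hno hn hch hS hlz (by omega) (by omega)
  have hll : l.length = q - I z := by simpa using hl
  have hsub : S.filter (G.Adj y) ⊆ l.toFinset := by
    intro w hw
    rw [mem_filter] at hw
    exact List.mem_toFinset.2 (hyl w hw.1 hw.2)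
  have hlc := List.toFinset_card_le l
  have hyd : nbrCount G y S ≤ q - I z := by
    rw [nbrCount]; exact (card_le_card hsub).trans (by omega)
  have hyI := h1 y hy
  have hyz := hmax y hy
  have heq : S.filter (G.Adj y) = l.toFinset := by
    refine eq_of_subset_of_card_le hsub ?_
    rw [nbrCount] at hyI
    omega
  have hzl : z ∈ l := by
    match l, hll with
    | [], hll => simp at hll; omega
    | a :: l, _ =>
      rw [List.getLast?_cons_cons] at hlz
      exact List.mem_of_getLast? hlz
  have hadj : G.Adj y z := by
    have : z ∈ S.filter (G.Adj y) := by rw [heq]; simpa using hzl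
    exact (mem_filter.1 this).2
  have hzd : nbrCount G z S ≤ q - I z := by
    obtain ⟨r, hr⟩ : ∃ r, (y :: l).reverse = z :: r := by
      have : (y :: l).reverse.head? = some z := by rw [List.head?_reverse, hlz]
      exact List.head?_eq_some_iff.1 this
    have hrl : r.length = q - I z := by
      have := congrArg List.length hr
      simp at this; omega
    have := nbrCount_le_of_not_isPiece (z := y) (y := z) (l := r) hno
      (by rw [← hr]; exact List.nodup_reverse.2 hn)
      (by rw [← hr, List.isChain_reverse]; exact hch.imp fun a b h => h.symm)
      (by rw [← hr]; exact fun x hx => hS x (List.mem_reverse.1 hx)) (by rw [← hr]; simp) (by simp; omega) (by simp; omega)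
    rw [nbrCount]
    refine (card_le_card (t := r.toFinset) ?_).trans ((List.toFinset_card_le _).trans (by omega))
    intro w hw
    rw [mem_filter] at hw
    exact List.mem_toFinset.2 (this w hw.1 hw.2)
  have hyne : y ≠ z := hadj.ne
  have hy' : y ∈ S.erase z := mem_erase.2 ⟨hyne, hy⟩
  have e1 := hstep S z hz
  have e2 := hstep (S.erase z) y hy'
  have e3 := nbrCount_erase (G := G) y hz
  rw [if_pos hadj] at e3
  have c1 := card_erase_add_one hz
  have c2 := card_erase_add_one hy'
  have h3 := ih _ (by omega) ((S.erase z).erase y)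
    (fun l hl => hno l (hl.mono ((erase_subset _ _).trans (erase_subset _ _)))) rfl
  rw [← c1, ← c2, mul_add, mul_add]
  split_ifs at e1 e2 <;> omega

/-- Either there are many disjoint pieces or few vertices meet all of them. -/
lemma exists_disjoint_pieces_or_hitting (I : V → ℕ) (q m : ℕ) (S : Finset V) :
    (∃ F : Finset (List V), F.card = m ∧ (∀ l ∈ F, IsPiece G I q S l) ∧
      ∀ l ∈ F, ∀ l' ∈ F, l ≠ l' → List.Disjoint l l') ∨
    ∃ B ⊆ S, B.card ≤ m * (q + 2) ∧ ∀ l, ¬ IsPiece G I q (S \ B) l := by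
  classical
  induction m generalizing S with
  | zero => exact Or.inl ⟨∅, by simp⟩
  | succ m ih =>
    by_cases h : ∃ l, IsPiece G I q S l
    · obtain ⟨l, hl⟩ := h
      rcases ih (S \ l.toFinset) with ⟨F, hF, hp, hd⟩ | ⟨B, hB, hBc, hno⟩
      · have hdl : ∀ l' ∈ F, List.Disjoint l l' := by
          intro l' hl' x hx hx'
          have := (hp l' hl').2.2.1 x hx'
          simp [hx] at this
        have hlF : l ∉ F := by
          intro hlF
          obtain ⟨z, hz, -⟩ := hl.2.2.2.2
          exact hdl l hlF (List.mem_of_getLast? hz) (List.mem_of_getLast? hz)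
        refine Or.inl ⟨insert l F, by rw [card_insert_of_notMem hlF, hF], ?_, ?_⟩
        · intro l' hl'
          rcases mem_insert.1 hl' with rfl | hl'
          · exact hl
          · exact (hp l' hl').mono sdiff_subset
        · intro l₁ h₁ l₂ h₂ hne
          rcases mem_insert.1 h₁ with h₁ | h₁ <;> rcases mem_insert.1 h₂ with h₂ | h₂
          · exact absurd (h₁.trans h₂.symm) hne
          · rw [h₁]; exact hdl _ h₂
          · rw [h₂]; exact (hdl _ h₁).symm
          · exact hd _ h₁ _ h₂ hne
      · refine Or.inr ⟨B ∪ l.toFinset, ?_, ?_, ?_⟩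
        · refine union_subset (hB.trans sdiff_subset) fun x hx => hl.2.2.1 x (by simpa using hx)
        · have h1 := card_union_le B l.toFinset
          have h2 := List.toFinset_card_le l
          have h3 := hl.2.2.2.1
          rw [add_mul]; omega
        · intro l' hl'
          refine hno l' (hl'.mono ?_)
          intro x hx
          simp only [mem_sdiff, mem_union] at hx ⊢
          tauto
    · exact Or.inr ⟨∅, by simp, by simp, fun l hl => h ⟨l, by simpa using hl⟩⟩

end

section
variable {V : Type*}

/-- `G` contains a complete bipartite graph with sides of sizes `q` and `N`. -/
def HasBiclique (G : SimpleGraph V) (q N : ℕ) : Prop :=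
  ∃ A W : Finset V, A.card = q ∧ W.card = N ∧ ∀ a ∈ A, ∀ w ∈ W, G.Adj w a

/-- `G` contains `m` disjoint paths with `ℓ` vertices each, whose last vertices are adjacent to all
of a set of `q + 2 - ℓ` further vertices. -/
def HasBundle (G : SimpleGraph V) (q m : ℕ) : Prop :=
  ∃ (ℓ : ℕ) (J : Finset V) (F : Finset (List V)), 1 ≤ ℓ ∧ J.card + ℓ = q + 2 ∧ F.card = m ∧
    (∀ l ∈ F, l.Nodup ∧ l.IsChain G.Adj ∧ l.length = ℓ ∧ (∀ x ∈ l, x ∉ J) ∧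
      ∃ z, l.getLast? = some z ∧ ∀ a ∈ J, G.Adj z a) ∧
    ∀ l ∈ F, ∀ l' ∈ F, l ≠ l' → List.Disjoint l l'

variable [DecidableEq V]

lemma hasBundle_of_pieces {G : SimpleGraph V} {q m : ℕ} {A S : Finset V} (hAS : Disjoint A S)
    {F : Finset (List V)} (hF : (q + 3) * 2 ^ A.card * m < F.card)
    (hp : ∀ l ∈ F, IsPiece G (fun x => nbrCount G x A) q S l)
    (hd : ∀ l ∈ F, ∀ l' ∈ F, l ≠ l' → List.Disjoint l l') : HasBundle G q m := by
  classical
  have hex : ∀ l ∈ F, ∃ J ⊆ A, J.card + l.length = q + 2 ∧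
      ∃ z, l.getLast? = some z ∧ ∀ a ∈ J, G.Adj z a := by
    intro l hl
    obtain ⟨-, -, -, hlen, z, hz, hI⟩ := hp l hl
    simp only [nbrCount] at hI
    obtain ⟨J, hJ, hJc⟩ := exists_subset_card_eq
      (s := A.filter (G.Adj z)) (n := q + 2 - l.length) (by omega)
    exact ⟨J, hJ.trans (filter_subset _ _), by omega, z, hz, fun a ha => (mem_filter.1 (hJ ha)).2⟩
  choose! J hJA hJc hJz using hex
  obtain ⟨⟨ℓ, J₀⟩, -, hlt⟩ := exists_lt_card_fiber_of_mul_lt_card_of_maps_to (s := F)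
    (t := range (q + 3) ×ˢ A.powerset) (f := fun l => (l.length, J l)) (n := m)
    (fun l hl => by
      simp only [mem_product, mem_range, mem_powerset]
      have := hJc l hl
      exact ⟨by omega, hJA l hl⟩) (by simpa using hF)
  obtain ⟨F', hF', hF'c⟩ := exists_subset_card_eq hlt.le
  obtain ⟨l₀, hl₀⟩ := card_pos.1 (Nat.zero_lt_of_lt hlt)
  have hmem : ∀ l ∈ F', l ∈ F ∧ l.length = ℓ ∧ J l = J₀ := by
    intro l hl
    have := mem_filter.1 (hF' hl)
    exact ⟨this.1, by simpa using this.2⟩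
  refine ⟨ℓ, J₀, F', ?_, ?_, hF'c, ?_, fun l hl l' hl' => hd l (hmem l hl).1 l' (hmem l' hl').1⟩
  · obtain ⟨hl1, hl2⟩ := mem_filter.1 hl₀
    obtain ⟨rfl, rfl⟩ := Prod.mk_inj.1 hl2
    obtain ⟨z, hz, -⟩ := hJz l₀ hl1
    exact List.length_pos_of_mem (List.mem_of_getLast? hz)
  · obtain ⟨hl1, hl2⟩ := mem_filter.1 hl₀
    obtain ⟨rfl, rfl⟩ := Prod.mk_inj.1 hl2
    exact hJc l₀ hl1
  · intro l hl
    obtain ⟨hl, hlen, hJl⟩ := hmem l hl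
    have h := hp l hl
    refine ⟨h.1, h.2.1, hlen, fun x hx hxJ => ?_, hJl ▸ hJz l hl⟩
    exact disjoint_left.1 hAS (hJA l hl (hJl ▸ hxJ)) (h.2.2.1 x hx)

lemma card_le_of_not_hasBiclique {G : SimpleGraph V} {q N : ℕ} {A S : Finset V}
    (h : ¬ HasBiclique G q N) : (S.filter fun x => q ≤ nbrCount G x A).card ≤ 2 ^ A.card * N := by
  classical
  by_contra! hlt
  have hex : ∀ x ∈ S.filter fun x => q ≤ nbrCount G x A, ∃ J ⊆ A, J.card = q ∧
      ∀ a ∈ J, G.Adj x a := by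
    intro x hx
    rw [mem_filter, nbrCount] at hx
    obtain ⟨J, hJ, hJc⟩ := exists_subset_card_eq hx.2
    exact ⟨J, hJ.trans (filter_subset _ _), hJc, fun a ha => (mem_filter.1 (hJ ha)).2⟩
  choose! J hJA hJc hJz using hex
  obtain ⟨J₀, -, hlt⟩ := exists_lt_card_fiber_of_mul_lt_card_of_maps_to
    (t := A.powerset) (f := J) (n := N) (fun x hx => mem_powerset.2 (hJA x hx)) (by simpa using hlt)
  obtain ⟨W, hW, hWc⟩ := exists_subset_card_eq hlt.le
  obtain ⟨x, hx'⟩ := card_pos.1 (Nat.zero_lt_of_lt hlt)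
  obtain ⟨hx, rfl⟩ := mem_filter.1 hx'
  refine h ⟨J x, W, hJc x hx, hWc, fun a ha w hw => ?_⟩
  obtain ⟨hw, he⟩ := mem_filter.1 (hW hw)
  exact hJz w hw a (he ▸ ha)

lemma exists_larger_hub_set (q N m C₀ j K C : ℕ) : ∃ K' C' : ℕ, ∀ (n : ℕ)
    (G : SimpleGraph (Fin n)), 2 * q * n ≤ ∑ x, nbrCount G x univ + C₀ → ¬ HasBiclique G q N →
      ¬ HasBundle G q m → ∀ A : Finset (Fin n), A.card ≤ K →
      j * n ≤ 2 * ∑ x ∈ Aᶜ, nbrCount G x A + C → ∃ A' : Finset (Fin n), A'.card ≤ K' ∧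
        (j + 1) * n ≤ 2 * ∑ x ∈ A'ᶜ, nbrCount G x A' + C' := by
  set D := ((q + 3) * 2 ^ K * m + 1) * (q + 2) with hD
  refine ⟨K + D, C + C₀ + (K + D) * (K + D) + (K + D) + 2 ^ K * N + 2 * (D * K),
    fun n G hG hbi hbu A hAK hA => ?_⟩
  have h2K : 2 ^ A.card ≤ 2 ^ K := Nat.pow_le_pow_right (by norm_num) hAK
  rcases exists_disjoint_pieces_or_hitting (G := G) (fun x => nbrCount G x A) q
    ((q + 3) * 2 ^ K * m + 1) Aᶜ with ⟨F, hF, hp, hd⟩ | ⟨B, hB, hBc, hno⟩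
  · refine absurd (hasBundle_of_pieces disjoint_compl_right ?_ hp hd) hbu
    rw [hF]
    exact Nat.lt_succ_of_le (by gcongr)
  have hAB : Disjoint A B := disjoint_compl_right.mono_right hB
  have hcompl : (A ∪ B)ᶜ = Aᶜ \ B := by
    ext x; simp
  have hcard : (A ∪ B).card ≤ K + D := by
    have := card_union_le A B
    omega
  refine ⟨A ∪ B, hcard, ?_⟩
  have hL := sum_le_of_not_isPiece (G := G) (fun x => nbrCount G x A) q (Aᶜ \ B) hno
  rw [← hcompl] at hL
  set S := (A ∪ B)ᶜ with hS
  have hSc : S.card + (A ∪ B).card = n := by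
    rw [hS, card_compl_add_card, Fintype.card_fin]
  have hbig := card_le_of_not_hasBiclique (A := A) (S := S) hbi
  have hsplit := card_filter_add_card_filter_not (s := S) (fun x => nbrCount G x A < q)
  simp only [not_lt] at hsplit
  have hN : 2 ^ A.card * N ≤ 2 ^ K * N := by gcongr
  have hdeg : ∑ x, nbrCount G x univ = ∑ x ∈ S, nbrCount G x univ
      + ∑ x ∈ A ∪ B, nbrCount G x univ := (sum_compl_add_sum _ _).symm
  have huniv : ∀ x, nbrCount G x univ = nbrCount G x S + nbrCount G x (A ∪ B) := by
    intro x
    rw [hS, ← nbrCount_union x disjoint_compl_left, union_comm, union_compl]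
  have hq : 2 * q * S.card ≤ 2 * q * n := Nat.mul_le_mul_left _ (by omega)
  rw [sum_congr rfl fun x (_ : x ∈ S) => huniv x,
    sum_congr rfl fun x (_ : x ∈ A ∪ B) => huniv x, sum_add_distrib, sum_add_distrib,
    sum_nbrCount_comm (A ∪ B) S] at hdeg
  have hAA : ∑ x ∈ A ∪ B, nbrCount G x (A ∪ B) ≤ (K + D) * (K + D) := by
    refine (sum_le_card_nsmul _ _ (A ∪ B).card fun x _ => nbrCount_le_card _ _).trans ?_
    exact Nat.mul_le_mul hcard hcard
  rw [sum_add_distrib, ← mul_sum] at hL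
  have hAS : ∑ x ∈ Aᶜ, nbrCount G x A ≤ ∑ x ∈ S, nbrCount G x A + D * K := by
    rw [← sum_sdiff hB, ← hcompl]
    refine Nat.add_le_add_left ((sum_le_card_nsmul _ _ K fun x _ =>
      (nbrCount_le_card _ _).trans hAK).trans ?_) _
    exact Nat.mul_le_mul_right _ hBc
  rw [add_mul, one_mul]
  omega

/-- A graph with at least `q n - O(1)` edges contains a large biclique or a large bundle. -/
lemma hasBiclique_or_hasBundle (q N m C₀ : ℕ) : ∃ n₀ : ℕ, ∀ n ≥ n₀, ∀ G : SimpleGraph (Fin n),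
    2 * q * n ≤ ∑ x, nbrCount G x univ + C₀ → HasBiclique G q N ∨ HasBundle G q m := by
  have key : ∀ j : ℕ, ∃ K C : ℕ, ∀ (n : ℕ) (G : SimpleGraph (Fin n)),
      2 * q * n ≤ ∑ x, nbrCount G x univ + C₀ → ¬ HasBiclique G q N → ¬ HasBundle G q m →
      ∃ A : Finset (Fin n), A.card ≤ K ∧ j * n ≤ 2 * ∑ x ∈ Aᶜ, nbrCount G x A + C := by
    intro j
    induction j with
    | zero => exact ⟨0, 0, fun n G _ _ _ => ⟨∅, by simp⟩⟩
    | succ j ih =>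
      obtain ⟨K, C, h⟩ := ih
      obtain ⟨K', C', h'⟩ := exists_larger_hub_set q N m C₀ j K C
      refine ⟨K', C', fun n G h1 h2 h3 => ?_⟩
      obtain ⟨A, hA, hA'⟩ := h n G h1 h2 h3
      exact h' n G h1 h2 h3 A hA hA'
  obtain ⟨K, C, h⟩ := key (2 * q + 1)
  refine ⟨2 * (2 ^ K * N * K) + C + 1, fun n hn G hG => ?_⟩
  by_contra! hno
  obtain ⟨A, hAK, hA⟩ := h n G hG hno.1 hno.2
  have hbig := card_le_of_not_hasBiclique (A := A) (S := Aᶜ) hno.1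
  have h2K : 2 ^ A.card * N ≤ 2 ^ K * N :=
    Nat.mul_le_mul_right _ (Nat.pow_le_pow_right (by norm_num) hAK)
  rw [← sum_filter_add_sum_filter_not Aᶜ (fun x => q ≤ nbrCount G x A)] at hA
  have e1 : ∑ x ∈ Aᶜ with q ≤ nbrCount G x A, nbrCount G x A ≤ 2 ^ K * N * K := by
    refine (sum_le_card_nsmul _ _ K fun x _ => (nbrCount_le_card _ _).trans hAK).trans ?_
    exact Nat.mul_le_mul_right _ (hbig.trans h2K)
  have e2 : ∑ x ∈ Aᶜ with ¬ q ≤ nbrCount G x A, nbrCount G x A ≤ q * n := by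
    refine (sum_le_card_nsmul _ _ q fun x hx => ?_).trans ?_
    · exact (not_le.1 (mem_filter.1 hx).2).le
    · rw [smul_eq_mul, mul_comm]
      refine Nat.mul_le_mul_left _ ((card_le_univ _).trans (by simp))
  have : (2 * q + 1) * n = 2 * (q * n) + n := by ring
  omega

end

lemma sum_add_le_of_weights {k ℓ : ℕ} {g b : Fin k → ℕ} (w : Fin k → ℕ) (h : ∀ i, g i + w i ≤ b i)
    (hw : ℓ ≤ ∑ i, w i) : ∑ i, g i + ℓ ≤ ∑ i, b i := by
  have := sum_le_sum fun i (_ : i ∈ univ) => h i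
  rw [sum_add_distrib] at this
  omega

/-- How to distribute hubs among the paths of the forest when paths with `ℓ` vertices are at hand,
two of which can be joined for one of the paths. -/
lemma exists_hub_distribution {k ℓ : ℕ} {t : Fin k → ℕ} (ht : ∀ i, 2 ≤ t i)
    (heven : ∃ i, Even (t i)) (hℓ : 1 ≤ ℓ) (hℓs : ℓ ≤ ∑ i, t i / 2) :
    ∃ (i₀ : Fin k) (g : Fin k → ℕ), t i₀ ≤ 2 * ℓ + 2 * g i₀ ∧
      (∀ i ≠ i₀, t i ≤ ℓ ∨ (t i ≤ 2 * ℓ + 1 ∧ 1 ≤ g i) ∨ t i / 2 ≤ g i) ∧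
      ∑ i, g i + ℓ ≤ ∑ i, t i / 2 := by
  obtain ⟨e, he⟩ := heven
  set cost : Fin k → ℕ := fun i => if t i ≤ ℓ then 0 else if t i ≤ 2 * ℓ + 1 then 1 else t i / 2
    with hcost
  have hcb : ∀ i, cost i ≤ t i / 2 := by
    intro i; have := ht i; simp only [hcost]; split_ifs <;> omega
  have hce : ∀ i, Even (t i) → t i / 2 < ℓ → cost i + 1 ≤ t i / 2 := by
    intro i hi hlt
    obtain ⟨r, hr⟩ := hi
    have := ht i; simp only [hcost]; split_ifs <;> omega
  have hcm : ∀ i, t i ≤ ℓ ∨ (t i ≤ 2 * ℓ + 1 ∧ 1 ≤ cost i) ∨ t i / 2 ≤ cost i := by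
    intro i; simp only [hcost]; split_ifs <;> omega
  by_cases hA : ∃ i, Even (t i) ∧ ℓ ≤ t i / 2
  · obtain ⟨i₀, ⟨r, hr⟩, hi₀⟩ := hA
    refine ⟨i₀, fun i => if i = i₀ then t i / 2 - ℓ else cost i, ?_, ?_, ?_⟩
    · simp; omega
    · intro i hi; simpa [hi] using hcm i
    · refine sum_add_le_of_weights (fun i => if i = i₀ then ℓ else 0) (fun i => ?_) (by simp)
      have := hcb i
      split_ifs with h
      · subst h; omega
      · omega
  push Not at hA
  have hee := hce e he (hA e he)
  by_cases hB : ∃ i, ¬ Even (t i) ∧ ℓ ≤ t i / 2 + 1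
  · obtain ⟨i₀, ho, hi₀⟩ := hB
    have hne : e ≠ i₀ := by rintro rfl; exact ho he
    refine ⟨i₀, fun i => if i = i₀ then t i / 2 + 1 - ℓ else cost i, ?_, ?_, ?_⟩
    · simp; omega
    · intro i hi; simpa [hi] using hcm i
    · refine sum_add_le_of_weights
        (fun i => (if i = i₀ then ℓ - 1 else 0) + if i = e then 1 else 0) (fun i => ?_) ?_
      · have := hcb i
        split_ifs with h h' h'
        · exact absurd (h'.symm.trans h) hne
        · subst h; omega
        · subst h'; omega
        · omega
      · rw [sum_add_distrib]; simp; omega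
  push Not at hB
  have hsmall : ∀ i, t i + 2 ≤ 2 * ℓ := by
    intro i
    by_cases h : Even (t i)
    · have := hA i h; obtain ⟨r, hr⟩ := h; omega
    · have := hB i h; omega
  obtain ⟨i₀, -, hmax⟩ := exists_max_image univ t ⟨e, mem_univ e⟩
  by_cases hC : ∃ j, j ≠ i₀ ∧ ℓ < t j
  · obtain ⟨j, hj, hjt⟩ := hC
    have hij := hmax j (mem_univ _)
    refine ⟨i₀, fun i => if i = i₀ then 0 else cost i, ?_, ?_, ?_⟩
    · have := hsmall i₀; simp; omega
    · intro i hi; simpa [hi] using hcm i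
    · have hcj : cost j ≤ 1 := by
        have := hsmall j; simp only [hcost]; split_ifs <;> omega
      refine sum_add_le_of_weights (fun i => (if i = i₀ then t i₀ / 2 else 0) +
        (if i = j then t j / 2 - 1 else 0) + if i = e ∧ e ≠ i₀ ∧ e ≠ j then 1 else 0)
        (fun i => ?_) ?_
      · have := hcb i
        by_cases h1 : i = i₀
        · subst h1
          rw [if_pos rfl, if_pos rfl, if_neg (Ne.symm hj), if_neg (by tauto)]
          omega
        · by_cases h2 : i = j
          · subst h2
            rw [if_neg h1, if_neg h1, if_pos rfl, if_neg (by tauto)]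
            omega
          · rw [if_neg h1, if_neg h1, if_neg h2]
            split_ifs with h3
            · rw [h3.1]; omega
            · omega
      · rw [sum_add_distrib, sum_add_distrib]
        simp only [sum_ite_eq', mem_univ, if_true]
        have : (∑ i, if i = e ∧ e ≠ i₀ ∧ e ≠ j then 1 else 0) =
            if e ≠ i₀ ∧ e ≠ j then 1 else 0 := by
          rw [sum_eq_single e]
          · simp
          · intro b _ hb; simp [hb]
          · simp
        rw [this]
        have := ht j
        split_ifs with h
        · omega
        · have he' : Even (t i₀) ∨ Even (t j) := by
            by_cases h' : e = i₀
            · left; rw [← h']; exact he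
            · right
              have : e = j := by tauto
              rw [← this]; exact he
          rcases he' with ⟨r, hr⟩ | ⟨r, hr⟩ <;> omega
  · push Not at hC
    refine ⟨i₀, fun i => 0, ?_, ?_, ?_⟩
    · have := hsmall i₀; omega
    · intro i hi; exact Or.inl (hC i hi)
    · simpa using hℓs

lemma mem_of_mem_edgesL {V : Type*} {l : List V} {e : Sym2 V} (he : e ∈ edgesL l) {x : V}
    (hx : x ∈ e) : x ∈ l := by
  fun_induction edgesL l with
  | case1 => simp at he
  | case2 => simp at he
  | case3 y z l ih =>
    rcases List.mem_cons.1 he with rfl | he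
    · rcases Sym2.mem_iff.1 hx with rfl | rfl <;> simp
    · exact List.mem_cons_of_mem _ (ih he)

lemma nodup_edgesL {V : Type*} {l : List V} (h : l.Nodup) : (edgesL l).Nodup := by
  fun_induction edgesL l with
  | case1 => simp
  | case2 => simp
  | case3 x y l ih =>
    rw [List.nodup_cons] at h
    exact List.nodup_cons.2
      ⟨fun he => h.1 (mem_of_mem_edgesL he (Sym2.mem_mk_left x y)), ih h.2⟩

lemma mem_of_isChain_of_mem_edgesL {V : Type*} {l : List V} {E : Set (Sym2 V)}
    (h : l.IsChain fun x y => s(x, y) ∈ E) {e : Sym2 V} (he : e ∈ edgesL l) : e ∈ E := by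
  fun_induction edgesL l with
  | case1 => simp at he
  | case2 => simp at he
  | case3 x y l ih =>
    rw [List.isChain_cons_cons] at h
    rcases List.mem_cons.1 he with rfl | he
    · exact h.1
    · exact ih h.2 he

/-- The color conditions of `rainbowLF_of_prefixes` hold when all edges of the prefixes belong to a
rainbow set. -/
lemma rainbowLF_of_prefixes_injOn {n k : ℕ} {c : Sym2 (Fin n) → ℕ} {t : Fin k → ℕ}
    {A W : Finset (Fin n)} (hAW : RainbowBip c A W) (P : Fin k → List (Fin n)) (h : Fin k → ℕ)
    (hnd : ∀ i, (P i).Nodup) (hdj : ∀ i j, i ≠ j → List.Disjoint (P i) (P j))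
    {E : Set (Sym2 (Fin n))} (hE : Set.InjOn c E) (hP : ∀ i, (P i).IsChain fun x y => s(x, y) ∈ E)
    (hcov : ∀ i, t i ≤ (P i).length ∨
      ((∀ x ∈ (P i).getLast?, x ∈ A) ∧ t i ≤ (P i).length + 1 + 2 * h i))
    (hA : ∑ i, (h i + (P i).countP (· ∈ A)) ≤ A.card)
    (hW : ∑ i, (2 * (P i).length + h i + 1) ≤ W.card) :
    RainbowLF n c t := by
  refine rainbowLF_of_prefixes hAW P h hnd hdj (fun i => ?_) (fun i j hij => ?_) hcov hA hW
  · exact List.Nodup.map_on (fun e he e' he' h => hE (mem_of_isChain_of_mem_edgesL (hP i) he)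
      (mem_of_isChain_of_mem_edgesL (hP i) he') h) (nodup_edgesL (hnd i))
  · intro m hm hm'
    obtain ⟨e, he, rfl⟩ := List.mem_map.1 hm
    obtain ⟨e', he', hee⟩ := List.mem_map.1 hm'
    obtain rfl := hE (mem_of_isChain_of_mem_edgesL (hP j) he')
      (mem_of_isChain_of_mem_edgesL (hP i) he) hee
    induction e' with
    | _ x y =>
      exact hdj i j hij (mem_of_mem_edgesL he (Sym2.mem_mk_left x y))
        (mem_of_mem_edgesL he' (Sym2.mem_mk_left x y))

lemma exists_perm_isChain_cons {α : Type*} {R : α → α → Prop} (x : α) (L : List α)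
    (hL : L.IsChain R) (hx : ∀ y ∈ L, R x y ∨ R y x) :
    ∃ L' : List α, L'.Perm (x :: L) ∧ L'.IsChain R ∧
      ∀ y, R y x → (y :: L).IsChain R → (y :: L').IsChain R := by
  induction L with
  | nil => exact ⟨[x], List.Perm.refl _, by simp, fun y hy _ => by simpa using hy⟩
  | cons z L ih =>
    by_cases h : R x z
    · exact ⟨x :: z :: L, List.Perm.refl _, List.isChain_cons_cons.2 ⟨h, hL⟩, fun y hy _ =>
        List.isChain_cons_cons.2 ⟨hy, List.isChain_cons_cons.2 ⟨h, hL⟩⟩⟩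
    · have hzx : R z x := (hx z (by simp)).resolve_left h
      obtain ⟨L', h1, h2, h3⟩ := ih hL.tail fun y hy => hx y (by simp [hy])
      refine ⟨z :: L', (h1.cons z).trans (List.Perm.swap _ _ _), h3 z hzx hL, fun y _ hy' => ?_⟩
      exact List.isChain_cons_cons.2 ⟨(List.isChain_cons_cons.1 hy').1, h3 z hzx hL⟩

/-- Rédei's theorem: a semicomplete digraph has a Hamiltonian path. -/
lemma exists_perm_isChain {α : Type*} {R : α → α → Prop} (L : List α) (hn : L.Nodup)
    (h : ∀ x ∈ L, ∀ y ∈ L, x ≠ y → R x y ∨ R y x) : ∃ L' : List α, L'.Perm L ∧ L'.IsChain R := by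
  induction L with
  | nil => exact ⟨[], List.Perm.refl _, by simp⟩
  | cons x L ih =>
    rw [List.nodup_cons] at hn
    obtain ⟨L₁, h1, h2⟩ := ih hn.2 fun a ha b hb => h a (by simp [ha]) b (by simp [hb])
    obtain ⟨L', h3, h4, -⟩ := exists_perm_isChain_cons x L₁ h2 fun y hy => by
      have hy' := h1.mem_iff.1 hy
      exact h x (by simp) y (by simp [hy']) (by rintro rfl; exact hn.1 hy')
    exact ⟨L', h3.trans (h1.cons x), h4⟩

/-- The color `γ` appears on an edge of `G` inside `l` or between `l` and `J`. -/
def BundleColor {V : Type*} (G : SimpleGraph V) (c : Sym2 V → ℕ) (J : Finset V) (l : List V)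
    (γ : ℕ) : Prop :=
  ∃ x ∈ l, ∃ y, (y ∈ l ∨ y ∈ J) ∧ G.Adj x y ∧ c s(x, y) = γ

lemma isChain_and_mem {V : Type*} {R : V → V → Prop} {l : List V} (h : l.IsChain R) :
    l.IsChain fun x y => R x y ∧ x ∈ l ∧ y ∈ l := by
  rw [List.isChain_iff_getElem] at h ⊢
  exact fun i hi => ⟨h i hi, List.getElem_mem _, List.getElem_mem _⟩

lemma bundleColor_unique {V : Type*} {G : SimpleGraph V} {c : Sym2 V → ℕ}
    (hc : Set.InjOn c G.edgeSet) {J : Finset V} {l l' : List V} {γ : ℕ}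
    (hll : List.Disjoint l l') (hl : ∀ x ∈ l, x ∉ J)
    (h : BundleColor G c J l γ) (h' : BundleColor G c J l' γ) : False := by
  obtain ⟨x, hx, y, hy, hxy, rfl⟩ := h
  obtain ⟨x', hx', y', hy', hxy', he⟩ := h'
  rcases Sym2.eq_iff.1 (hc ((G.mem_edgeSet).2 hxy') ((G.mem_edgeSet).2 hxy) he) with
    ⟨rfl, rfl⟩ | ⟨rfl, rfl⟩
  · exact hll hx hx'
  · rcases hy' with hy' | hy'
    · exact hll hx hy'
    · exact hl _ hx hy'

/-- If the edges joining the free ends of the paths of a bundle have colors of the bundle, then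
these edges contain the forest. -/
lemma rainbowLF_of_tournament {n k : ℕ} {c : Sym2 (Fin n) → ℕ} {t : Fin k → ℕ}
    {α : Type*} (F : Finset α) (v : α → Fin n) (hv : Set.InjOn v F) (C : α → ℕ → Prop)
    (hC : ∀ l ∈ F, ∀ l' ∈ F, ∀ γ, C l γ → C l' γ → l = l')
    (h : ∀ l ∈ F, ∀ l' ∈ F, l ≠ l' → C l (c s(v l, v l')) ∨ C l' (c s(v l, v l')))
    (hF : ∑ i, t i ≤ F.card) (hF0 : F.Nonempty) : RainbowLF n c t := by
  classical
  obtain ⟨l₀, -⟩ := hF0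
  have : Nonempty α := ⟨l₀⟩
  obtain ⟨f, hf, hfi⟩ := exists_sigma_family t F hF
  have hex : ∀ i, ∃ L : List α, L.Perm ((List.range (t i)).map (f i)) ∧
      L.IsChain fun l l' => C l (c s(v l, v l')) := by
    intro i
    refine exists_perm_isChain _ ?_ ?_
    · refine List.Nodup.map_on ?_ List.nodup_range
      intro a ha b hb hab
      exact (hfi i a (List.mem_range.1 ha) i b (List.mem_range.1 hb) hab).2
    · intro x hx y hy hxy
      obtain ⟨a, ha, rfl⟩ := List.mem_map.1 hx
      obtain ⟨b, hb, rfl⟩ := List.mem_map.1 hy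
      have := h _ (hf i a (List.mem_range.1 ha)) _ (hf i b (List.mem_range.1 hb)) hxy
      rwa [Sym2.eq_swap (a := v (f i b))]
  choose L hLp hLc using hex
  have hmem : ∀ i, ∀ l ∈ L i, ∃ a < t i, l = f i a := by
    intro i l hl
    obtain ⟨a, ha, rfl⟩ := List.mem_map.1 ((hLp i).mem_iff.1 hl)
    exact ⟨a, List.mem_range.1 ha, rfl⟩
  have hmF : ∀ i, ∀ l ∈ L i, l ∈ F := by
    intro i l hl
    obtain ⟨a, ha, rfl⟩ := hmem i l hl
    exact hf i a ha
  have hLn : ∀ i, (L i).Nodup := by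
    intro i
    rw [(hLp i).nodup_iff]
    refine List.Nodup.map_on ?_ List.nodup_range
    intro a ha b hb hab
    exact (hfi i a (List.mem_range.1 ha) i b (List.mem_range.1 hb) hab).2
  have hdj : ∀ i j, ∀ l, l ∈ L i → l ∈ L j → i = j := by
    intro i j l hl hl'
    obtain ⟨a, ha, rfl⟩ := hmem i l hl
    obtain ⟨b, hb, hab⟩ := hmem j _ hl'
    exact (hfi i a ha j b hb hab).1
  refine rainbowLF_of_lists (fun i => (L i).map v) ?_ ?_ ?_ ?_
  · intro i
    rw [List.length_map, (hLp i).length_eq]; simp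
  · intro i
    exact List.Nodup.map_on (fun x hx y hy hxy => hv (hmF i x hx) (hmF i y hy) hxy) (hLn i)
  · intro i j hij x hx hx'
    obtain ⟨l, hl, rfl⟩ := List.mem_map.1 hx
    obtain ⟨l', hl', hll⟩ := List.mem_map.1 hx'
    obtain rfl := hv (hmF j l' hl') (hmF i l hl) hll
    exact hij (hdj i j _ hl hl')
  · intro i j a ha b hb hab
    simp only [List.getElem_map] at hab
    rw [List.length_map] at ha hb
    have h1 := List.isChain_iff_getElem.1 (hLc i) a ha
    have h2 := List.isChain_iff_getElem.1 (hLc j) b hb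
    rw [← hab] at h2
    have h3 := hC _ (hmF i _ (List.getElem_mem _)) _ (hmF j _ (List.getElem_mem _)) _ h1 h2
    obtain rfl := hdj i j _ (List.getElem_mem _) (by rw [h3]; exact List.getElem_mem _)
    exact ⟨rfl, (hLn i).getElem_inj_iff.1 h3⟩

lemma rainbowLF_of_hasBundle {n k m : ℕ} {c : Sym2 (Fin n) → ℕ} {t : Fin k → ℕ}
    (ht : ∀ i, 2 ≤ t i) (heven : ∃ i, Even (t i)) {s q : ℕ} (hs : s = ∑ i, t i / 2)
    (hq : s = q + 2) {G : SimpleGraph (Fin n)} (hc : Set.InjOn c G.edgeSet)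
    (hm : 2 * k + 3 + k * (5 * s + 3) + ∑ i, t i ≤ m) (hG : HasBundle G q m) :
    RainbowLF n c t := by
  classical
  obtain ⟨ℓ, J, F, hℓ, hJ, hF, hl, hd⟩ := hG
  have hFne : F.Nonempty := card_pos.1 (by omega)
  obtain ⟨l₀, hl₀⟩ := hFne
  obtain ⟨v₀, hv₀, -⟩ := (hl l₀ hl₀).2.2.2.2
  have : Nonempty (Fin n) := ⟨v₀⟩
  have hz : ∀ l ∈ F, ∃ z, l.getLast? = some z ∧ ∀ a ∈ J, G.Adj z a := fun l h => (hl l h).2.2.2.2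
  have hv : ∀ l ∈ F, ∃ v, l.head? = some v := by
    intro l h
    have h1 := (hl l h).2.2.1
    match l, h1 with
    | [], h1 => simp at h1; omega
    | x :: l, _ => exact ⟨x, rfl⟩
  choose! z hzl hza using hz
  choose! v hvl using hv
  have hzm : ∀ l ∈ F, z l ∈ l := fun l h => List.mem_of_getLast? (hzl l h)
  have hvm : ∀ l ∈ F, v l ∈ l := fun l h => List.mem_of_mem_head? (hvl l h)
  have hsame : ∀ l ∈ F, ∀ l' ∈ F, ∀ x, x ∈ l → x ∈ l' → l = l' := by
    intro l h l' h' x hx hx'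
    by_contra hne
    exact hd l h l' h' hne hx hx'
  have hlJ : ∀ l ∈ F, ∀ x ∈ l, x ∉ J := fun l h => (hl l h).2.2.2.1
  have huniq : ∀ l ∈ F, ∀ l' ∈ F, ∀ γ, BundleColor G c J l γ → BundleColor G c J l' γ → l = l' := by
    intro l h l' h' γ h1 h2
    by_contra hne
    exact bundleColor_unique hc (hd l h l' h' hne) (hlJ l h) h1 h2
  by_cases htour : ∀ l ∈ F, ∀ l' ∈ F, l ≠ l' → BundleColor G c J l (c s(v l, v l')) ∨
      BundleColor G c J l' (c s(v l, v l'))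
  · refine rainbowLF_of_tournament F v ?_ (BundleColor G c J) huniq htour (by omega) ⟨l₀, hl₀⟩
    intro l h l' h' he
    exact hsame l h l' h' (v l) (hvm l h) (he ▸ hvm l' h')
  push Not at htour
  obtain ⟨κ, hκ, κ', hκ', hne, hμ, hμ'⟩ := htour
  set μ := c s(v κ, v κ') with hμdef
  obtain ⟨i₀, g, hi₀, hi, hg⟩ := exists_hub_distribution (ℓ := ℓ) ht heven hℓ (by omega)
  set F' := ((F.erase κ).erase κ').filter fun l => ¬ BundleColor G c J l μ with hF'
  have hF'c : m ≤ F'.card + 3 := by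
    have h1 : (((F.erase κ).erase κ').filter fun l => BundleColor G c J l μ).card + F'.card =
        ((F.erase κ).erase κ').card := by
      rw [hF']
      exact card_filter_add_card_filter_not _
    have h2 : (((F.erase κ).erase κ').filter fun l => BundleColor G c J l μ).card ≤ 1 := by
      rw [card_le_one]
      intro a ha b hb
      simp only [mem_filter, mem_erase] at ha hb
      exact huniq a ha.1.2.2 b hb.1.2.2 μ ha.2 hb.2
    have h3 := card_erase_add_one hκ
    have h4 := card_erase_add_one (mem_erase.2 ⟨hne.symm, hκ'⟩)
    omega
  have hF'm : ∀ l ∈ F', l ∈ F ∧ l ≠ κ ∧ l ≠ κ' ∧ ¬ BundleColor G c J l μ := by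
    intro l h
    simp only [hF', mem_filter, mem_erase] at h
    tauto
  have : Nonempty (List (Fin n)) := ⟨[]⟩
  obtain ⟨f, hf, hfi⟩ := exists_sigma_family (fun _ : Fin k => 2) F' (by simp; omega)
  obtain ⟨u, hu, hui⟩ := exists_sigma_family g J (by omega)
  have hf0 : ∀ i, f i 0 ∈ F' := fun i => hf i 0 (by norm_num)
  have hf1 : ∀ i, f i 1 ∈ F' := fun i => hf i 1 (by norm_num)
  set own : Fin k → List (Fin n) → Prop := fun i l =>
    (i = i₀ ∧ (l = κ ∨ l = κ')) ∨ l = f i 0 ∨ l = f i 1 with hown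
  have hownF : ∀ i l, own i l → l ∈ F := by
    rintro i l (⟨-, rfl | rfl⟩ | rfl | rfl)
    · exact hκ
    · exact hκ'
    · exact (hF'm _ (hf0 i)).1
    · exact (hF'm _ (hf1 i)).1
  have hownμ : ∀ i l, own i l → ¬ BundleColor G c J l μ := by
    rintro i l (⟨-, rfl | rfl⟩ | rfl | rfl)
    · exact hμ
    · exact hμ'
    · exact (hF'm _ (hf0 i)).2.2.2
    · exact (hF'm _ (hf1 i)).2.2.2
  have hownd : ∀ i j l, own i l → own j l → i = j := by
    have key : ∀ i l, l = f i 0 ∨ l = f i 1 → l ∈ F' ∧ ∃ a < 2, l = f i a := by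
      rintro i l (rfl | rfl)
      · exact ⟨hf0 i, 0, by norm_num, rfl⟩
      · exact ⟨hf1 i, 1, by norm_num, rfl⟩
    rintro i j l (⟨rfl, h1⟩ | h1) (⟨rfl, h2⟩ | h2)
    · rfl
    · have := hF'm l (key _ _ h2).1
      tauto
    · have := hF'm l (key _ _ h1).1
      tauto
    · obtain ⟨-, a, ha, h1⟩ := key _ _ h1
      obtain ⟨-, b, hb, h2⟩ := key _ _ h2
      exact (hfi i a ha j b hb (h1.symm.trans h2)).1
  set E : Set (Sym2 (Fin n)) := {e | (∃ l ∈ F, ¬ BundleColor G c J l μ ∧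
      ∃ x ∈ l, ∃ y, (y ∈ l ∨ y ∈ J) ∧ G.Adj x y ∧ e = s(x, y)) ∨ e = s(v κ, v κ')} with hE
  have hEinj : Set.InjOn c E := by
    rintro e (⟨l, hl1, hl2, x, hx, y, hy, hxy, rfl⟩ | rfl) e'
      (⟨l', hl1', hl2', x', hx', y', hy', hxy', rfl⟩ | rfl) he
    · exact hc ((G.mem_edgeSet).2 hxy) ((G.mem_edgeSet).2 hxy') he
    · exact absurd ⟨x, hx, y, hy, hxy, he⟩ hl2
    · exact absurd ⟨x', hx', y', hy', hxy', he.symm⟩ hl2'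
    · rfl
  have hchain : ∀ i l, own i l → l.IsChain fun x y => s(x, y) ∈ E := by
    intro i l h
    have h1 := isChain_and_mem (hl l (hownF i l h)).2.1
    refine h1.imp fun x y hxy => Or.inl ⟨l, hownF i l h, hownμ i l h, x, hxy.2.1, y, Or.inl hxy.2.2,
      hxy.1, rfl⟩
  have hchainr : ∀ i l, own i l → l.reverse.IsChain fun x y => s(x, y) ∈ E := by
    intro i l h
    rw [List.isChain_reverse]
    refine (hchain i l h).imp fun x y hxy => ?_
    rwa [Sym2.eq_swap]
  have hhub : ∀ i l, own i l → ∀ a ∈ J, s(z l, a) ∈ E := by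
    intro i l h a ha
    exact Or.inl ⟨l, hownF i l h, hownμ i l h, z l, hzm l (hownF i l h), a, Or.inr ha,
      hza l (hownF i l h) a ha, rfl⟩
  have hspec : ∀ i, ∃ (P : List (Fin n)) (h : ℕ), P.Nodup ∧
      (∀ x ∈ P, (∃ l, own i l ∧ x ∈ l) ∨ (0 < g i ∧ x = u i 0)) ∧
      (P.IsChain fun x y => s(x, y) ∈ E) ∧
      (t i ≤ P.length ∨ ((∀ x ∈ P.getLast?, x ∈ J) ∧ t i ≤ P.length + 1 + 2 * h)) ∧
      h + P.countP (· ∈ J) ≤ g i ∧ P.length ≤ 2 * ℓ + 1 := by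
    have hcount : ∀ l ∈ F, l.countP (· ∈ J) = 0 := by
      intro l h
      rw [List.countP_eq_zero]
      intro x hx
      simpa using hlJ l h x hx
    have hjoin : ∀ l ∈ F, ∀ l' ∈ F, l ≠ l' → (l.reverse ++ l').Nodup := by
      intro l h l' h' hne
      refine List.Nodup.append (List.nodup_reverse.2 (hl l h).1) (hl l' h').1 ?_
      intro x hx hx'
      exact hd l h l' h' hne (List.mem_reverse.1 hx) hx'
    intro i
    have ho0 : own i (f i 0) := Or.inr (Or.inl rfl)
    have ho1 : own i (f i 1) := Or.inr (Or.inr rfl)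
    by_cases hii : i = i₀
    · have hoκ : own i κ := Or.inl ⟨hii, Or.inl rfl⟩
      have hoκ' : own i κ' := Or.inl ⟨hii, Or.inr rfl⟩
      have hlen : (κ.reverse ++ κ').length = 2 * ℓ := by
        rw [List.length_append, List.length_reverse, (hl κ hκ).2.2.1, (hl κ' hκ').2.2.1]; ring
      have hch : (κ.reverse ++ κ').IsChain fun x y => s(x, y) ∈ E := by
        refine List.isChain_append.2 ⟨hchainr i κ hoκ, hchain i κ' hoκ', ?_⟩
        intro x hx y hy
        rw [List.getLast?_reverse, hvl κ hκ] at hx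
        rw [hvl κ' hκ'] at hy
        obtain rfl : v κ = x := by simpa using hx
        obtain rfl : v κ' = y := by simpa using hy
        exact Or.inr rfl
      have hmem : ∀ x ∈ κ.reverse ++ κ', (∃ l, own i l ∧ x ∈ l) := by
        intro x hx
        rcases List.mem_append.1 hx with hx | hx
        · exact ⟨κ, hoκ, List.mem_reverse.1 hx⟩
        · exact ⟨κ', hoκ', hx⟩
      have hc0 : (κ.reverse ++ κ').countP (· ∈ J) = 0 := by
        rw [List.countP_append, List.countP_reverse, hcount κ hκ, hcount κ' hκ']
      rcases Nat.eq_zero_or_pos (g i) with h0 | h0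
      · refine ⟨κ.reverse ++ κ', 0, hjoin κ hκ κ' hκ' hne, fun x hx => Or.inl (hmem x hx), hch,
          Or.inl ?_, by omega, by omega⟩
        rw [hii] at h0 ⊢
        omega
      · have huJ := hu i 0 h0
        refine ⟨κ.reverse ++ κ' ++ [u i 0], g i - 1, ?_, ?_, ?_, Or.inr ⟨?_, ?_⟩, ?_, ?_⟩
        · refine List.Nodup.append (hjoin κ hκ κ' hκ' hne) (by simp) ?_
          intro x hx hx'
          obtain rfl : x = u i 0 := by simpa using hx'
          obtain ⟨l, hol, hxl⟩ := hmem _ hx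
          exact hlJ l (hownF i l hol) _ hxl huJ
        · intro x hx
          rcases List.mem_append.1 hx with hx | hx
          · exact Or.inl (hmem x hx)
          · exact Or.inr ⟨h0, by simpa using hx⟩
        · refine List.isChain_append.2 ⟨hch, by simp, ?_⟩
          intro x hx y hy
          rw [List.getLast?_append, hzl κ' hκ'] at hx
          obtain rfl : z κ' = x := by simpa using hx
          obtain rfl : u i 0 = y := by simpa using hy
          exact hhub i κ' hoκ' _ huJ
        · intro x hx
          obtain rfl : u i 0 = x := by simpa using hx
          exact huJ
        · rw [List.length_append, hlen, hii]
          rw [hii] at h0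
          simp; omega
        · rw [List.countP_append, hc0]; simp [huJ]; omega
        · rw [List.length_append, hlen]; simp
    · rcases hi i hii with h1 | ⟨h1, h2⟩ | h1
      · refine ⟨f i 0, 0, (hl _ (hownF i _ ho0)).1, fun x hx => Or.inl ⟨_, ho0, hx⟩,
          hchain i _ ho0, Or.inl ?_, ?_, ?_⟩
        · rw [(hl _ (hownF i _ ho0)).2.2.1]; exact h1
        · rw [hcount _ (hownF i _ ho0)]; omega
        · rw [(hl _ (hownF i _ ho0)).2.2.1]; omega
      · have huJ := hu i 0 h2
        have hne01 : f i 0 ≠ f i 1 := by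
          intro h
          have := (hfi i 0 (by norm_num) i 1 (by norm_num) h).2
          omega
        have hlen : (f i 0 ++ u i 0 :: (f i 1).reverse).length = 2 * ℓ + 1 := by
          rw [List.length_append, List.length_cons, List.length_reverse,
            (hl _ (hownF i _ ho0)).2.2.1, (hl _ (hownF i _ ho1)).2.2.1]
          ring
        refine ⟨f i 0 ++ u i 0 :: (f i 1).reverse, 0, ?_, ?_, ?_, Or.inl (by omega), ?_, by omega⟩
        · refine List.Nodup.append (hl _ (hownF i _ ho0)).1 (List.nodup_cons.2
            ⟨fun h => hlJ _ (hownF i _ ho1) _ (List.mem_reverse.1 h) huJ,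
              List.nodup_reverse.2 (hl _ (hownF i _ ho1)).1⟩) ?_
          intro x hx hx'
          rcases List.mem_cons.1 hx' with rfl | hx'
          · exact hlJ _ (hownF i _ ho0) _ hx huJ
          · exact hd _ (hownF i _ ho0) _ (hownF i _ ho1) hne01 hx (List.mem_reverse.1 hx')
        · intro x hx
          rcases List.mem_append.1 hx with hx | hx
          · exact Or.inl ⟨_, ho0, hx⟩
          · rcases List.mem_cons.1 hx with rfl | hx
            · exact Or.inr ⟨h2, rfl⟩
            · exact Or.inl ⟨_, ho1, List.mem_reverse.1 hx⟩
        · refine List.isChain_append.2 ⟨hchain i _ ho0, ?_, ?_⟩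
          · refine List.isChain_cons.2 ⟨?_, hchainr i _ ho1⟩
            intro y hy
            rw [List.head?_reverse, hzl _ (hownF i _ ho1)] at hy
            obtain rfl : z (f i 1) = y := by simpa using hy
            rw [Sym2.eq_swap]
            exact hhub i _ ho1 _ huJ
          · intro x hx y hy
            rw [hzl _ (hownF i _ ho0)] at hx
            obtain rfl : z (f i 0) = x := by simpa using hx
            obtain rfl : u i 0 = y := by simpa using hy
            exact hhub i _ ho0 _ huJ
        · rw [List.countP_append, List.countP_cons, List.countP_reverse,
            hcount _ (hownF i _ ho0), hcount _ (hownF i _ ho1)]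
          simp [huJ]; omega
      · exact ⟨[], g i, by simp, by simp, by simp, Or.inr ⟨by simp, by simp; omega⟩, by simp,
          by simp⟩
  choose P h hPn hPm hPc hPt hPg hPl using hspec
  have hbip : RainbowBip c J (F.image z) := by
    refine ⟨disjoint_left.2 ?_, ?_⟩
    · intro a ha ha'
      obtain ⟨l, hlF, rfl⟩ := mem_image.1 ha'
      exact hlJ l hlF _ (hzm l hlF) ha
    · intro a ha a' ha' w hw w' hw' he
      obtain ⟨l, hlF, rfl⟩ := mem_image.1 hw
      obtain ⟨l', hlF', rfl⟩ := mem_image.1 hw'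
      rcases Sym2.eq_iff.1 (hc ((G.mem_edgeSet).2 (hza l hlF a ha).symm)
        ((G.mem_edgeSet).2 (hza l' hlF' a' ha').symm) he) with h1 | ⟨h1, -⟩
      · exact h1
      · exact absurd ha (h1 ▸ hlJ l' hlF' _ (hzm l' hlF'))
  have hWc : (F.image z).card = m := by
    rw [card_image_of_injOn, hF]
    intro l h1 l' h2 he
    exact hsame l h1 l' h2 (z l) (hzm l h1) (he ▸ hzm l' h2)
  refine rainbowLF_of_prefixes_injOn hbip P h hPn ?_ hEinj hPc hPt ?_ ?_
  · intro i j hij x hx hx'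
    rcases hPm i x hx with ⟨l, hol, hxl⟩ | ⟨h1, rfl⟩ <;>
      rcases hPm j _ hx' with ⟨l', hol', hxl'⟩ | ⟨h2, h3⟩
    · obtain rfl := hsame l (hownF _ _ hol) l' (hownF _ _ hol') x hxl hxl'
      exact hij (hownd _ _ _ hol hol')
    · exact hlJ l (hownF _ _ hol) _ hxl (h3 ▸ hu j 0 h2)
    · exact hlJ l' (hownF _ _ hol') _ hxl' (hu i 0 h1)
    · exact hij (hui i 0 h1 j 0 h2 h3).1
  · exact (sum_le_sum fun i _ => hPg i).trans (by omega)
  · rw [hWc]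
    have hgs : ∀ i, g i ≤ s := fun i =>
      (single_le_sum (fun j _ => Nat.zero_le (g j)) (mem_univ i)).trans (by omega)
    refine (sum_le_card_nsmul _ _ (5 * s + 3) fun i _ => ?_).trans ?_
    · have h1 := hPl i
      have h2 := hPg i
      have h3 := hgs i
      omega
    · simp; omega

lemma exists_representing_graph {n : ℕ} (c : Sym2 (Fin n) → ℕ) :
    ∃ G : SimpleGraph (Fin n), Set.InjOn c G.edgeSet ∧
      ∑ x, nbrCount G x univ = 2 * colorCount n c := by
  classical
  obtain ⟨E, hE, hc⟩ := Set.exists_subset_bijOn {e : Sym2 (Fin n) | ¬ e.IsDiag} c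
  have hedge : (SimpleGraph.fromEdgeSet E).edgeSet = E := by
    rw [SimpleGraph.edgeSet_fromEdgeSet, sdiff_eq_left, Set.disjoint_left]
    exact fun e he => hE he
  refine ⟨SimpleGraph.fromEdgeSet E, by rw [hedge]; exact hc.injOn, ?_⟩
  have h1 : ∀ x, nbrCount (SimpleGraph.fromEdgeSet E) x univ
      = (SimpleGraph.fromEdgeSet E).degree x := by
    intro x
    rw [nbrCount, ← SimpleGraph.card_neighborFinset_eq_degree,
      SimpleGraph.neighborFinset_eq_filter]
    congr
  rw [sum_congr rfl fun x _ => h1 x, SimpleGraph.sum_degrees_eq_twice_card_edges]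
  congr 1
  have h2 : ((SimpleGraph.fromEdgeSet E).edgeFinset).image c
      = (univ.filter fun e : Sym2 (Fin n) => ¬ e.IsDiag).image c := by
    rw [← coe_inj, coe_image, coe_image, SimpleGraph.coe_edgeFinset, hedge, hc.image_eq]
    simp
  rw [colorCount, ← h2, card_image_of_injOn]
  · congr!
  rw [SimpleGraph.coe_edgeFinset, hedge]
  exact hc.injOn

lemma rainbowLF_or_exists_rainbowBip {k : ℕ} {t : Fin k → ℕ}
    (ht : ∀ i, 2 ≤ t i) (heven : ∃ i, Even (t i)) {s q : ℕ} (hs : s = ∑ i, t i / 2)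
    (hq : s = q + 2) (N : ℕ) : ∃ n₀ : ℕ, ∀ n ≥ n₀, ∀ c : Sym2 (Fin n) → ℕ,
      q * (n - q) ≤ colorCount n c → RainbowLF n c t ∨
        ∃ A W : Finset (Fin n), A.card = q ∧ W.card = N ∧ RainbowBip c A W := by
  obtain ⟨n₀, h⟩ := hasBiclique_or_hasBundle q N (2 * k + 3 + k * (5 * s + 3) + ∑ i, t i)
    (2 * q * q)
  refine ⟨n₀, fun n hn c hcol => ?_⟩
  obtain ⟨G, hc, hG⟩ := exists_representing_graph c
  have hle : 2 * q * n ≤ ∑ x, nbrCount G x univ + 2 * q * q := by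
    have h1 : n ≤ n - q + q := by omega
    have h2 := Nat.mul_le_mul_left (2 * q) h1
    rw [hG]
    nlinarith
  rcases h n hn G hle with ⟨A, W, hA, hW, hadj⟩ | hb
  · refine Or.inr ⟨A, W, hA, hW, ?_, ?_⟩
    · rw [disjoint_left]
      exact fun x hx hx' => (hadj x hx x hx').ne rfl
    · intro a ha a' ha' w hw w' hw' he
      have h1 := hc (by exact (hadj a ha w hw).symm) (by exact (hadj a' ha' w' hw').symm) he
      rcases Sym2.eq_iff.1 h1 with h2 | ⟨rfl, rfl⟩
      · exact h2
      · exact ((hadj a ha a hw').ne rfl).elim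
  · exact Or.inl (rainbowLF_of_hasBundle ht heven hs hq hc le_rfl hb)

/-- The colors of the edges inside `S`. -/
def cols {V : Type*} [DecidableEq V] (c : Sym2 V → ℕ) (S : Finset V) : Finset ℕ :=
  S.offDiag.image fun p => c s(p.1, p.2)

lemma mem_cols {V : Type*} [DecidableEq V] {c : Sym2 V → ℕ} {S : Finset V} {γ : ℕ} :
    γ ∈ cols c S ↔ ∃ x ∈ S, ∃ y ∈ S, x ≠ y ∧ c s(x, y) = γ := by
  simp [cols, and_assoc]

lemma cols_mono {V : Type*} [DecidableEq V] {c : Sym2 V → ℕ} {S T : Finset V} (h : S ⊆ T) :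
    cols c S ⊆ cols c T :=
  image_subset_image (offDiag_mono h)

lemma card_cols_univ {n : ℕ} (c : Sym2 (Fin n) → ℕ) : (cols c univ).card = colorCount n c := by
  rw [colorCount, nondiag_eq_image_offDiag, image_image]
  rfl

/-- Every edge inside `U` colored `γ` contains `x`. -/
def IsPrivate {V : Type*} (c : Sym2 V → ℕ) (U : Finset V) (x : V) (γ : ℕ) : Prop :=
  ∀ y ∈ U, ∀ z ∈ U, y ≠ z → c s(y, z) = γ → y = x ∨ z = x

lemma exists_of_mem_cols_sdiff {V : Type*} [DecidableEq V] {c : Sym2 V → ℕ} {U : Finset V}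
    {x : V} {γ : ℕ} (h : γ ∈ cols c U \ cols c (U \ {x})) :
    IsPrivate c U x γ ∧ ∃ y ∈ U, y ≠ x ∧ c s(x, y) = γ := by
  rw [mem_sdiff, mem_cols, mem_cols] at h
  obtain ⟨⟨y, hy, z, hz, hyz, hc⟩, h2⟩ := h
  have hp : IsPrivate c U x γ := by
    intro y hy z hz hyz hc
    by_contra! hne
    exact h2 ⟨y, by simp [hy, hne.1], z, by simp [hz, hne.2], hyz, hc⟩
  refine ⟨hp, ?_⟩
  rcases hp y hy z hz hyz hc with rfl | rfl
  · exact ⟨z, hz, hyz.symm, hc⟩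
  · exact ⟨y, hy, hyz, by rw [Sym2.eq_swap]; exact hc⟩

/-- A vertex set `U` containing `A` and `W` that has many colors, where `W` is large and completely
joined to `A` in distinct colors, and deleting further vertices from `U` destroys many colors. -/
structure IsCritical {n : ℕ} (c : Sym2 (Fin n) → ℕ) (A W U : Finset (Fin n)) (q r : ℕ) :
    Prop where
  rainbowBip : RainbowBip c A W
  card_hub : A.card = q
  hub_subset : A ⊆ U
  subset : W ⊆ U
  le_card : 10 * q + 100 ≤ W.card
  le_cols : q.choose 2 + q * (U.card - q) + r ≤ (cols c U).card
  le_lost : ∀ S ⊆ U, Disjoint S A → Disjoint S W → S.Nonempty →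
    q * S.card + 1 ≤ (cols c U \ cols c (U \ S)).card
  exists_pair : ∀ v ∈ W, ∀ a ∈ A, ∀ T : Finset (Fin n), T.card ≤ 10 →
    ∃ w₁ ∈ W, ∃ w₂ ∈ W, w₁ ∉ T ∧ w₂ ∉ T ∧ w₁ ≠ w₂ ∧ c s(w₁, w₂) ≠ c s(v, a)

lemma exists_pair_of_card {V : Type*} [DecidableEq V] {W T : Finset V}
    (h : T.card + 2 ≤ W.card) : ∃ w₁ ∈ W, ∃ w₂ ∈ W, w₁ ∉ T ∧ w₂ ∉ T ∧ w₁ ≠ w₂ := by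
  have h1 := le_card_sdiff T W
  obtain ⟨a, ha, b, hb, hab⟩ := one_lt_card.1 (show 1 < (W \ T).card by omega)
  rw [mem_sdiff] at ha hb
  exact ⟨a, ha.1, b, hb.1, ha.2, hb.2, hab⟩

lemma exists_subset_exists_pair {n q : ℕ} {c : Sym2 (Fin n) → ℕ} {A W : Finset (Fin n)}
    (h : RainbowBip c A W) (hW : W.card = 10 * q + 120) :
    ∃ W' ⊆ W, 10 * q + 100 ≤ W'.card ∧ ∀ v ∈ W', ∀ a ∈ A, ∀ T : Finset (Fin n), T.card ≤ 10 →
      ∃ w₁ ∈ W', ∃ w₂ ∈ W', w₁ ∉ T ∧ w₂ ∉ T ∧ w₁ ≠ w₂ ∧ c s(w₁, w₂) ≠ c s(v, a) := by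
  by_cases h1 : ∀ v ∈ W, ∀ a ∈ A, ∀ T : Finset (Fin n), T.card ≤ 10 →
      ∃ w₁ ∈ W, ∃ w₂ ∈ W, w₁ ∉ T ∧ w₂ ∉ T ∧ w₁ ≠ w₂ ∧ c s(w₁, w₂) ≠ c s(v, a)
  · exact ⟨W, Subset.rfl, by omega, h1⟩
  push Not at h1
  obtain ⟨v, hv, a, ha, T, hT, h1⟩ := h1
  have h2 := le_card_sdiff (insert v T) W
  have h3 := card_insert_le v T
  refine ⟨W \ insert v T, sdiff_subset, by omega, fun v' hv' a' ha' T' hT' => ?_⟩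
  obtain ⟨w₁, hw₁, w₂, hw₂, hT₁, hT₂, hne⟩ :=
    exists_pair_of_card (W := W \ insert v T) (T := T') (by omega)
  refine ⟨w₁, hw₁, w₂, hw₂, hT₁, hT₂, hne, ?_⟩
  simp only [mem_sdiff, mem_insert, not_or] at hw₁ hw₂ hv'
  rw [h1 w₁ hw₁.1 w₂ hw₂.1 hw₁.2.2 hw₂.2.2 hne, Sym2.eq_swap, Sym2.eq_swap (a := v')]
  exact fun he => hv'.2.1 (h.2 a ha a' ha' v hv v' hv'.1 he).2.symm

lemma exists_isCritical {n q r : ℕ} {c : Sym2 (Fin n) → ℕ} {A W : Finset (Fin n)}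
    (h : RainbowBip c A W) (hA : A.card = q) (hW : W.card = 10 * q + 120)
    (hc : q.choose 2 + q * (n - q) + r ≤ colorCount n c) :
    ∃ W' U, IsCritical c A W' U q r := by
  obtain ⟨W', hW', hcard, hpair⟩ := exists_subset_exists_pair h hW
  obtain ⟨U, hU, hmin⟩ := exists_min_image
    (univ.filter fun U : Finset (Fin n) => A ⊆ U ∧ W' ⊆ U ∧
      q.choose 2 + q * (U.card - q) + r ≤ (cols c U).card) card
    ⟨univ, by simp [card_cols_univ, hc]⟩
  simp only [mem_filter, mem_univ, true_and] at hU hmin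
  refine ⟨W', U, h.mono hW', hA, hU.1, hU.2.1, hcard, hU.2.2, ?_, hpair⟩
  intro S hSU hSA hSW hS
  have h1 : ¬ (q.choose 2 + q * ((U \ S).card - q) + r ≤ (cols c (U \ S)).card) := by
    intro h2
    have h3 := hmin (U \ S) ⟨subset_sdiff.2 ⟨hU.1, hSA.symm⟩, subset_sdiff.2 ⟨hU.2.1, hSW.symm⟩, h2⟩
    have h4 := card_sdiff_add_card_eq_card hSU
    have h5 := hS.card_pos
    omega
  have h2 := card_sdiff_add_card_eq_card hSU
  have h3 := card_sdiff_add_card_eq_card (cols_mono (c := c) (sdiff_subset (s := U) (t := S)))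
  have h4 : q ≤ (U \ S).card := hA ▸ card_le_card (subset_sdiff.2 ⟨hU.1, hSA.symm⟩)
  have h5 : q * (U.card - q) = q * ((U \ S).card - q) + q * S.card := by
    rw [← mul_add]; congr 1; omega
  omega

lemma edgesL_concat {V : Type*} {l : List V} {x : V} (h : l.getLast? = some x) (y : V) :
    edgesL (l ++ [y]) = edgesL l ++ [s(x, y)] := by
  fun_induction edgesL l with
  | case1 => simp at h
  | case2 z => simp_all
  | case3 a b l ih =>
    have := ih (by simpa using h)
    simp_all

lemma edgesL_reverse {V : Type*} (l : List V) : edgesL l.reverse = (edgesL l).reverse := by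
  fun_induction edgesL l with
  | case1 => rfl
  | case2 => rfl
  | case3 a b l ih =>
    rw [List.reverse_cons, edgesL_concat (x := b) (by simp), ih, Sym2.eq_swap]
    simp

lemma half_add_half_le_sum {k : ℕ} (t : Fin k → ℕ) {i j : Fin k} (h : i ≠ j) :
    t i / 2 + t j / 2 ≤ ∑ i, t i / 2 := by
  rw [← sum_pair h (f := fun i => t i / 2)]
  exact sum_le_sum_of_subset (subset_univ _)

lemma rainbowLF_of_pair {n k : ℕ} {c : Sym2 (Fin n) → ℕ} {t : Fin k → ℕ} (ht : ∀ i, 2 ≤ t i)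
    {A W : Finset (Fin n)} (hAW : RainbowBip c A W) {s : ℕ} (hs : s = ∑ i, t i / 2)
    (hAs : s ≤ A.card + 2) (hW : 3 * s + 20 ≤ W.card) {i₁ i₂ : Fin k} (hi : i₁ ≠ i₂)
    {P₁ P₂ : List (Fin n)} {l₁ l₂ : Fin n} (hl₁ : P₁.getLast? = some l₁)
    (hl₂ : P₂.getLast? = some l₂) (hlen₁ : P₁.length + 2 * (t i₁ / 2) = t i₁ + 2)
    (hlen₂ : P₂.length + 2 * (t i₂ / 2) = t i₂ + 2) (hPA : ∀ x ∈ P₁ ++ P₂, x ∉ A)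
    (hnd : (P₁ ++ P₂).Nodup) (hcnd : ((edgesL P₁ ++ edgesL P₂).map c).Nodup)
    (h₁ : A.Nonempty → ∃ a₁ ∈ A, c s(l₁, a₁) ∉ (edgesL P₁ ++ edgesL P₂).map c ∧
      ∀ a ∈ A, a ≠ a₁ → c s(l₂, a) ≠ c s(l₁, a₁))
    (h₂ : ∀ a ∈ A, c s(l₂, a) ∉ (edgesL P₁ ++ edgesL P₂).map c) : RainbowLF n c t := by
  have hsum := half_add_half_le_sum t hi
  have ht₁ := ht i₁
  have ht₂ := ht i₂
  have hcA : ∀ (P : List (Fin n)), (∀ x ∈ P, x ∈ P₁ ++ P₂) → P.countP (· ∈ A) = 0 := by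
    intro P hP
    rw [List.countP_eq_zero]
    intro x hx
    simpa using hPA x (hP x hx)
  have hcA₁ := hcA P₁ (by simp +contextual)
  have hcA₂ := hcA P₂ (by simp +contextual)
  have hm₁ := List.mem_of_getLast? hl₁
  have hm₂ := List.mem_of_getLast? hl₂
  by_cases hb₁ : t i₁ / 2 = 1 <;> by_cases hb₂ : t i₂ / 2 = 1
  · refine rainbowLF_of_two ht hAW hs hAs hi P₁ P₂ 0 0 hnd hcnd (Or.inl (by omega))
      (Or.inl (by omega)) ?_ ?_ <;> omega
  · obtain ⟨a, ha⟩ := card_pos.1 (show 0 < A.card by omega)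
    have h3 := h₂ a ha
    refine rainbowLF_of_two ht hAW hs hAs hi P₁ (P₂ ++ [a]) 0 (t i₂ / 2 - 2) ?_ ?_
      (Or.inl (by omega)) (Or.inr ⟨by simp [ha], by simp; omega⟩) ?_ ?_
    · rw [← List.append_assoc, List.nodup_append']
      exact ⟨hnd, by simp, by simpa using ⟨fun h => hPA a (by simp [h]) ha, fun h => hPA a (by simp [h]) ha⟩⟩
    · rw [edgesL_concat hl₂, ← List.append_assoc, List.map_append, List.nodup_append']
      exact ⟨hcnd, by simp, by simpa using h3⟩
    · rw [List.countP_append, hcA₁, hcA₂]; simp [ha]; omega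
    · simp; omega
  · obtain ⟨a, ha, h3, -⟩ := h₁ (card_pos.1 (show 0 < A.card by omega))
    refine rainbowLF_of_two ht hAW hs hAs hi.symm P₂ (P₁ ++ [a]) 0 (t i₁ / 2 - 2) ?_ ?_
      (Or.inl (by omega)) (Or.inr ⟨by simp [ha], by simp; omega⟩) ?_ ?_
    · rw [← List.append_assoc, List.nodup_append', List.nodup_append_comm]
      exact ⟨hnd, by simp, by simpa using ⟨fun h => hPA a (by simp [h]) ha, fun h => hPA a (by simp [h]) ha⟩⟩
    · rw [edgesL_concat hl₁, ← List.append_assoc, List.map_append, List.nodup_append',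
        List.map_append, List.nodup_append_comm, ← List.map_append]
      refine ⟨hcnd, by simp, ?_⟩
      simp at h3 ⊢
      exact ⟨h3.2, h3.1⟩
    · rw [List.countP_append, hcA₁, hcA₂]; simp [ha]; omega
    · simp; omega
  · obtain ⟨a, ha, h3, h4⟩ := h₁ (card_pos.1 (show 0 < A.card by omega))
    obtain ⟨a', ha', hne⟩ := exists_mem_ne (show 1 < A.card by omega) a
    have h5 := h₂ a' ha'
    have h6 := h4 a' ha' hne
    refine rainbowLF_of_two ht hAW hs hAs hi (P₁ ++ [a]) (P₂ ++ [a']) (t i₁ / 2 - 2)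
      (t i₂ / 2 - 2) ?_ ?_ (Or.inr ⟨by simp [ha], by simp; omega⟩)
      (Or.inr ⟨by simp [ha'], by simp; omega⟩) ?_ ?_
    · have e : (P₁ ++ [a] ++ (P₂ ++ [a'])).Perm (P₁ ++ P₂ ++ [a, a']) := by
        rw [List.perm_iff_count]; intro x; simp [List.count_append, List.count_cons]; omega
      rw [e.nodup_iff, List.nodup_append']
      refine ⟨hnd, by simp [hne.symm], ?_⟩
      have q1 : ∀ b ∈ A, b ∉ P₁ ∧ b ∉ P₂ := fun b hb =>
        ⟨fun h => hPA b (by simp [h]) hb, fun h => hPA b (by simp [h]) hb⟩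
      simp [q1 a ha, q1 a' ha']
    · rw [edgesL_concat hl₁, edgesL_concat hl₂]
      have e : ((edgesL P₁ ++ [s(l₁, a)] ++ (edgesL P₂ ++ [s(l₂, a')])).map c).Perm
          ((edgesL P₁ ++ edgesL P₂).map c ++ [c s(l₁, a), c s(l₂, a')]) := by
        rw [List.perm_iff_count]; intro x; simp [List.count_append, List.count_cons]; omega
      rw [e.nodup_iff, List.nodup_append']
      refine ⟨hcnd, by simp [h6.symm], ?_⟩
      simp at h3 h5 ⊢
      tauto
    · rw [List.countP_append, List.countP_append, hcA₁, hcA₂]; simp [ha, ha']; omega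
    · simp; omega

lemma RainbowBip.exists_end {V : Type*} {c : Sym2 V → ℕ} {A Y : Finset V}
    (h : RainbowBip c A Y) {u v : V} (hu : u ∈ Y) (hv : v ∈ Y) (huv : u ≠ v) (γ : ℕ) :
    (∀ a ∈ A, c s(u, a) ≠ γ) ∨ ∀ a ∈ A, c s(v, a) ≠ γ := by
  by_contra! h'
  obtain ⟨⟨a, ha, h1⟩, b, hb, h2⟩ := h'
  refine huv (h.2 a ha b hb u hu v hv ?_).2
  rw [Sym2.eq_swap, h1, Sym2.eq_swap, h2]

/-- Two rainbow prefixes can be completed if their colors, with one possible exception, do not occur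
between `A` and `Y`. -/
lemma rainbowLF_of_pair_of_clean {n k : ℕ} {c : Sym2 (Fin n) → ℕ} {t : Fin k → ℕ}
    (ht : ∀ i, 2 ≤ t i) {A Y : Finset (Fin n)} (hAY : RainbowBip c A Y) {s : ℕ}
    (hs : s = ∑ i, t i / 2) (hAs : s ≤ A.card + 2) (hY : 3 * s + 20 ≤ Y.card) {i₁ i₂ : Fin k}
    (hi : i₁ ≠ i₂) {P₁ P₂ : List (Fin n)} (hP₁ : 2 ≤ P₁.length) (hP₂ : 2 ≤ P₂.length)
    (hlen₁ : P₁.length + 2 * (t i₁ / 2) = t i₁ + 2)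
    (hlen₂ : P₂.length + 2 * (t i₂ / 2) = t i₂ + 2) (hPY : ∀ x ∈ P₁ ++ P₂, x ∈ Y)
    (hnd : (P₁ ++ P₂).Nodup) (hcnd : ((edgesL P₁ ++ edgesL P₂).map c).Nodup) (μ : ℕ)
    (hμ : ∀ γ ∈ (edgesL P₁ ++ edgesL P₂).map c, γ = μ ∨ ∀ a ∈ A, ∀ v ∈ Y, c s(v, a) ≠ γ) :
    RainbowLF n c t := by
  have key : ∀ P : List (Fin n), 2 ≤ P.length → P.Nodup → (∀ x ∈ P, x ∈ Y) →
      ∃ (P' : List (Fin n)) (l : Fin n), P'.Perm P ∧ (edgesL P').Perm (edgesL P) ∧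
        P'.getLast? = some l ∧ l ∈ Y ∧ l ∈ P ∧ ∀ a ∈ A, c s(l, a) ≠ μ := by
    intro P hP hPn hPY
    match P, hP with
    | x :: y :: l, _ =>
      obtain ⟨z, hz⟩ : ∃ z, (x :: y :: l).getLast? = some z := by
        rw [← Option.isSome_iff_exists]; simp
      have hz' : z ∈ y :: l := List.mem_of_getLast? (by simpa using hz)
      have hxz : x ≠ z := fun h => (List.nodup_cons.1 hPn).1 (h ▸ hz')
      have hx := hPY x (by simp)
      have hzY := hPY z (by simp [List.mem_cons.1 hz'])
      rcases hAY.exists_end hx hzY hxz μ with h | h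
      · refine ⟨(x :: y :: l).reverse, x, List.reverse_perm _, ?_, ?_, hx, by simp, h⟩
        · rw [edgesL_reverse]; exact List.reverse_perm _
        · simp
      · exact ⟨_, z, List.Perm.refl _, List.Perm.refl _, hz, hzY, by simp [List.mem_cons.1 hz'], h⟩
  have hnd' := List.nodup_append'.1 hnd
  obtain ⟨Q₁, l₁, hp₁, he₁, hl₁, hlY₁, hlP₁, hlμ₁⟩ :=
    key P₁ hP₁ hnd'.1 fun x hx => hPY x (by simp [hx])
  obtain ⟨Q₂, l₂, hp₂, he₂, hl₂, hlY₂, hlP₂, hlμ₂⟩ :=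
    key P₂ hP₂ hnd'.2.1 fun x hx => hPY x (by simp [hx])
  have hE := (he₁.append he₂).map c
  have hnot : ∀ l ∈ Y, (∀ a ∈ A, c s(l, a) ≠ μ) → ∀ a ∈ A,
      c s(l, a) ∉ (edgesL Q₁ ++ edgesL Q₂).map c := by
    intro l hl hlμ a ha hmem
    rcases hμ _ (hE.mem_iff.1 hmem) with h | h
    · exact hlμ a ha h
    · exact h a ha l hl rfl
  refine rainbowLF_of_pair ht hAY hs hAs hY hi hl₁ hl₂ (by rw [hp₁.length_eq, hlen₁])
    (by rw [hp₂.length_eq, hlen₂]) ?_ ((hp₁.append hp₂).nodup_iff.2 hnd) (hE.nodup_iff.2 hcnd) ?_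
    (hnot l₂ hlY₂ hlμ₂)
  · intro x hx
    exact disjoint_right.1 hAY.1 (hPY x ((hp₁.append hp₂).mem_iff.1 hx))
  · rintro ⟨a, ha⟩
    refine ⟨a, ha, hnot l₁ hlY₁ hlμ₁ a ha, fun a' ha' hne he => hne ?_⟩
    rw [Sym2.eq_swap, Sym2.eq_swap (a := l₁)] at he
    exact (hAY.2 a' ha' a ha l₂ hlY₂ l₁ hlY₁ he).1

lemma exists_colors_avoiding {n q r : ℕ} {c : Sym2 (Fin n) → ℕ} {A U : Finset (Fin n)}
    (hA : A.card = q) (hAU : A ⊆ U)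
    (hcols : q.choose 2 + q * (U.card - q) + r ≤ (cols c U).card) :
    ∃ Γ : Finset ℕ, r ≤ Γ.card ∧ ∀ γ ∈ Γ, (∃ x ∈ U \ A, ∃ y ∈ U \ A, x ≠ y ∧ c s(x, y) = γ) ∧
      ∀ a ∈ A, ∀ v ∈ U \ A, c s(v, a) ≠ γ := by
  set T : Finset ℕ := cols c A ∪ (A ×ˢ (U \ A)).image fun p => c s(p.2, p.1) with hT
  have hTc : T.card ≤ q.choose 2 + q * (U.card - q) := by
    refine (card_union_le _ _).trans (add_le_add ?_ ?_)
    · have : cols c A = (A.offDiag.image (Function.uncurry Sym2.mk)).image c := by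
        rw [image_image]; rfl
      rw [this, ← hA, ← Sym2.card_image_offDiag]
      exact card_image_le
    · refine card_image_le.trans_eq ?_
      rw [card_product, card_sdiff_of_subset hAU, hA]
  refine ⟨cols c U \ T, ?_, fun γ hγ => ?_⟩
  · have := le_card_sdiff T (cols c U)
    omega
  · rw [mem_sdiff, hT, mem_union, not_or] at hγ
    obtain ⟨h1, h2, h3⟩ := hγ
    have h4 : ∀ a ∈ A, ∀ v ∈ U \ A, c s(v, a) ≠ γ := fun a ha v hv he =>
      h3 (mem_image.2 ⟨(a, v), mem_product.2 ⟨ha, hv⟩, he⟩)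
    refine ⟨?_, h4⟩
    obtain ⟨x, hx, y, hy, hxy, he⟩ := mem_cols.1 h1
    refine ⟨x, ?_, y, ?_, hxy, he⟩
    · refine mem_sdiff.2 ⟨hx, fun hxA => ?_⟩
      by_cases hyA : y ∈ A
      · exact h2 (mem_cols.2 ⟨x, hxA, y, hyA, hxy, he⟩)
      · exact h4 x hxA y (mem_sdiff.2 ⟨hy, hyA⟩) (by rw [Sym2.eq_swap, he])
    · refine mem_sdiff.2 ⟨hy, fun hyA => ?_⟩
      by_cases hxA : x ∈ A
      · exact h2 (mem_cols.2 ⟨x, hxA, y, hyA, hxy, he⟩)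
      · exact h4 y hyA x (mem_sdiff.2 ⟨hx, hxA⟩) he

lemma exists_even_even_or_odd_even {k ε : ℕ} (hk : 2 ≤ k) {t : Fin k → ℕ}
    (heven : ∃ i, Even (t i))
    (hε : ε = if (Finset.univ.filter fun i => Even (t i)).card = 1 then 1 else 0) :
    (ε = 0 ∧ ∃ i₁ i₂, i₁ ≠ i₂ ∧ Even (t i₁) ∧ Even (t i₂)) ∨
      (ε = 1 ∧ ∃ i₁ i₂, i₁ ≠ i₂ ∧ Odd (t i₁) ∧ Even (t i₂)) := by
  obtain ⟨i, hi⟩ := heven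
  split_ifs at hε with h
  · refine Or.inr ⟨hε, ?_⟩
    obtain ⟨j, hj⟩ : ∃ j : Fin k, j ≠ i := by
      have : Nontrivial (Fin k) := Fin.nontrivial_iff_two_le.2 hk
      exact exists_ne i
    refine ⟨j, i, hj, ?_, hi⟩
    by_contra hodd
    rw [Nat.not_odd_iff_even] at hodd
    exact hj (card_le_one.1 h.le j (by simp [hodd]) i (by simp [hi]))
  · refine Or.inl ⟨hε, ?_⟩
    have h0 : 0 < (univ.filter fun i => Even (t i)).card := card_pos.2 ⟨i, by simp [hi]⟩
    obtain ⟨a, ha, b, hb, hab⟩ := one_lt_card.1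
      (show 1 < (univ.filter fun i => Even (t i)).card by omega)
    simp only [mem_filter, mem_univ, true_and] at ha hb
    exact ⟨a, b, hab, ha, hb⟩

/-- Two edges of different colors and a third edge yield a rainbow path on three vertices and a
disjoint edge, with at most one further color. -/
lemma exists_three_two {V : Type*} {d : V → V → ℕ} (comm : ∀ a b, d a b = d b a)
    {x y z u w w₁ w₂ : V} {γ₁ γ₂ : ℕ} (hne : γ₁ ≠ γ₂) (hxy : x ≠ y) (hzu : z ≠ u)
    (hw : w₁ ≠ w₂) (hγ₁ : d x y = γ₁) (hγ₂ : d z u = γ₂) (hμ₁ : d w₁ w₂ ≠ γ₁)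
    (hμ₂ : d w₁ w₂ ≠ γ₂) (h1x : w₁ ≠ x) (h1y : w₁ ≠ y) (h1z : w₁ ≠ z) (h1u : w₁ ≠ u)
    (h2x : w₂ ≠ x) (h2y : w₂ ≠ y) (h2z : w₂ ≠ z) (h2u : w₂ ≠ u) (hwx : w ≠ x) (hwy : w ≠ y)
    (hwz : w ≠ z) (hwu : w ≠ u) (hww₁ : w ≠ w₁) (hww₂ : w ≠ w₂) :
    ∃ p₁ p₂ p₃ r₁ r₂ μ, (∀ v ∈ [p₁, p₂, p₃, r₁, r₂], v ∈ [x, y, z, u, w, w₁, w₂]) ∧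
      [p₁, p₂, p₃, r₁, r₂].Nodup ∧ [d p₁ p₂, d p₂ p₃, d r₁ r₂].Nodup ∧
      ∀ γ ∈ [d p₁ p₂, d p₂ p₃, d r₁ r₂], γ = μ ∨ γ = γ₁ ∨ γ = γ₂ := by
  have share : ∀ p₁ p₂ p₃ : V, (∀ v ∈ [p₁, p₂, p₃], v ∈ [x, y, z, u, w]) → p₁ ≠ p₂ → p₂ ≠ p₃ →
      p₁ ≠ p₃ → d p₁ p₂ = γ₁ → d p₂ p₃ = γ₂ →
      ∃ p₁ p₂ p₃ r₁ r₂ μ, (∀ v ∈ [p₁, p₂, p₃, r₁, r₂], v ∈ [x, y, z, u, w, w₁, w₂]) ∧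
        [p₁, p₂, p₃, r₁, r₂].Nodup ∧ [d p₁ p₂, d p₂ p₃, d r₁ r₂].Nodup ∧
        ∀ γ ∈ [d p₁ p₂, d p₂ p₃, d r₁ r₂], γ = μ ∨ γ = γ₁ ∨ γ = γ₂ := by
    intro p₁ p₂ p₃ hp n1 n2 n3 e1 e2
    have q₁ := hp p₁ (by simp)
    have q₂ := hp p₂ (by simp)
    have q₃ := hp p₃ (by simp)
    clear hp
    simp only [List.mem_cons, List.not_mem_nil, or_false] at q₁ q₂ q₃
    refine ⟨p₁, p₂, p₃, w₁, w₂, d w₁ w₂, ?_, ?_, ?_, ?_⟩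
    · simp; grind
    · simp; grind
    · simp; grind
    · simp; grind
  have c1 := comm x y
  have c2 := comm z u
  have c3 := comm z w
  by_cases hxz : x = z
  · exact share y x u (by simp) hxy.symm (by grind) (by grind) (by grind) (by grind)
  by_cases hxu : x = u
  · exact share y x z (by simp) hxy.symm (by grind) (by grind) (by grind) (by grind)
  by_cases hyz : y = z
  · exact share x y u (by simp) hxy (by grind) (by grind) (by grind) (by grind)
  by_cases hyu : y = u
  · exact share x y z (by simp) hxy (by grind) (by grind) (by grind) (by grind)
  by_cases e1 : d y w = γ₂
  · exact share x y w (by simp) hxy (by grind) (by grind) (by grind) (by grind)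
  by_cases e2 : d z w = γ₁
  · exact share w z u (by simp) (by grind) (by grind) (by grind) (by grind) (by grind)
  by_cases e3 : d y w = γ₁
  · by_cases e4 : d z w = γ₂
    · exact share y w z (by simp) (by grind) (by grind) (by grind) (by grind) (by grind)
    · refine ⟨u, z, w, x, y, d z w, by simp, ?_, ?_, ?_⟩
      · simp; grind
      · simp; grind
      · simp; grind
  · refine ⟨x, y, w, z, u, d y w, by simp, ?_, ?_, ?_⟩
    · simp; grind
    · simp; grind
    · simp; grind

section
variable {n k : ℕ} {c : Sym2 (Fin n) → ℕ} {t : Fin k → ℕ} {A Y : Finset (Fin n)} {s : ℕ}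

lemma rainbowLF_of_clean_of_even_even (ht : ∀ i, 2 ≤ t i) (hAY : RainbowBip c A Y)
    (hs : s = ∑ i, t i / 2) (hAs : s ≤ A.card + 2) (hY : 3 * s + 20 ≤ Y.card) {i₁ i₂ : Fin k}
    (hi : i₁ ≠ i₂) (h₁ : Even (t i₁)) (h₂ : Even (t i₂)) {γ₁ γ₂ : ℕ} (hne : γ₁ ≠ γ₂)
    {x y z u : Fin n} (hx : x ∈ Y) (hy : y ∈ Y) (hxy : x ≠ y) (hz : z ∈ Y) (hu : u ∈ Y)
    (hzu : z ≠ u) (hγ₁ : c s(x, y) = γ₁) (hγ₂ : c s(z, u) = γ₂)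
    (hg₁ : ∀ a ∈ A, ∀ v ∈ Y, c s(v, a) ≠ γ₁) (hg₂ : ∀ a ∈ A, ∀ v ∈ Y, c s(v, a) ≠ γ₂) :
    RainbowLF n c t := by
  rw [Nat.even_iff] at h₁ h₂
  obtain ⟨w₁, hw₁, w₂, hw₂, hT₁, hT₂, hw⟩ := exists_pair_of_card (W := Y) (T := {x, y, z, u})
    (by have : ({x, y, z, u} : Finset (Fin n)).card ≤ 4 := card_le_four
        omega)
  simp only [mem_insert, mem_singleton, not_or] at hT₁ hT₂
  by_cases hμ : c s(w₁, w₂) = γ₁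
  · refine rainbowLF_of_pair_of_clean (P₁ := [z, u]) (P₂ := [w₁, w₂]) ht hAY hs hAs hY hi (by simp)
      (by simp) (by simp; omega) (by simp; omega) ?_ ?_ ?_ (c s(w₁, w₂)) ?_
    · simp [*]
    · simp [*, Ne.symm]
    · simp; grind
    · simp; grind
  · refine rainbowLF_of_pair_of_clean (P₁ := [x, y]) (P₂ := [w₁, w₂]) ht hAY hs hAs hY hi (by simp)
      (by simp) (by simp; omega) (by simp; omega) ?_ ?_ ?_ (c s(w₁, w₂)) ?_
    · simp [*]
    · simp [*, Ne.symm]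
    · simp; grind
    · simp; grind

/-- A version of `rainbowLF_of_pair_of_clean` for a path on three vertices and an edge. -/
lemma rainbowLF_of_clean_of_three_two (ht : ∀ i, 2 ≤ t i) (hAY : RainbowBip c A Y)
    (hs : s = ∑ i, t i / 2) (hAs : s ≤ A.card + 2) (hY : 3 * s + 20 ≤ Y.card) {i₁ i₂ : Fin k}
    (hi : i₁ ≠ i₂) (h₁ : Odd (t i₁)) (h₂ : Even (t i₂)) {p₁ p₂ p₃ r₁ r₂ : Fin n}
    (hY' : ∀ x ∈ [p₁, p₂, p₃, r₁, r₂], x ∈ Y) (hnd : [p₁, p₂, p₃, r₁, r₂].Nodup)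
    (hcnd : [c s(p₁, p₂), c s(p₂, p₃), c s(r₁, r₂)].Nodup) (μ : ℕ)
    (hμ : ∀ γ ∈ [c s(p₁, p₂), c s(p₂, p₃), c s(r₁, r₂)],
      γ = μ ∨ ∀ a ∈ A, ∀ v ∈ Y, c s(v, a) ≠ γ) : RainbowLF n c t := by
  rw [Nat.odd_iff] at h₁
  rw [Nat.even_iff] at h₂
  exact rainbowLF_of_pair_of_clean (P₁ := [p₁, p₂, p₃]) (P₂ := [r₁, r₂]) ht hAY hs hAs hY hi
    (by simp) (by simp) (by simp; omega) (by simp; omega) hY' hnd hcnd μ hμ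

lemma rainbowLF_of_clean_of_odd_even (ht : ∀ i, 2 ≤ t i) (hAY : RainbowBip c A Y)
    (hs : s = ∑ i, t i / 2) (hAs : s ≤ A.card + 2) (hY : 3 * s + 20 ≤ Y.card) {i₁ i₂ : Fin k}
    (hi : i₁ ≠ i₂) (h₁ : Odd (t i₁)) (h₂ : Even (t i₂)) {γ₁ γ₂ : ℕ} (hne : γ₁ ≠ γ₂)
    {x y z u w₁ w₂ : Fin n} (hx : x ∈ Y) (hy : y ∈ Y) (hxy : x ≠ y) (hz : z ∈ Y) (hu : u ∈ Y)
    (hzu : z ≠ u) (hγ₁ : c s(x, y) = γ₁) (hγ₂ : c s(z, u) = γ₂)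
    (hg₁ : ∀ a ∈ A, ∀ v ∈ Y, c s(v, a) ≠ γ₁) (hg₂ : ∀ a ∈ A, ∀ v ∈ Y, c s(v, a) ≠ γ₂)
    (hw₁ : w₁ ∈ Y) (hw₂ : w₂ ∈ Y) (hw : w₁ ≠ w₂) (hT₁ : w₁ ∉ [x, y, z, u])
    (hT₂ : w₂ ∉ [x, y, z, u]) (hμ₁ : c s(w₁, w₂) ≠ γ₁) (hμ₂ : c s(w₁, w₂) ≠ γ₂) :
    RainbowLF n c t := by
  simp only [List.mem_cons, List.not_mem_nil, or_false, not_or] at hT₁ hT₂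
  obtain ⟨w, hwY, -, -, hwT, -⟩ := exists_pair_of_card (W := Y) (T := {x, y, z, u, w₁, w₂})
    (by have : ({x, y, z, u, w₁, w₂} : Finset (Fin n)).card ≤ 6 := card_le_six
        omega)
  simp only [mem_insert, mem_singleton, not_or] at hwT
  obtain ⟨p₁, p₂, p₃, r₁, r₂, μ, hp, hnd, hcnd, hμ⟩ :=
    exists_three_two (d := fun a b => c s(a, b)) (fun a b => by rw [Sym2.eq_swap]) hne hxy hzu hw
      hγ₁ hγ₂ hμ₁ hμ₂ hT₁.1 hT₁.2.1 hT₁.2.2.1 hT₁.2.2.2 hT₂.1 hT₂.2.1 hT₂.2.2.1 hT₂.2.2.2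
      hwT.1 hwT.2.1 hwT.2.2.1 hwT.2.2.2.1 hwT.2.2.2.2.1 hwT.2.2.2.2.2
  refine rainbowLF_of_clean_of_three_two ht hAY hs hAs hY hi h₁ h₂ (fun v hv => ?_) hnd hcnd μ
    fun γ hγ => ?_
  · have := hp v hv
    simp only [List.mem_cons, List.not_mem_nil, or_false] at this
    rcases this with rfl | rfl | rfl | rfl | rfl | rfl | rfl <;> assumption
  · rcases hμ γ hγ with h | rfl | rfl
    · exact Or.inl h
    · exact Or.inr hg₁
    · exact Or.inr hg₂

end

lemma rainbowLF_of_clean {n k : ℕ} (hk : 2 ≤ k) {c : Sym2 (Fin n) → ℕ} {t : Fin k → ℕ}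
    {A U : Finset (Fin n)} {s q ε : ℕ} (ht : ∀ i, 2 ≤ t i) (heven : ∃ i, Even (t i))
    (hε : ε = if (Finset.univ.filter fun i => Even (t i)).card = 1 then 1 else 0)
    (hs : s = ∑ i, t i / 2) (hq : s = q + 2) (hA : A.card = q) (hAU : A ⊆ U)
    (hAY : RainbowBip c A (U \ A)) (hY : 3 * s + 20 ≤ (U \ A).card)
    (hcols : q.choose 2 + q * (U.card - q) + (2 + ε) ≤ (cols c U).card) : RainbowLF n c t := by
  obtain ⟨Γ, hΓ, hgood⟩ := exists_colors_avoiding hA hAU hcols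
  have hAs : s ≤ A.card + 2 := by omega
  rcases exists_even_even_or_odd_even hk heven hε with
    ⟨hε, i₁, i₂, hi, h₁, h₂⟩ | ⟨hε, i₁, i₂, hi, h₁, h₂⟩
  · obtain ⟨γ₁, hγ₁, γ₂, hγ₂, hne⟩ := one_lt_card.1 (show 1 < Γ.card by omega)
    obtain ⟨⟨x, hx, y, hy, hxy, e₁⟩, g₁⟩ := hgood _ hγ₁
    obtain ⟨⟨z, hz, u, hu, hzu, e₂⟩, g₂⟩ := hgood _ hγ₂
    exact rainbowLF_of_clean_of_even_even ht hAY hs hAs hY hi h₁ h₂ hne hx hy hxy hz hu hzu e₁ e₂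
      g₁ g₂
  · obtain ⟨γ₁, γ₂, γ₃, hγ₁, hγ₂, hγ₃, h12, h13, h23⟩ := two_lt_card_iff.1 (show 2 < Γ.card by omega)
    obtain ⟨⟨x, hx, y, hy, hxy, e₁⟩, g₁⟩ := hgood _ hγ₁
    obtain ⟨⟨z, hz, u, hu, hzu, e₂⟩, g₂⟩ := hgood _ hγ₂
    obtain ⟨⟨p, hp, r, hr, hpr, e₃⟩, g₃⟩ := hgood _ hγ₃
    obtain ⟨w₁, hw₁, w₂, hw₂, hT₁, hT₂, hw⟩ := exists_pair_of_card (W := U \ A)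
      (T := {x, y, z, u, p, r})
      (by have : ({x, y, z, u, p, r} : Finset (Fin n)).card ≤ 6 := card_le_six
          omega)
    simp only [mem_insert, mem_singleton, not_or] at hT₁ hT₂
    by_cases hμ₁ : c s(w₁, w₂) = γ₁
    · exact rainbowLF_of_clean_of_odd_even ht hAY hs hAs hY hi h₁ h₂ h23 hz hu hzu hp hr hpr e₂ e₃
        g₂ g₃ hw₁ hw₂ hw (by simp [hT₁]) (by simp [hT₂]) (hμ₁ ▸ h12) (hμ₁ ▸ h13)
    by_cases hμ₂ : c s(w₁, w₂) = γ₂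
    · exact rainbowLF_of_clean_of_odd_even ht hAY hs hAs hY hi h₁ h₂ h13 hx hy hxy hp hr hpr e₁ e₃
        g₁ g₃ hw₁ hw₂ hw (by simp [hT₁]) (by simp [hT₂]) hμ₁ (hμ₂ ▸ h23)
    · exact rainbowLF_of_clean_of_odd_even ht hAY hs hAs hY hi h₁ h₂ h12 hx hy hxy hz hu hzu e₁ e₂
        g₁ g₂ hw₁ hw₂ hw (by simp [hT₁]) (by simp [hT₂]) hμ₁ hμ₂

section
variable {n k : ℕ} {c : Sym2 (Fin n) → ℕ} {t : Fin k → ℕ} {A W U : Finset (Fin n)} {s q r : ℕ}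

lemma IsPrivate.ne {V : Type*} {c : Sym2 V → ℕ} {U : Finset V} {x y z : V} {γ : ℕ}
    (h : IsPrivate c U x γ) (hy : y ∈ U) (hz : z ∈ U) (hyz : y ≠ z) (hyx : y ≠ x) (hzx : z ≠ x) :
    c s(y, z) ≠ γ := fun he => (h y hy z hz hyz he).elim hyx hzx

/-- A path on three vertices outside the hub whose colors are private, and whose last vertex has a
suitable edge to the hub, extends to the linear forest. -/
lemma IsCritical.rainbowLF_of_path (h : IsCritical c A W U q r) (ht : ∀ i, 2 ≤ t i)
    (hs : s = ∑ i, t i / 2) (hq : s = q + 2) {i₁ i₂ : Fin k} (hi : i₁ ≠ i₂) (heven : Even (t i₂))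
    {p₁ p₂ p₃ : Fin n} (h1 : p₁ ∈ U \ A) (h2 : p₂ ∈ U \ A) (h3 : p₃ ∈ U \ A) (h12 : p₁ ≠ p₂)
    (h13 : p₁ ≠ p₃) (h23 : p₂ ≠ p₃)
    (hc₁ : IsPrivate c U p₁ (c s(p₁, p₂)) ∨ IsPrivate c U p₂ (c s(p₁, p₂)))
    (hc₂ : IsPrivate c U p₂ (c s(p₂, p₃))) (hne : c s(p₁, p₂) ≠ c s(p₂, p₃))
    (hend : A.Nonempty → p₃ ∈ W ∨ ∃ a ∈ A, IsPrivate c U p₃ (c s(p₃, a))) :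
    RainbowLF n c t := by
  have hcard := h.le_card
  have hA := h.card_hub
  rw [mem_sdiff] at h1 h2 h3
  have hWA : ∀ w ∈ W, w ∉ A := fun w hw hwA => disjoint_left.1 h.rainbowBip.1 hwA hw
  obtain ⟨w₁, hw₁, w₂, hw₂, hT₁, hT₂, hw, a₁, hend'⟩ : ∃ w₁ ∈ W, ∃ w₂ ∈ W,
      w₁ ∉ ({p₁, p₂, p₃} : Finset (Fin n)) ∧ w₂ ∉ ({p₁, p₂, p₃} : Finset (Fin n)) ∧ w₁ ≠ w₂ ∧
      ∃ a₁, A.Nonempty → a₁ ∈ A ∧ c s(w₁, w₂) ≠ c s(p₃, a₁) ∧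
        ∀ a ∈ A, a ≠ a₁ → ∀ w ∈ W, w ≠ p₃ → c s(w, a) ≠ c s(p₃, a₁) := by
    have hT : ({p₁, p₂, p₃} : Finset (Fin n)).card ≤ 3 := card_le_three
    obtain ⟨w₁, hw₁, w₂, hw₂, hT₁, hT₂, hw⟩ :=
      exists_pair_of_card (W := W) (T := {p₁, p₂, p₃}) (by omega)
    by_cases hAn : A.Nonempty
    · rcases hend hAn with hW | ⟨a, ha, hp⟩
      · obtain ⟨a, ha⟩ := hAn
        obtain ⟨w₁, hw₁, w₂, hw₂, hT₁, hT₂, hw, hcw⟩ :=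
          h.exists_pair p₃ hW a ha {p₁, p₂, p₃} (by omega)
        refine ⟨w₁, hw₁, w₂, hw₂, hT₁, hT₂, hw, a, fun _ => ⟨ha, hcw, fun b hb hba w hw hwp he => ?_⟩⟩
        rw [Sym2.eq_swap, Sym2.eq_swap (a := p₃)] at he
        exact hba (h.rainbowBip.2 b hb a ha w hw p₃ hW he).1
      · refine ⟨w₁, hw₁, w₂, hw₂, hT₁, hT₂, hw, a, fun _ => ⟨ha, ?_, fun b hb hba w hw hwp => ?_⟩⟩
        · simp only [mem_insert, mem_singleton, not_or] at hT₁ hT₂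
          exact hp.ne (h.subset hw₁) (h.subset hw₂) hw hT₁.2.2 hT₂.2.2
        · exact hp.ne (h.subset hw) (h.hub_subset hb) (fun he => hWA w hw (he ▸ hb)) hwp
            (fun he => h3.2 (he ▸ hb))
    · exact ⟨w₁, hw₁, w₂, hw₂, hT₁, hT₂, hw, p₁, fun h => (hAn h).elim⟩
  simp only [mem_insert, mem_singleton, not_or] at hT₁ hT₂
  obtain ⟨v₁, v₂, hv₁, hv₂, hv, hS₁, hS₂, hend', hor⟩ : ∃ v₁ v₂, v₁ ∈ W ∧ v₂ ∈ W ∧ v₁ ≠ v₂ ∧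
      (v₁ ≠ p₁ ∧ v₁ ≠ p₂ ∧ v₁ ≠ p₃) ∧ (v₂ ≠ p₁ ∧ v₂ ≠ p₂ ∧ v₂ ≠ p₃) ∧
      (A.Nonempty → a₁ ∈ A ∧ c s(v₁, v₂) ≠ c s(p₃, a₁) ∧
        ∀ a ∈ A, a ≠ a₁ → ∀ w ∈ W, w ≠ p₃ → c s(w, a) ≠ c s(p₃, a₁)) ∧
      ∀ a ∈ A, c s(v₂, a) ≠ c s(v₁, v₂) := by
    rcases h.rainbowBip.exists_end hw₁ hw₂ hw (c s(w₁, w₂)) with hor | hor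
    · exact ⟨w₂, w₁, hw₂, hw₁, hw.symm, hT₂, hT₁, by rwa [Sym2.eq_swap (a := w₂)],
        by rwa [Sym2.eq_swap (a := w₂)]⟩
    · exact ⟨w₁, w₂, hw₁, hw₂, hw, hT₁, hT₂, hend', hor⟩
  have ne₁ : ∀ x ∈ U, ∀ y ∈ U, x ≠ y → x ≠ p₁ → x ≠ p₂ → y ≠ p₁ → y ≠ p₂ →
      c s(x, y) ≠ c s(p₁, p₂) := fun x hx y hy hxy hx1 hx2 hy1 hy2 =>
    hc₁.elim (fun hp => hp.ne hx hy hxy hx1 hy1) fun hp => hp.ne hx hy hxy hx2 hy2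
  have neA : ∀ a ∈ A, a ∈ U ∧ a ≠ p₁ ∧ a ≠ p₂ ∧ a ≠ p₃ ∧ a ≠ v₂ := fun a ha =>
    ⟨h.hub_subset ha, fun he => h1.2 (he ▸ ha), fun he => h2.2 (he ▸ ha), fun he => h3.2 (he ▸ ha),
      fun he => hWA v₂ hv₂ (he ▸ ha)⟩
  have e₁ := ne₁ v₁ (h.subset hv₁) v₂ (h.subset hv₂) hv hS₁.1 hS₁.2.1 hS₂.1 hS₂.2.1
  have e₂ := hc₂.ne (h.subset hv₁) (h.subset hv₂) hv hS₁.2.1 hS₂.2.1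
  have f₁ : ∀ a ∈ A, c s(p₃, a) ≠ c s(p₁, p₂) := fun a ha =>
    ne₁ p₃ h3.1 a (neA a ha).1 (neA a ha).2.2.2.1.symm h13.symm h23.symm (neA a ha).2.1
      (neA a ha).2.2.1
  have f₂ : ∀ a ∈ A, c s(p₃, a) ≠ c s(p₂, p₃) := fun a ha =>
    hc₂.ne h3.1 (neA a ha).1 (neA a ha).2.2.2.1.symm h23.symm (neA a ha).2.2.1
  have g₁ : ∀ a ∈ A, c s(v₂, a) ≠ c s(p₁, p₂) := fun a ha =>
    ne₁ v₂ (h.subset hv₂) a (neA a ha).1 (neA a ha).2.2.2.2.symm hS₂.1 hS₂.2.1 (neA a ha).2.1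
      (neA a ha).2.2.1
  have g₂ : ∀ a ∈ A, c s(v₂, a) ≠ c s(p₂, p₃) := fun a ha =>
    hc₂.ne (h.subset hv₂) (neA a ha).1 (neA a ha).2.2.2.2.symm hS₂.2.1 (neA a ha).2.2.1
  have hvA₁ := hWA v₁ hv₁
  have hvA₂ := hWA v₂ hv₂
  have hh₁ : A.Nonempty → (∀ a ∈ A, a ≠ a₁ → c s(v₂, a) ≠ c s(p₃, a₁)) := fun hAn a ha hne =>
    (hend' hAn).2.2 a ha hne v₂ hv₂ hS₂.2.2
  have hh₂ : A.Nonempty → c s(p₃, a₁) ≠ c s(v₁, v₂) := fun hAn => (hend' hAn).2.1.symm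
  have hh₃ : A.Nonempty → a₁ ∈ A := fun hAn => (hend' hAn).1
  clear hend hend' hT₁ hT₂ hc₁ hc₂ ne₁ neA
  rw [Nat.even_iff] at heven
  rcases Nat.even_or_odd (t i₁) with hpar | hpar
  · rw [Nat.even_iff] at hpar
    refine rainbowLF_of_pair (P₁ := [p₂, p₃]) (P₂ := [v₁, v₂]) (l₁ := p₃) (l₂ := v₂) ht h.rainbowBip hs (by omega)
      (by omega) hi (by simp) (by simp) (by simp; omega) (by simp; omega) ?_ ?_ ?_ ?_ ?_
    · simp [*]
    · simp [*, Ne.symm]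
    · simp [e₂.symm]
    · intro hAn
      exact ⟨a₁, hh₃ hAn, by simp [hh₂ hAn, f₂ _ (hh₃ hAn)], hh₁ hAn⟩
    · intro a ha
      simp [hor a ha, g₂ a ha]
  · rw [Nat.odd_iff] at hpar
    refine rainbowLF_of_pair (P₁ := [p₁, p₂, p₃]) (P₂ := [v₁, v₂]) (l₁ := p₃) (l₂ := v₂) ht h.rainbowBip hs (by omega)
      (by omega) hi (by simp) (by simp) (by simp; omega) (by simp; omega) ?_ ?_ ?_ ?_ ?_
    · simp [*]
    · simp [*, Ne.symm]
    · simp [e₂.symm, e₁.symm, hne]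
    · intro hAn
      exact ⟨a₁, hh₃ hAn, by simp [hh₂ hAn, f₂ _ (hh₃ hAn), f₁ _ (hh₃ hAn)], hh₁ hAn⟩
    · intro a ha
      simp [hor a ha, g₁ a ha, g₂ a ha]
end

section
variable {n : ℕ} {c : Sym2 (Fin n) → ℕ} {A W U : Finset (Fin n)} {q r : ℕ}

lemma IsCritical.succ_le_card_lost (h : IsCritical c A W U q r) {x : Fin n} (hx : x ∈ U)
    (hxA : x ∉ A) (hxW : x ∉ W) : q + 1 ≤ (cols c U \ cols c (U \ {x})).card := by
  simpa using h.le_lost {x} (by simpa) (by simpa) (by simpa) (by simp)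

lemma IsCritical.rainbowBip_sdiff (h : IsCritical c A W U q r)
    (huniq : ∀ x ∈ U, x ∉ A → x ∉ W → ∀ u ∈ U \ A, ∀ v ∈ U \ A, x ≠ u → x ≠ v →
      IsPrivate c U x (c s(x, u)) → IsPrivate c U x (c s(x, v)) → c s(x, u) = c s(x, v)) :
    RainbowBip c A (U \ A) := by
  have key : ∀ x ∈ U, x ∉ A → x ∉ W → Set.InjOn (fun a => c s(x, a)) A ∧
      ∀ a ∈ A, IsPrivate c U x (c s(x, a)) := by
    intro x hx hxA hxW
    have h1 := h.succ_le_card_lost hx hxA hxW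
    set Γ := cols c U \ cols c (U \ {x}) with hΓ
    set I := A.image fun a => c s(x, a) with hI
    have h2 : (Γ \ I).card ≤ 1 := by
      have key : ∀ γ ∈ Γ \ I, ∃ y ∈ U \ A, x ≠ y ∧ IsPrivate c U x γ ∧ c s(x, y) = γ := by
        intro γ hγ
        rw [mem_sdiff] at hγ
        obtain ⟨hp, y, hy, hyx, hc⟩ := exists_of_mem_cols_sdiff hγ.1
        exact ⟨y, mem_sdiff.2 ⟨hy, fun hyA => hγ.2 (mem_image.2 ⟨y, hyA, hc⟩)⟩, hyx.symm, hp,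
          hc⟩
      rw [card_le_one]
      intro γ hγ δ hδ
      obtain ⟨y, hy, hxy, hp, rfl⟩ := key γ hγ
      obtain ⟨z, hz, hxz, hp', rfl⟩ := key δ hδ
      exact huniq x hx hxA hxW y hy z hz hxy hxz hp hp'
    have h3 := card_sdiff_add_card_inter Γ I
    have h4 : I.card ≤ q := card_image_le.trans_eq h.card_hub
    have h5 : (Γ ∩ I).card ≤ I.card := card_le_card inter_subset_right
    have h6 : Γ ∩ I = I := eq_of_subset_of_card_le inter_subset_right (by omega)
    refine ⟨card_image_iff.1 (by rw [h.card_hub]; change I.card = q; omega), fun a ha => ?_⟩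
    have h7 : c s(x, a) ∈ Γ ∩ I := h6.ge (mem_image_of_mem (fun a => c s(x, a)) ha)
    exact (exists_of_mem_cols_sdiff (mem_inter.1 h7).1).1
  refine ⟨disjoint_sdiff, fun a ha a' ha' w hw w' hw' he => ?_⟩
  rw [mem_sdiff] at hw hw'
  have priv : ∀ a ∈ A, ∀ a' ∈ A, ∀ w ∈ U, w ∉ A → w ∉ W → ∀ w' ∈ U, w' ∉ A →
      c s(a, w) = c s(a', w') → w' = w := by
    intro a ha a' ha' w hw hwA hwW w' hw' hwA' he
    have hp := (key w hw hwA hwW).2 a ha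
    rw [Sym2.eq_swap, he] at hp
    exact (hp a' (h.hub_subset ha') w' hw' (fun h => hwA' (h ▸ ha')) rfl).resolve_left
      fun h => hwA (h ▸ ha')
  by_cases hwW : w ∈ W
  · by_cases hwW' : w' ∈ W
    · exact h.rainbowBip.2 a ha a' ha' w hwW w' hwW' he
    · exact (hwW' (priv a' ha' a ha w' hw'.1 hw'.2 hwW' w hw.1 hw.2 he.symm ▸ hwW)).elim
  · have e := priv a ha a' ha' w hw.1 hw.2 hwW w' hw'.1 hw'.2 he
    subst e
    refine ⟨(key _ hw.1 hw.2 hwW).1 ha ha' ?_, rfl⟩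
    simpa only [Sym2.eq_swap (a := w')] using he

end

/-- The color of each edge of the list is private for its later endpoint. -/
def IsPrivateChain {V : Type*} (c : Sym2 V → ℕ) (U : Finset V) (l : List V) : Prop :=
  l.IsChain fun y z => IsPrivate c U z (c s(y, z))

lemma IsPrivateChain.notMem_map_edgesL {V : Type*} {c : Sym2 V → ℕ} {U : Finset V} {l : List V}
    (h : IsPrivateChain c U l) {x y : V} (hx : x ∈ U) (hy : y ∈ U) (hxy : x ≠ y)
    (hxl : x ∉ l.tail) (hyl : y ∉ l.tail) : c s(x, y) ∉ (edgesL l).map c := by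
  fun_induction edgesL l with
  | case1 => simp
  | case2 => simp
  | case3 a b l ih =>
    obtain ⟨h1, h2⟩ := List.isChain_cons_cons.1 h
    simp only [List.tail_cons, List.mem_cons, not_or] at hxl hyl
    rw [List.map_cons, List.mem_cons, not_or]
    exact ⟨h1.ne hx hy hxy hxl.1 hyl.1, ih h2 hxl.2 hyl.2⟩

lemma IsPrivateChain.nodup_map_edgesL {V : Type*} {c : Sym2 V → ℕ} {U : Finset V} {l : List V}
    (h : IsPrivateChain c U l) (hl : l.Nodup) (hU : ∀ x ∈ l, x ∈ U) :
    ((edgesL l).map c).Nodup := by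
  fun_induction edgesL l with
  | case1 => simp
  | case2 => simp
  | case3 a b l ih =>
    have h' : IsPrivateChain c U (b :: l) := (List.isChain_cons_cons.1 h).2
    simp only [List.nodup_cons, List.mem_cons, not_or] at hl
    rw [List.map_cons, List.nodup_cons]
    exact ⟨h'.notMem_map_edgesL (hU a (by simp)) (hU b (by simp)) hl.1.1 hl.1.2 hl.2.1,
      ih h' (by simpa using hl.2) fun x hx => hU x (by simp at hx; simp [hx])⟩

section
variable {n k : ℕ} {c : Sym2 (Fin n) → ℕ} {t : Fin k → ℕ} {A W U : Finset (Fin n)} {s q r : ℕ}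

/-- Beyond a path with two private colors, private colors lead outside the hub and outside `W`. -/
lemma IsCritical.notMem_of_isPrivate (h : IsCritical c A W U q r) (ht : ∀ i, 2 ≤ t i)
    (hs : s = ∑ i, t i / 2) (hq : s = q + 2) {i₁ i₂ : Fin k} (hi : i₁ ≠ i₂) (heven : Even (t i₂))
    (hF : ¬ RainbowLF n c t) {p₁ p₂ p₃ y : Fin n} (h1 : p₁ ∈ U \ A) (h2 : p₂ ∈ U \ (A ∪ W))
    (h3 : p₃ ∈ U \ A) (h12 : p₁ ≠ p₂) (h13 : p₁ ≠ p₃) (h23 : p₂ ≠ p₃)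
    (hc₁ : IsPrivate c U p₁ (c s(p₁, p₂)) ∨ IsPrivate c U p₂ (c s(p₁, p₂)))
    (hc₂ : IsPrivate c U p₂ (c s(p₂, p₃))) (hne : c s(p₁, p₂) ≠ c s(p₂, p₃)) (hy : y ∈ U)
    (hyp : y ≠ p₃) (hpy : IsPrivate c U p₃ (c s(p₃, y))) : y ∉ A ∪ W := by
  have h2' : p₂ ∈ U \ A := by simp only [mem_sdiff, mem_union, not_or] at h2 ⊢; tauto
  rw [mem_union]
  rintro (hyA | hyW)
  · exact hF (h.rainbowLF_of_path ht hs hq hi heven h1 h2' h3 h12 h13 h23 hc₁ hc₂ hne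
      fun _ => Or.inr ⟨y, hyA, hpy⟩)
  · have hyp₂ : y ≠ p₂ := by rintro rfl; simp [hyW] at h2
    have hyA : y ∈ U \ A := mem_sdiff.2 ⟨hy, disjoint_right.1 h.rainbowBip.1 hyW⟩
    refine hF (h.rainbowLF_of_path ht hs hq hi heven h2' h3 hyA h23 hyp₂.symm hyp.symm
      (Or.inl hc₂) hpy ?_ fun _ => Or.inl hyW)
    exact (hc₂.ne (mem_sdiff.1 h3).1 hy hyp.symm h23.symm hyp₂).symm

lemma IsCritical.exists_isPrivateChain (h : IsCritical c A W U q r) (ht : ∀ i, 2 ≤ t i)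
    (hs : s = ∑ i, t i / 2) (hq : s = q + 2) {i₁ i₂ : Fin k} (hi : i₁ ≠ i₂) (heven : Even (t i₂))
    (hF : ¬ RainbowLF n c t) {x v : Fin n} (hx : x ∈ U \ (A ∪ W)) (hv : v ∈ U \ (A ∪ W))
    (hxv : x ≠ v) (hp : IsPrivate c U x (c s(v, x)))
    (hpv : ∀ y ∈ U, y ≠ v → IsPrivate c U v (c s(v, y)) → y ∉ A ∪ W) (m : ℕ) (hm : m ≤ q) :
    ∃ z z' l, l.length = m ∧ (z :: z' :: l).Nodup ∧ (∀ y ∈ z :: z' :: l, y ∈ U \ (A ∪ W)) ∧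
      IsPrivateChain c U (z :: z' :: l) ∧
      ∀ y ∈ U, y ≠ z → IsPrivate c U z (c s(z, y)) → y ∉ A ∪ W := by
  induction m with
  | zero =>
    refine ⟨v, x, [], rfl, by simp [hxv.symm], ?_, ?_, hpv⟩
    · simp only [List.forall_mem_cons]; exact ⟨hv, hx, by simp⟩
    · exact List.isChain_cons_cons.2 ⟨hp, List.isChain_singleton _⟩
  | succ m ih =>
    obtain ⟨z, z', l, hl, hnd, hX, hch, hz⟩ := ih (by omega)
    have hzX := hX z (by simp)
    have hzX' := hX z' (by simp)
    have sub : ∀ {y}, y ∈ U \ (A ∪ W) → y ∈ U \ A := fun hy =>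
      sdiff_subset_sdiff Subset.rfl subset_union_left hy
    have h1 : q + 1 ≤ (cols c U \ cols c (U \ {z})).card := by
      simp only [mem_sdiff, mem_union, not_or] at hzX
      exact h.succ_le_card_lost hzX.1 hzX.2.1 hzX.2.2
    obtain ⟨γ, hγ, hγl⟩ : ∃ γ ∈ cols c U \ cols c (U \ {z}),
        γ ∉ ((z' :: l).toFinset.image fun y => c s(z, y)) := by
      by_contra! hcon
      have h2 := card_le_card (subset_iff.2 hcon)
      have h3 := (card_image_le (s := (z' :: l).toFinset) (f := fun y => c s(z, y))).trans
        (List.toFinset_card_le _)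
      simp only [List.length_cons] at h3
      omega
    obtain ⟨hpγ, y, hy, hyz, rfl⟩ := exists_of_mem_cols_sdiff hγ
    have hyX : y ∈ U \ (A ∪ W) := mem_sdiff.2 ⟨hy, hz y hy hyz hpγ⟩
    have hyl : y ∉ z' :: l := fun hyl => hγl (mem_image.2 ⟨y, by simpa using hyl, rfl⟩)
    have hzz' : z ≠ z' := by rintro rfl; simp at hnd
    have hpc := (List.isChain_cons_cons.1 hch).1
    rw [Sym2.eq_swap] at hpc
    refine ⟨y, z, z' :: l, by simp [hl], ?_, ?_, ?_, ?_⟩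
    · exact List.nodup_cons.2 ⟨by rw [List.mem_cons, not_or]; exact ⟨hyz, hyl⟩, hnd⟩
    · rw [List.forall_mem_cons]; exact ⟨hyX, hX⟩
    · exact List.isChain_cons_cons.2 ⟨by rwa [Sym2.eq_swap], hch⟩
    · intro w hw hwy hpw
      have hyz' : z' ≠ y := fun he => hyl (by simp [he])
      exact h.notMem_of_isPrivate ht hs hq hi heven hF (sub hzX') hzX (sub hyX) hzz'.symm hyz'
        hyz.symm (Or.inl hpc) hpγ (hpc.ne (mem_sdiff.1 hzX).1 hy hyz.symm hzz' hyz'.symm).symm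
        hw hwy hpw

end

lemma exists_le_sum_half {k : ℕ} (hk : 2 ≤ k) {t : Fin k → ℕ} {s : ℕ} (ht : ∀ i, 2 ≤ t i)
    (heven : ∃ i, Even (t i)) (hs : s = ∑ i, t i / 2) (h3 : 3 ≤ s) :
    (∃ j i, j ≠ i ∧ t j ≤ s ∧ (2 ≤ t j / 2 ∨ Even (t i))) ∨
      ∃ j i, j ≠ i ∧ t i = 2 ∧ t j + 1 = 2 * s := by
  obtain ⟨i, hi⟩ := heven
  by_cases hex : ∃ j, j ≠ i ∧ t j ≤ s
  · obtain ⟨j, hj, hjs⟩ := hex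
    exact Or.inl ⟨j, i, hj, hjs, Or.inr hi⟩
  push Not at hex
  obtain ⟨j, hj⟩ : ∃ j : Fin k, j ≠ i := by
    have : Nontrivial (Fin k) := Fin.nontrivial_iff_two_le.2 hk
    exact exists_ne i
  have hjs := hex j hj
  have hti := ht i
  rw [Nat.even_iff] at hi
  have huniv : (univ : Finset (Fin k)) = {i, j} := by
    symm
    rw [eq_univ_iff_forall]
    intro l
    by_contra hl
    simp only [mem_insert, mem_singleton, not_or] at hl
    have h1 : ∑ m ∈ {l, i, j}, t m / 2 ≤ ∑ m, t m / 2 :=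
      sum_le_sum_of_subset (subset_univ _)
    rw [sum_insert (by simp [hl]), sum_pair hj.symm, ← hs] at h1
    have := hex l hl.1
    omega
  rw [huniv, sum_pair hj.symm] at hs
  by_cases h2 : 2 ≤ t i / 2
  · exact Or.inl ⟨i, j, hj.symm, by omega, Or.inl h2⟩
  · by_cases hpar : t j % 2 = 0
    · exact Or.inl ⟨i, j, hj.symm, by omega, Or.inr (Nat.even_iff.2 hpar)⟩
    · exact Or.inr ⟨j, i, hj, by omega, by omega⟩

section
variable {n k : ℕ} {c : Sym2 (Fin n) → ℕ} {t : Fin k → ℕ} {A W U : Finset (Fin n)} {s q r : ℕ}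

lemma IsCritical.rainbowLF_of_isPrivateChain (h : IsCritical c A W U q r) (ht : ∀ i, 2 ≤ t i)
    (hs : s = ∑ i, t i / 2) (hq : s = q + 2) {i j : Fin k} (hij : j ≠ i) {l : List (Fin n)}
    (hl : IsPrivateChain c U l) (hnd : l.Nodup) (hX : ∀ y ∈ l, y ∈ U \ (A ∪ W))
    (hlen : l.length = s) (hj : t j ≤ s) (hji : 2 ≤ t j / 2 ∨ Even (t i)) :
    RainbowLF n c t := by
  have hcard := h.le_card
  have hA := h.card_hub
  have hWA : ∀ w ∈ W, w ∉ A := fun w hw hwA => disjoint_left.1 h.rainbowBip.1 hwA hw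
  have hlU : ∀ y ∈ l, y ∈ U := fun y hy => (mem_sdiff.1 (hX y hy)).1
  have hlA : l.countP (· ∈ A) = 0 := by
    rw [List.countP_eq_zero]
    intro y hy
    have := hX y hy
    simp only [mem_sdiff, mem_union, not_or] at this
    simp [this.2.1]
  have hcnd := hl.nodup_map_edgesL hnd hlU
  have hsum := half_add_half_le_sum t hij
  have hti := ht i
  have htj := ht j
  have hAl : ∀ a ∈ A, a ∈ U ∧ a ∉ l := fun a ha => ⟨h.hub_subset ha, fun hal => by
    have := hX a hal
    simp [ha] at this⟩
  have hWl : ∀ w ∈ W, w ∈ U ∧ w ∉ l := fun w hw => ⟨h.subset hw, fun hwl => by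
    have := hX w hwl
    simp [hw] at this⟩
  have hnot : ∀ x y, x ∈ U ∧ x ∉ l → y ∈ U ∧ y ∉ l → x ≠ y → c s(x, y) ∉ (edgesL l).map c :=
    fun x y hx hy hxy => hl.notMem_map_edgesL hx.1 hy.1 hxy (fun h => hx.2 (List.mem_of_mem_tail h))
      fun h => hy.2 (List.mem_of_mem_tail h)
  by_cases hb : 2 ≤ t j / 2
  · exact rainbowLF_of_two ht h.rainbowBip hs (by omega) hij l [] 0 (t i / 2) (by simpa)
      (by simpa using hcnd) (Or.inl (by omega)) (Or.inr ⟨by simp, by simp; omega⟩)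
      (by simp only [List.countP_nil]; omega) (by simp only [List.length_nil]; omega)
  have heven := hji.resolve_left hb
  rw [Nat.even_iff] at heven
  obtain ⟨w₁, hw₁, w₂, hw₂, -, -, hw⟩ := exists_pair_of_card (W := W) (T := ∅) (by simp; omega)
  have e₁ := hnot w₁ w₂ (hWl w₁ hw₁) (hWl w₂ hw₂) hw
  by_cases hb' : t i / 2 = 1
  · refine rainbowLF_of_two ht h.rainbowBip hs (by omega) hij l [w₁, w₂] 0 0 ?_ ?_
      (Or.inl (by omega)) (Or.inl (by simp; omega)) ?_ ?_
    · rw [List.nodup_append']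
      exact ⟨hnd, by simp [hw], by simp [hWl w₁ hw₁, hWl w₂ hw₂]⟩
    · rw [List.map_append, List.nodup_append']
      exact ⟨hcnd, by simp, by simpa using e₁⟩
    · rw [hlA, List.countP_eq_zero.2 (by simp [hWA w₁ hw₁, hWA w₂ hw₂])]
      omega
    · simp only [List.length_cons, List.length_nil]; omega
  · obtain ⟨a, ha⟩ := card_pos.1 (show 0 < A.card by omega)
    obtain ⟨v₁, v₂, hv₁, hv₂, hv, e₁, hor⟩ : ∃ v₁ v₂, v₁ ∈ W ∧ v₂ ∈ W ∧ v₁ ≠ v₂ ∧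
        c s(v₁, v₂) ∉ (edgesL l).map c ∧ ∀ a ∈ A, c s(v₂, a) ≠ c s(v₁, v₂) := by
      rcases h.rainbowBip.exists_end hw₁ hw₂ hw (c s(w₁, w₂)) with hor | hor
      · exact ⟨w₂, w₁, hw₂, hw₁, hw.symm, by rwa [Sym2.eq_swap], by rwa [Sym2.eq_swap (a := w₂)]⟩
      · exact ⟨w₁, w₂, hw₁, hw₂, hw, e₁, hor⟩
    have e₂ := hnot v₂ a (hWl v₂ hv₂) (hAl a ha) (fun he => hWA v₂ hv₂ (he ▸ ha))
    have e₃ := hor a ha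
    have n₁ : v₁ ≠ a := fun he => hWA v₁ hv₁ (he ▸ ha)
    have n₂ : v₂ ≠ a := fun he => hWA v₂ hv₂ (he ▸ ha)
    refine rainbowLF_of_two ht h.rainbowBip hs (by omega) hij l [v₁, v₂, a] 0 (t i / 2 - 2) ?_ ?_
      (Or.inl (by omega)) (Or.inr ⟨by simp [ha], by simp; omega⟩) ?_ ?_
    · rw [List.nodup_append']
      exact ⟨hnd, by simp [hv, n₁, n₂], by simp [hWl v₁ hv₁, hWl v₂ hv₂, hAl a ha]⟩
    · rw [List.map_append, List.nodup_append']
      refine ⟨hcnd, by simp [e₃.symm], ?_⟩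
      simp at e₁ e₂ ⊢
      exact ⟨e₁, e₂⟩
    · rw [hlA]
      simp [hWA v₁ hv₁, hWA v₂ hv₂, ha]
      omega
    · simp only [List.length_cons, List.length_nil]; omega

lemma IsCritical.rainbowLF_of_isPrivateChain_of_eq_two (h : IsCritical c A W U q r)
    (ht : ∀ i, 2 ≤ t i) (hs : s = ∑ i, t i / 2) (hq : s = q + 2) (hq2 : 2 ≤ q) {i j : Fin k}
    (hij : j ≠ i) {z : Fin n} {l : List (Fin n)} (hl : IsPrivateChain c U (z :: l))
    (hnd : (z :: l).Nodup) (hX : ∀ y ∈ z :: l, y ∈ U \ (A ∪ W)) (hlen : (z :: l).length = s)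
    (hi : t i = 2) (hj : t j + 1 = 2 * s) : RainbowLF n c t := by
  have hcard := h.le_card
  have hA := h.card_hub
  have hWA : ∀ w ∈ W, w ∉ A := fun w hw hwA => disjoint_left.1 h.rainbowBip.1 hwA hw
  have hlU : ∀ y ∈ z :: l, y ∈ U := fun y hy => (mem_sdiff.1 (hX y hy)).1
  have hlA : (z :: l).countP (· ∈ A) = 0 := by
    rw [List.countP_eq_zero]
    intro y hy
    have := hX y hy
    simp only [mem_sdiff, mem_union, not_or] at this
    simp [this.2.1]
  have hcnd := hl.nodup_map_edgesL hnd hlU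
  have hAl : ∀ a ∈ A, a ∈ U ∧ a ∉ z :: l := fun a ha => ⟨h.hub_subset ha, fun hal => by
    have := hX a hal
    simp [ha] at this⟩
  have hWl : ∀ w ∈ W, w ∈ U ∧ w ∉ z :: l := fun w hw => ⟨h.subset hw, fun hwl => by
    have := hX w hwl
    simp [hw] at this⟩
  have hnot : ∀ x y, x ∈ U ∧ x ∉ l → y ∈ U ∧ y ∉ l → x ≠ y → c s(x, y) ∉ (edgesL (z :: l)).map c :=
    fun x y hx hy hxy => hl.notMem_map_edgesL hx.1 hy.1 hxy hx.2 hy.2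
  have hz : z ∈ U ∧ z ∉ l := ⟨hlU z (by simp), (List.nodup_cons.1 hnd).1⟩
  obtain ⟨a₁, ha₁, a₂, ha₂, ha⟩ := one_lt_card.1 (show 1 < A.card by omega)
  obtain ⟨w₁, hw₁, w₂, hw₂, -, -, hw⟩ := exists_pair_of_card (W := W) (T := ∅) (by simp; omega)
  obtain ⟨w₃, hw₃, -, -, hT, -, -⟩ := exists_pair_of_card (W := W) (T := {w₁, w₂})
    (by have : ({w₁, w₂} : Finset (Fin n)).card ≤ 2 := card_le_two
        omega)
  simp only [mem_insert, mem_singleton, not_or] at hT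
  obtain ⟨a, ha', b, hb, hab, hwa⟩ : ∃ a ∈ A, ∃ b ∈ A, a ≠ b ∧ c s(a, w₁) ≠ c s(w₁, z) := by
    by_cases he : c s(a₁, w₁) = c s(w₁, z)
    · refine ⟨a₂, ha₂, a₁, ha₁, ha.symm, fun he' => ha ?_⟩
      exact (h.rainbowBip.2 a₁ ha₁ a₂ ha₂ w₁ hw₁ w₁ hw₁ (he.trans he'.symm)).1
    · exact ⟨a₁, ha₁, a₂, ha₂, ha, he⟩
  obtain ⟨w, hwW, hww, hbw⟩ : ∃ w ∈ W, w ≠ w₁ ∧ c s(b, w) ≠ c s(w₁, z) := by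
    by_cases he : c s(b, w₂) = c s(w₁, z)
    · refine ⟨w₃, hw₃, hT.1, fun he' => hT.2 ?_⟩
      exact (h.rainbowBip.2 b hb b hb w₃ hw₃ w₂ hw₂ (he'.trans he.symm)).2
    · exact ⟨w₂, hw₂, hw.symm, he⟩
  have f : c s(a, w₁) ≠ c s(b, w) := fun he => hab (h.rainbowBip.2 a ha' b hb w₁ hw₁ w hwW he).1
  have na : ∀ a ∈ A, ∀ w ∈ W, a ≠ w := fun a ha w hw he => hWA w hw (he ▸ ha)
  have o : ∀ {y}, y ∈ U ∧ y ∉ z :: l → y ∈ U ∧ y ∉ l := fun hy =>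
    ⟨hy.1, fun hyl => hy.2 (List.mem_cons_of_mem _ hyl)⟩
  have e₁ := hnot w₁ z (o (hWl w₁ hw₁)) hz (fun he => (hWl w₁ hw₁).2 (by simp [he]))
  have e₂ := hnot a w₁ (o (hAl a ha')) (o (hWl w₁ hw₁)) (na a ha' w₁ hw₁)
  have e₃ := hnot b w (o (hAl b hb)) (o (hWl w hwW)) (na b hb w hwW)
  have g₁ := hWl w₁ hw₁
  have g₂ := hAl a ha'
  have g₃ := hAl b hb
  have g₄ := hWl w hwW
  refine rainbowLF_of_two ht h.rainbowBip hs (by omega) hij (a :: w₁ :: z :: l).reverse [b, w]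
    (q - 2) 0 ?_ ?_ (Or.inr ⟨by simp [ha'], by simp at hlen ⊢; omega⟩)
    (Or.inl (by simp; omega)) ?_ ?_
  · rw [(List.Perm.append_right _ (List.reverse_perm _)).nodup_iff, List.nodup_append']
    refine ⟨?_, by simp [na b hb w hwW], ?_⟩
    · rw [List.nodup_cons, List.nodup_cons, List.mem_cons, not_or]
      exact ⟨⟨na a ha' w₁ hw₁, g₂.2⟩, g₁.2, hnd⟩
    · have n1 := na b hb w₁ hw₁
      have n2 := (na a ha' w hwW).symm
      simp only [List.mem_cons, not_or] at g₃ g₄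
      simp [*, Ne.symm]
  · rw [edgesL_reverse, ((List.Perm.append_right _ (List.reverse_perm _)).map c).nodup_iff,
      List.map_append, List.nodup_append', edgesL_cons_cons, edgesL_cons_cons]
    refine ⟨?_, by simp, ?_⟩
    · rw [List.map_cons, List.map_cons, List.nodup_cons, List.nodup_cons, List.mem_cons, not_or]
      exact ⟨⟨hwa, e₂⟩, e₁, hcnd⟩
    · rw [List.disjoint_right]
      simp only [edgesL_cons_cons, edgesL_singleton, List.map_cons, List.map_nil,
        List.mem_cons, List.not_mem_nil, or_false, forall_eq, not_or]
      exact ⟨f.symm, hbw, by simpa using e₃⟩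
  · rw [List.countP_reverse, List.countP_cons, List.countP_cons, hlA]
    simp [ha', hWA w₁ hw₁, hb, hWA w hwW]
    omega
  · simp only [List.length_reverse, List.length_cons, List.length_nil] at hlen ⊢
    omega

end

section
variable {n k : ℕ} {c : Sym2 (Fin n) → ℕ} {t : Fin k → ℕ} {A W U : Finset (Fin n)} {s r : ℕ}

/-- The case of a single hub vertex and the forest `P₅ ∪ P₂`: a rainbow path on four vertices whose
colors appear only at its first three vertices suffices. -/
lemma IsCritical.rainbowLF_of_lost (h : IsCritical c A W U 1 r) (ht : ∀ i, 2 ≤ t i)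
    (hs : s = ∑ i, t i / 2) (hs3 : s = 3) {i j : Fin k} (hij : j ≠ i) (hi : t i = 2) (hj : t j = 5)
    {p₁ p₂ p₃ p₄ : Fin n} (h1 : p₁ ∈ U \ (A ∪ W)) (h2 : p₂ ∈ U \ (A ∪ W))
    (h3 : p₃ ∈ U \ (A ∪ W)) (h4 : p₄ ∈ U) (hnd : [p₁, p₂, p₃, p₄].Nodup)
    (hcnd : [c s(p₁, p₂), c s(p₂, p₃), c s(p₃, p₄)].Nodup)
    (hlost : ∀ γ ∈ [c s(p₁, p₂), c s(p₂, p₃), c s(p₃, p₄)], ∀ y ∈ U, ∀ z ∈ U, y ≠ z →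
      y ∉ [p₁, p₂, p₃] → z ∉ [p₁, p₂, p₃] → c s(y, z) ≠ γ) : RainbowLF n c t := by
  have hcard := h.le_card
  have hA := h.card_hub
  have hWA : ∀ w ∈ W, w ∉ A := fun w hw hwA => disjoint_left.1 h.rainbowBip.1 hwA hw
  simp only [mem_sdiff, mem_union, not_or] at h1 h2 h3
  have hAp : ∀ a ∈ A, a ∈ U ∧ a ≠ p₁ ∧ a ≠ p₂ ∧ a ≠ p₃ := fun a ha =>
    ⟨h.hub_subset ha, fun he => h1.2.1 (he ▸ ha), fun he => h2.2.1 (he ▸ ha),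
      fun he => h3.2.1 (he ▸ ha)⟩
  have hWp : ∀ w ∈ W, w ∈ U ∧ w ≠ p₁ ∧ w ≠ p₂ ∧ w ≠ p₃ := fun w hw =>
    ⟨h.subset hw, fun he => h1.2.2 (he ▸ hw), fun he => h2.2.2 (he ▸ hw),
      fun he => h3.2.2 (he ▸ hw)⟩
  have h4p : p₄ ∈ U ∧ p₄ ≠ p₁ ∧ p₄ ≠ p₂ ∧ p₄ ≠ p₃ := by
    simp at hnd
    exact ⟨h4, fun he => hnd.1.2.2 he.symm, fun he => hnd.2.1.2 he.symm, fun he => hnd.2.2 he.symm⟩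
  have finish : ∀ p₅ r₁ r₂ : Fin n, p₅ ∈ U ∧ p₅ ≠ p₁ ∧ p₅ ≠ p₂ ∧ p₅ ≠ p₃ →
      r₁ ∈ U ∧ r₁ ≠ p₁ ∧ r₁ ≠ p₂ ∧ r₁ ≠ p₃ → r₂ ∈ U ∧ r₂ ≠ p₁ ∧ r₂ ≠ p₂ ∧ r₂ ≠ p₃ →
      [p₄, p₅, r₁, r₂].Nodup → c s(p₄, p₅) ≠ c s(r₁, r₂) →
      [p₄, p₅, r₁, r₂].countP (· ∈ A) ≤ 1 → RainbowLF n c t := by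
    intro p₅ r₁ r₂ h5 h6 h7 hnd' hc hcount
    have e₁ : c s(p₄, p₅) ∉ [c s(p₁, p₂), c s(p₂, p₃), c s(p₃, p₄)] := fun hmem =>
      hlost _ hmem p₄ h4p.1 p₅ h5.1 (by simp at hnd'; tauto) (by simp [h4p]) (by simp [h5]) rfl
    have e₂ : c s(r₁, r₂) ∉ [c s(p₁, p₂), c s(p₂, p₃), c s(p₃, p₄)] := fun hmem =>
      hlost _ hmem r₁ h6.1 r₂ h7.1 (by simp at hnd'; tauto) (by simp [h6]) (by simp [h7]) rfl
    refine rainbowLF_of_two ht h.rainbowBip hs (by omega) hij [p₁, p₂, p₃, p₄, p₅] [r₁, r₂] 0 0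
      ?_ ?_ (Or.inl (by simp; omega)) (Or.inl (by simp; omega)) ?_ (by simp; omega)
    · simp at hnd hnd' ⊢
      simp [*, Ne.symm]
    · simp at hcnd e₁ e₂ ⊢
      simp [*, Ne.symm]
    · simp only [List.countP_cons, List.countP_nil] at hcount ⊢
      simp only [h1.2.1, h2.2.1, h3.2.1, decide_false, Bool.false_eq_true, if_false]
      omega
  obtain ⟨w₁, hw₁, w₂, hw₂, hT₁, hT₂, hw⟩ := exists_pair_of_card (W := W) (T := {p₄})
    (by simp; omega)
  obtain ⟨w₃, hw₃, w₄, hw₄, hT₃, hT₄, hw'⟩ := exists_pair_of_card (W := W) (T := {p₄, w₁, w₂})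
    (by have : ({p₄, w₁, w₂} : Finset (Fin n)).card ≤ 3 := card_le_three
        omega)
  simp only [mem_insert, mem_singleton, not_or] at hT₁ hT₂ hT₃ hT₄
  by_cases hpA : p₄ ∈ A
  · obtain ⟨w, hwW, hw4, hww₁, hww₂, hwc⟩ : ∃ w ∈ W, w ≠ p₄ ∧ w ≠ w₁ ∧ w ≠ w₂ ∧
        c s(p₄, w) ≠ c s(w₁, w₂) := by
      rcases h.rainbowBip.exists_end hw₃ hw₄ hw' (c s(w₁, w₂)) with he | he
      · exact ⟨w₃, hw₃, hT₃.1, hT₃.2.1, hT₃.2.2, by rw [Sym2.eq_swap]; exact he _ hpA⟩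
      · exact ⟨w₄, hw₄, hT₄.1, hT₄.2.1, hT₄.2.2, by rw [Sym2.eq_swap]; exact he _ hpA⟩
    refine finish w w₁ w₂ (hWp w hwW) (hWp _ hw₁) (hWp _ hw₂) ?_ hwc ?_
    · simp [*, Ne.symm, Ne.symm hT₁, Ne.symm hT₂]
    · simp [*]
  obtain ⟨a, ha⟩ := card_pos.1 (show 0 < A.card by omega)
  have hap : a ≠ p₄ := fun he => hpA (he ▸ ha)
  have haW : ∀ w ∈ W, a ≠ w := fun w hw he => hWA w hw (he ▸ ha)
  by_cases hpW : p₄ ∈ W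
  · obtain ⟨v₁, hv₁, v₂, hv₂, hS₁, hS₂, hv, hc⟩ := h.exists_pair p₄ hpW a ha {p₄} (by simp)
    simp only [mem_singleton] at hS₁ hS₂
    refine finish a v₁ v₂ (hAp a ha) (hWp _ hv₁) (hWp _ hv₂) ?_ hc.symm ?_
    · simp [hap.symm, Ne.symm hS₁, Ne.symm hS₂, haW _ hv₁, haW _ hv₂, hv]
    · simp [hpA, hWA _ hv₁, hWA _ hv₂, ha]
  · obtain ⟨w, hwW, hw4, hww₁, hwc⟩ : ∃ w ∈ W, w ≠ p₄ ∧ w ≠ w₁ ∧ c s(p₄, w₁) ≠ c s(a, w) := by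
      rcases h.rainbowBip.exists_end hw₃ hw₄ hw' (c s(p₄, w₁)) with he | he
      · exact ⟨w₃, hw₃, hT₃.1, hT₃.2.1, by rw [Sym2.eq_swap (a := a)]; exact (he _ ha).symm⟩
      · exact ⟨w₄, hw₄, hT₄.1, hT₄.2.1, by rw [Sym2.eq_swap (a := a)]; exact (he _ ha).symm⟩
    refine finish w₁ a w (hWp _ hw₁) (hAp a ha) (hWp w hwW) ?_ hwc ?_
    · simp [hap.symm, Ne.symm hT₁, hw4.symm, (haW _ hw₁).symm, haW w hwW, hww₁.symm]
    · simp [hpA, hWA _ hw₁, hWA _ hwW, ha]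

lemma IsCritical.rainbowLF_of_five_two (h : IsCritical c A W U 1 r) (ht : ∀ i, 2 ≤ t i)
    (hs : s = ∑ i, t i / 2) (hs3 : s = 3) {i j : Fin k} (hij : j ≠ i) (hi : t i = 2) (hj : t j = 5)
    {u x v : Fin n} (hu : u ∈ U \ (A ∪ W)) (hx : x ∈ U \ (A ∪ W)) (hv : v ∈ U \ (A ∪ W))
    (hux : u ≠ x) (hxv : x ≠ v) (huv : u ≠ v) (hcu : IsPrivate c U x (c s(u, x)))
    (hcv : IsPrivate c U x (c s(x, v))) (hne : c s(u, x) ≠ c s(x, v)) : RainbowLF n c t := by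
  have hU : u ∈ U ∧ x ∈ U ∧ v ∈ U := by simp at hu hx hv; tauto
  by_cases hex : ∃ y ∈ U, y ≠ u ∧ y ≠ x ∧ y ≠ v ∧ IsPrivate c U v (c s(v, y))
  · obtain ⟨y, hy, hyu, hyx, hyv, hp⟩ := hex
    have e₁ := hcu.ne hU.2.2 hy hyv.symm hxv.symm hyx
    have e₂ := hcv.ne hU.2.2 hy hyv.symm hxv.symm hyx
    refine h.rainbowLF_of_lost ht hs hs3 hij hi hj hu hx hv hy ?_ ?_ ?_
    · simp [*, Ne.symm]
    · simp [*, Ne.symm]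
    · intro γ hγ b hb d hd hbd hbS hdS
      simp only [List.mem_cons, List.not_mem_nil, or_false, not_or] at hγ hbS hdS
      rcases hγ with rfl | rfl | rfl
      · exact hcu.ne hb hd hbd hbS.2.1 hdS.2.1
      · exact hcv.ne hb hd hbd hbS.2.1 hdS.2.1
      · exact hp.ne hb hd hbd hbS.2.2 hdS.2.2
  push Not at hex
  have hvΓ : 1 + 1 ≤ (cols c U \ cols c (U \ {v})).card := by
    simp only [mem_sdiff, mem_union, not_or] at hv
    exact h.succ_le_card_lost hv.1 hv.2.1 hv.2.2
  have hsub : cols c U \ cols c (U \ {v}) ⊆ {c s(v, u), c s(x, v)} := by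
    intro γ hγ
    obtain ⟨hp, y, hy, hyv, rfl⟩ := exists_of_mem_cols_sdiff hγ
    by_cases hyu : y = u
    · simp [hyu]
    by_cases hyx : y = x
    · simp [hyx, Sym2.eq_swap]
    · exact (hex y hy hyu hyx hyv hp).elim
  have hcard := card_le_card hsub
  have hcard' : ({c s(v, u), c s(x, v)} : Finset ℕ).card ≤ 2 := card_le_two
  have hvu : IsPrivate c U v (c s(v, u)) :=
    (exists_of_mem_cols_sdiff (eq_of_subset_of_card_le hsub (by omega) ▸ mem_insert_self _ _)).1
  obtain ⟨κ, hκ, hκ'⟩ : ∃ κ ∈ cols c U \ cols c (U \ {u, x, v}),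
      κ ∉ ({c s(u, x), c s(x, v), c s(v, u)} : Finset ℕ) := by
    have hlost := h.le_lost {u, x, v} (by simp [insert_subset_iff, hU])
      (by simp at hu hx hv; simp [hu, hx, hv]) (by simp at hu hx hv; simp [hu, hx, hv]) (by simp)
    have h3 : ({u, x, v} : Finset (Fin n)).card = 3 := card_eq_three.2 ⟨u, x, v, hux, huv, hxv, rfl⟩
    by_contra! hcon
    have h4 := card_le_card (subset_iff.2 hcon)
    have h5 : ({c s(u, x), c s(x, v), c s(v, u)} : Finset ℕ).card ≤ 3 := card_le_three
    omega
  simp only [mem_insert, mem_singleton, not_or] at hκ'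
  rw [mem_sdiff] at hκ
  have hκlost : ∀ y ∈ U, ∀ z ∈ U, y ≠ z → y ∉ [u, x, v] → z ∉ [u, x, v] → c s(y, z) ≠ κ := by
    intro y hy z hz hyz hyS hzS he
    exact hκ.2 (mem_cols.2 ⟨y, by simp at hyS; simp [hy, hyS], z, by simp at hzS; simp [hz, hzS],
      hyz, he⟩)
  have hvune : c s(v, u) ≠ c s(u, x) ∧ c s(v, u) ≠ c s(x, v) :=
    ⟨hcu.ne hU.2.2 hU.1 huv.symm hxv.symm hux, hcv.ne hU.2.2 hU.1 huv.symm hxv.symm hux⟩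
  obtain ⟨y, hy, z, hz, hyz, hyS, hc⟩ : ∃ y ∈ U, ∃ z ∈ U, y ≠ z ∧ y ∈ [u, x, v] ∧ c s(y, z) = κ := by
    obtain ⟨y, hy, z, hz, hyz, hc⟩ := mem_cols.1 hκ.1
    by_cases hyS : y ∈ [u, x, v]
    · exact ⟨y, hy, z, hz, hyz, hyS, hc⟩
    by_cases hzS : z ∈ [u, x, v]
    · exact ⟨z, hz, y, hy, hyz.symm, hzS, by rw [Sym2.eq_swap, hc]⟩
    · exact (hκlost y hy z hz hyz hyS hzS hc).elim
  have hlost : ∀ γ ∈ [c s(u, x), c s(x, v), c s(v, u), κ], ∀ y ∈ U, ∀ z ∈ U, y ≠ z →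
      y ∉ [u, x, v] → z ∉ [u, x, v] → c s(y, z) ≠ γ := by
    intro γ hγ y hy z hz hyz hyS hzS
    simp only [List.mem_cons, List.not_mem_nil, or_false] at hγ
    rcases hγ with rfl | rfl | rfl | rfl
    · simp at hyS hzS
      exact hcu.ne hy hz hyz hyS.2.1 hzS.2.1
    · simp at hyS hzS
      exact hcv.ne hy hz hyz hyS.2.1 hzS.2.1
    · simp at hyS hzS
      exact hvu.ne hy hz hyz hyS.2.2 hzS.2.2
    · exact hκlost y hy z hz hyz hyS hzS
  have hzS : z ≠ u ∧ z ≠ x ∧ z ≠ v := by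
    simp only [List.mem_cons, List.not_mem_nil, or_false] at hyS
    have s₁ : s(x, u) = s(u, x) := Sym2.eq_swap
    have s₂ : s(v, x) = s(x, v) := Sym2.eq_swap
    have s₃ : s(u, v) = s(v, u) := Sym2.eq_swap
    rcases hyS with rfl | rfl | rfl <;> refine ⟨?_, ?_, ?_⟩ <;> rintro rfl <;> simp_all
  have final : ∀ p₁ p₂ p₃ : Fin n, [p₁, p₂, p₃].Perm [u, x, v] → y = p₃ →
      [c s(p₁, p₂), c s(p₂, p₃)].Nodup →
      (∀ γ ∈ [c s(p₁, p₂), c s(p₂, p₃)], γ ∈ [c s(u, x), c s(x, v), c s(v, u)]) →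
      RainbowLF n c t := by
    rintro p₁ p₂ _ hperm rfl hcnd hmem
    have hX : ∀ p ∈ [p₁, p₂, y], p ∈ U \ (A ∪ W) := by
      intro p hp
      have := hperm.mem_iff.1 hp
      simp only [List.mem_cons, List.not_mem_nil, or_false] at this
      rcases this with rfl | rfl | rfl <;> assumption
    refine h.rainbowLF_of_lost ht hs hs3 hij hi hj (hX p₁ (by simp)) (hX p₂ (by simp))
      (hX y (by simp)) hz ?_ ?_ ?_
    · change ([p₁, p₂, y] ++ [z]).Nodup
      rw [(hperm.append_right _).nodup_iff]
      simp [*, Ne.symm]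
    · change ([c s(p₁, p₂), c s(p₂, y)] ++ [c s(y, z)]).Nodup
      rw [List.nodup_append', hc, List.disjoint_singleton]
      refine ⟨hcnd, by simp, fun hmem' => ?_⟩
      have := hmem _ hmem'
      simp at this
      tauto
    · intro γ hγ b hb d hd hbd hbS hdS
      rw [hperm.mem_iff] at hbS hdS
      refine hlost γ ?_ b hb d hd hbd hbS hdS
      rw [hc] at hγ
      change γ ∈ [c s(p₁, p₂), c s(p₂, y)] ++ [κ] at hγ
      change γ ∈ [c s(u, x), c s(x, v), c s(v, u)] ++ [κ]
      rw [List.mem_append] at hγ ⊢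
      exact hγ.imp_left (hmem γ)
  have s₂ : s(v, x) = s(x, v) := Sym2.eq_swap
  have s₃ : s(u, v) = s(v, u) := Sym2.eq_swap
  have hyS' := hyS
  simp only [List.mem_cons, List.not_mem_nil, or_false] at hyS'
  rcases hyS' with hy' | hy' | hy'
  · refine final x v u ?_ hy' ?_ ?_
    · rw [List.perm_iff_count]; intro b; simp [List.count_cons]; omega
    · simpa using hvune.2.symm
    · simp
  · refine final u v x ?_ hy' ?_ ?_
    · rw [List.perm_iff_count]; intro b; simp [List.count_cons]; omega
    · simpa [s₂, s₃] using hvune.2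
    · simp [s₂, s₃]
  · refine final u x v (List.Perm.refl _) hy' ?_ ?_
    · simpa using hne
    · simp

end

section
variable {n k : ℕ} {c : Sym2 (Fin n) → ℕ} {t : Fin k → ℕ} {A W U : Finset (Fin n)} {s q ε r : ℕ}

lemma IsCritical.rainbowLF_of_two_private (h : IsCritical c A W U q r) (hk : 2 ≤ k)
    (ht : ∀ i, 2 ≤ t i) (heven : ∃ i, Even (t i)) (hs : s = ∑ i, t i / 2) (hq : s = q + 2)
    {x u v : Fin n} (hx : x ∈ U) (hxA : x ∉ A) (hxW : x ∉ W) (hu : u ∈ U \ A) (hv : v ∈ U \ A)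
    (hxu : x ≠ u) (hxv : x ≠ v) (hpu : IsPrivate c U x (c s(x, u)))
    (hpv : IsPrivate c U x (c s(x, v))) (hne : c s(x, u) ≠ c s(x, v)) : RainbowLF n c t := by
  by_contra hF
  obtain ⟨i₁, i₂, hi, hev⟩ : ∃ i₁ i₂ : Fin k, i₁ ≠ i₂ ∧ Even (t i₂) := by
    obtain ⟨i, hi⟩ := heven
    have : Nontrivial (Fin k) := Fin.nontrivial_iff_two_le.2 hk
    obtain ⟨j, hj⟩ := exists_ne i
    exact ⟨j, i, hj, hi⟩
  have huv : u ≠ v := by rintro rfl; exact hne rfl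
  have hxX : x ∈ U \ (A ∪ W) := by simp [hx, hxA, hxW]
  have hx' : x ∈ U \ A := by simp [hx, hxA]
  have hpu' : IsPrivate c U x (c s(u, x)) := by rwa [Sym2.eq_swap]
  have hpv' : IsPrivate c U x (c s(v, x)) := by rwa [Sym2.eq_swap]
  have hne' : c s(u, x) ≠ c s(x, v) := by rwa [Sym2.eq_swap (a := u)]
  have hne'' : c s(v, x) ≠ c s(x, u) := by rw [Sym2.eq_swap (a := v)]; exact hne.symm
  have hAn : A.Nonempty := by
    by_contra hA
    exact hF (h.rainbowLF_of_path ht hs hq hi hev hu hx' hv hxu.symm huv hxv (Or.inr hpu') hpv hne'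
      fun hA' => (hA hA').elim)
  have hvW : v ∉ W := fun hvW =>
    hF (h.rainbowLF_of_path ht hs hq hi hev hu hx' hv hxu.symm huv hxv (Or.inr hpu') hpv hne'
      fun _ => Or.inl hvW)
  have huW : u ∉ W := fun huW =>
    hF (h.rainbowLF_of_path ht hs hq hi hev hv hx' hu hxv.symm huv.symm hxu (Or.inr hpv') hpu hne''
      fun _ => Or.inl huW)
  have huX : u ∈ U \ (A ∪ W) := by simp at hu; simp [hu, huW]
  have hvX : v ∈ U \ (A ∪ W) := by simp at hv; simp [hv, hvW]
  have hend : ∀ y ∈ U, y ≠ v → IsPrivate c U v (c s(v, y)) → y ∉ A ∪ W := fun y hy hyv hp =>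
    h.notMem_of_isPrivate ht hs hq hi hev hF hu hxX hv hxu.symm huv hxv (Or.inr hpu') hpv hne' hy
      hyv hp
  have hq1 : 1 ≤ q := h.card_hub ▸ hAn.card_pos
  obtain ⟨z, z', l, hl, hnd, hX, hch, -⟩ := h.exists_isPrivateChain ht hs hq hi hev hF hxX hvX hxv
    hpv' hend q le_rfl
  have hlen : (z :: z' :: l).length = s := by simp [hl, hq]
  rcases exists_le_sum_half hk ht heven hs (by omega) with ⟨j, i, hji, hj, hor⟩ | ⟨j, i, hji, h2, hj⟩
  · exact hF (h.rainbowLF_of_isPrivateChain ht hs hq hji hch hnd hX hlen hj hor)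
  · by_cases hq2 : 2 ≤ q
    · exact hF (h.rainbowLF_of_isPrivateChain_of_eq_two ht hs hq hq2 hji hch hnd hX hlen h2 hj)
    · obtain rfl : q = 1 := by omega
      exact hF (h.rainbowLF_of_five_two ht hs (by omega) hji h2 (by omega) huX hxX hvX hxu.symm hxv
        huv hpu' hpv hne')

lemma IsCritical.rainbowLF (h : IsCritical c A W U q (2 + ε)) (hk : 2 ≤ k) (ht : ∀ i, 2 ≤ t i)
    (heven : ∃ i, Even (t i))
    (hε : ε = if (Finset.univ.filter fun i => Even (t i)).card = 1 then 1 else 0)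
    (hs : s = ∑ i, t i / 2) (hq : s = q + 2) : RainbowLF n c t := by
  by_contra hF
  have hWU : W ⊆ U \ A := subset_sdiff.2 ⟨h.subset, h.rainbowBip.1.symm⟩
  have hcard := h.le_card
  have hWc := card_le_card hWU
  refine hF (rainbowLF_of_clean hk ht heven hε hs hq h.card_hub h.hub_subset
    (h.rainbowBip_sdiff ?_) (by omega) h.le_cols)
  intro x hx hxA hxW u hu v hv hxu hxv hpu hpv
  by_contra hne
  exact hF (h.rainbowLF_of_two_private hk ht heven hs hq hx hxA hxW hu hv hxu hxv hpu hpv hne)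

end

/-- Main theorem: the anti-Ramsey number of a linear forest containing an
even path, for sufficiently large `n`. -/
theorem stmt_8 (k : ℕ) (hk : 2 ≤ k) (t : Fin k → ℕ) (ht : ∀ i, 2 ≤ t i)
    (heven : ∃ i, Even (t i)) (s ε : ℕ) (hs : s = ∑ i, t i / 2)
    (hε : ε = if (Finset.univ.filter fun i => Even (t i)).card = 1 then 1 else 0) :
    ∃ N : ℕ, ∀ n : ℕ, N ≤ n →
      IsGreatest
        {M | ∃ c : Sym2 (Fin n) → ℕ, colorCount n c = M ∧ ¬ RainbowLF n c t}
        (Nat.choose (s - 2) 2 + (s - 2) * (n - s + 2) + 1 + ε) := by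
  have h2 : 2 ≤ s := by
    have h := half_add_half_le_sum t
      (show (⟨0, by omega⟩ : Fin k) ≠ ⟨1, by omega⟩ by simp)
    have h0 := ht ⟨0, by omega⟩
    have h1 := ht ⟨1, by omega⟩
    omega
  obtain ⟨q, rfl⟩ : ∃ q, s = q + 2 := ⟨s - 2, by omega⟩
  obtain ⟨n₀, hn₀⟩ := rainbowLF_or_exists_rainbowBip ht heven hs rfl (10 * q + 120)
  refine ⟨max n₀ (q + 3), fun n hn => ⟨exists_extremal_coloring ht h2 hs hε (by omega), ?_⟩⟩
  rintro M ⟨c, rfl, hc⟩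
  by_contra! hlt
  rw [Nat.add_sub_cancel, show n - (q + 2) + 2 = n - q by omega] at hlt
  obtain ⟨A, W, hA, hW, hAW⟩ := (hn₀ n (by omega) c (by omega)).resolve_left hc
  obtain ⟨W', U, h⟩ := exists_isCritical (r := 2 + ε) hAW hA hW (by omega)
  exact hc (h.rainbowLF hk ht heven hε hs rfl)
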